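/- Let p ≥ 2, p' = p/(p−1) and γ(p) = p'(p'−1)/8. For every d ∈ ℕ, every multi-index α ∈ [0,∞)^d, every f ∈ C_c^∞(ℝ_+^d) and all nonnegative g_1,…,g_d ∈ C_c^∞(ℝ_+^d), one has |Σ_{i=1}^d ∫_{ℝ_+^d} R_{α,i} f(x) g_i(x) x^{2α} dx| ≤ 2 ((1+γ(p))/γ(p)) ((p/p')^{1/p} + (p'/p)^{1/p'}) ‖f‖_{L^p(ℝ_+^d, x^{2α}dx)} ‖(Σ_{i=1}^d g_i²)^{1/2}‖_{L^{p'}(ℝ_+^d, x^{2α}dx)}. -/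

import Mathlib

open MeasureTheory Real Filter Set
open scoped ENNReal BigOperators

noncomputable section

/-- The open positive orthant `(0,∞)^d`. -/
def posOrth (d : ℕ) : Set (Fin d → ℝ) := {x | ∀ j, 0 < x j}

/-- The weighted measure `x^{2α} dx` on the positive orthant. -/
def wMeasure (d : ℕ) (α : Fin d → ℝ) : Measure (Fin d → ℝ) :=
  (volume.restrict (posOrth d)).withDensity
    (fun x => ENNReal.ofReal (∏ j, (x j) ^ (2 * α j)))

/-- The Bessel function of the first kind of order `μ`. -/
def besselJ (μ : ℝ) (z : ℝ) : ℝ :=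
  ∑' k : ℕ, ((-1 : ℝ) ^ k / ((k.factorial : ℝ) * Real.Gamma ((k : ℝ) + μ + 1))) *
    (z / 2) ^ (2 * (k : ℝ) + μ)

/-- The modified Bessel function of the first kind of order `μ`. -/
def besselI (μ : ℝ) (z : ℝ) : ℝ :=
  ∑' k : ℕ, (1 / ((k.factorial : ℝ) * Real.Gamma ((k : ℝ) + μ + 1))) *
    (z / 2) ^ (2 * (k : ℝ) + μ)

/-- The eigenfunctions `φ_y^α(x) = ∏_j (x_j y_j)^{-α_j+1/2} J_{α_j-1/2}(x_j y_j)`. -/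
def phiFn (d : ℕ) (α : Fin d → ℝ) (y x : Fin d → ℝ) : ℝ :=
  ∏ j, ((x j * y j) ^ (-(α j) + 1 / 2) * besselJ (α j - 1 / 2) (x j * y j))

/-- The Hankel transform `h_α f(x) = ∫ φ_y^α(x) f(y) y^{2α} dy`. -/
def hankel (d : ℕ) (α : Fin d → ℝ) (f : (Fin d → ℝ) → ℝ) (x : Fin d → ℝ) : ℝ :=
  ∫ y, phiFn d α y x * f y ∂(wMeasure d α)

/-- The Euclidean norm on `Fin d → ℝ`. -/
def eNorm (d : ℕ) (x : Fin d → ℝ) : ℝ := Real.sqrt (∑ j, (x j) ^ 2)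

/-- The `i`-th Bessel–Riesz transform
`R_{α,i} f(x) = -x_i h_{α+e_i}((1/|y|) h_α f(y))(x)`. -/
def riesz (d : ℕ) (α : Fin d → ℝ) (i : Fin d) (f : (Fin d → ℝ) → ℝ)
    (x : Fin d → ℝ) : ℝ :=
  -(x i) * hankel d (α + Pi.single i 1) (fun y => (1 / eNorm d y) * hankel d α f y) x

/-- The Bessel–Poisson semigroup `P_t^α f = h_α(e^{-|·|t} h_α f)`. -/
def poissonH (d : ℕ) (α : Fin d → ℝ) (t : ℝ) (f : (Fin d → ℝ) → ℝ) :
    (Fin d → ℝ) → ℝ :=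
  hankel d α (fun y => Real.exp (-(eNorm d y) * t) * hankel d α f y)

/-- The `i`-th conjugate Poisson semigroup
`ℙ_t^{α,i} g(x) = x_i h_{α+e_i}(e^{-|y|t} h_{α+e_i}(g(·)/·_i)(y))(x)`. -/
def conjPoissonH (d : ℕ) (α : Fin d → ℝ) (i : Fin d) (t : ℝ)
    (g : (Fin d → ℝ) → ℝ) (x : Fin d → ℝ) : ℝ :=
  x i * hankel d (α + Pi.single i 1)
    (fun y => Real.exp (-(eNorm d y) * t) *
      hankel d (α + Pi.single i 1) (fun z => g z / z i) y) x

/-- The Bessel heat kernel `𝒲_t^α(x,y)`. -/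
def heatK (d : ℕ) (α : Fin d → ℝ) (t : ℝ) (x y : Fin d → ℝ) : ℝ :=
  (2 * t) ^ (-(∑ j, α j) - (d : ℝ) / 2) *
    Real.exp (-((eNorm d x) ^ 2 + (eNorm d y) ^ 2) / (4 * t)) *
    ∏ j, ((x j * y j / (2 * t)) ^ (-(α j) + 1 / 2) *
      besselI (α j - 1 / 2) (x j * y j / (2 * t)))

/-- The Bessel–Poisson kernel `𝒫_t^α(x,y)` obtained by subordination. -/
def poissonK (d : ℕ) (α : Fin d → ℝ) (t : ℝ) (x y : Fin d → ℝ) : ℝ :=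
  (t / Real.sqrt (2 * Real.pi)) *
    ∫ u in Set.Ioi (0 : ℝ),
      u ^ (-(3 : ℝ) / 2) * Real.exp (-(t ^ 2) / (4 * u)) * heatK d α u x y

/-- The Poisson semigroup defined through the Poisson kernel. -/
def poissonOp (d : ℕ) (α : Fin d → ℝ) (t : ℝ) (f : (Fin d → ℝ) → ℝ)
    (x : Fin d → ℝ) : ℝ :=
  ∫ y, poissonK d α t x y * f y ∂(wMeasure d α)

/-- The partial derivative in the `i`-th coordinate. -/
def pd (d : ℕ) (i : Fin d) (F : (Fin d → ℝ) → ℝ) (x : Fin d → ℝ) : ℝ :=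
  deriv (fun s => F (Function.update x i s)) (x i)

/-- Smooth compactly supported functions on `(0,∞)^d`. -/
def CcInfPos (d : ℕ) (f : (Fin d → ℝ) → ℝ) : Prop :=
  ContDiff ℝ (⊤ : ℕ∞) f ∧ HasCompactSupport f ∧ tsupport f ⊆ posOrth d

/-- Coefficients of the even power series of the normalised Bessel function. -/
def besC (a : ℝ) (k : ℕ) : ℝ :=
  (-1 : ℝ) ^ k / ((k.factorial : ℝ) * Real.Gamma (k + a + 1 / 2)) *
    ((1 / 2 : ℝ) ^ (a - 1 / 2) * (1 / 4) ^ k)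

/-- The normalised Bessel function `z ^ (-a + 1/2) J_{a - 1/2}(z)`, as an even entire function. -/
def bes (a z : ℝ) : ℝ := ∑' k : ℕ, besC a k * z ^ (2 * k)

lemma besC_succ {a : ℝ} (ha : 0 ≤ a) (k : ℕ) :
    besC a (k + 1) = -(besC a k / (4 * (k + 1) * (k + a + 1 / 2))) := by
  have h1 : Real.Gamma (((k + 1 : ℕ) : ℝ) + a + 1 / 2)
      = (k + a + 1 / 2) * Real.Gamma (k + a + 1 / 2) := by
    rw [← Real.Gamma_add_one (by positivity)]; congr 1; push_cast; ring
  have h2 : Real.Gamma (k + a + 1 / 2) ≠ 0 := (Real.Gamma_pos_of_pos (by positivity)).ne'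
  have h3 : (k.factorial : ℝ) ≠ 0 := by positivity
  have h4 : (k + a + 1 / 2 : ℝ) ≠ 0 := by positivity
  have h5 : (k + 1 : ℝ) ≠ 0 := by positivity
  unfold besC
  rw [h1, Nat.factorial_succ]
  push_cast
  generalize Real.Gamma (k + a + 1 / 2) = G at *
  field_simp
  ring

lemma besC_add_one {a : ℝ} (ha : 0 ≤ a) (k : ℕ) :
    besC a k = (2 * a + 1 + 2 * k) * besC (a + 1) k := by
  have h1 : Real.Gamma ((k : ℝ) + (a + 1) + 1 / 2)
      = (k + a + 1 / 2) * Real.Gamma (k + a + 1 / 2) := by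
    rw [← Real.Gamma_add_one (by positivity)]; congr 1; ring
  have h2 : Real.Gamma (k + a + 1 / 2) ≠ 0 := (Real.Gamma_pos_of_pos (by positivity)).ne'
  have h3 : (k.factorial : ℝ) ≠ 0 := by positivity
  have h4 : (k + a + 1 / 2 : ℝ) ≠ 0 := by positivity
  have h5 : (1 / 2 : ℝ) ^ (a + 1 - 1 / 2) = (1 / 2 : ℝ) ^ (a - 1 / 2) * (1 / 2) := by
    rw [← Real.rpow_add_one (by norm_num)]; congr 1; ring
  unfold besC
  rw [h1, h5]
  generalize Real.Gamma (k + a + 1 / 2) = G at *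
  field_simp
  ring

lemma besC_succ' {a : ℝ} (ha : 0 ≤ a) (k : ℕ) :
    2 * (k + 1) * besC a (k + 1) = -besC (a + 1) k := by
  have h4 : (k + a + 1 / 2 : ℝ) ≠ 0 := by positivity
  have h5 : (k + 1 : ℝ) ≠ 0 := by positivity
  rw [besC_succ ha, besC_add_one ha]
  field_simp
  ring

lemma abs_besC_le {a : ℝ} (ha : 0 ≤ a) (k : ℕ) :
    |besC a k| ≤ |besC a 0| * ((1 / (4 * (a + 1 / 2))) ^ k / k.factorial) := by
  induction k with
  | zero => simp
  | succ k ih =>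
    rw [besC_succ ha, abs_neg, abs_div, abs_of_pos (show 0 < 4 * ((k : ℝ) + 1) * (k + a + 1 / 2) by positivity)]
    calc |besC a k| / (4 * ((k : ℝ) + 1) * (k + a + 1 / 2))
        ≤ |besC a 0| * ((1 / (4 * (a + 1 / 2))) ^ k / k.factorial) / (4 * ((k : ℝ) + 1) * (a + 1 / 2)) := by
          gcongr
          linarith [(Nat.cast_nonneg k : (0 : ℝ) ≤ k)]
      _ = _ := by
          rw [Nat.factorial_succ]; push_cast
          have h3 : (k.factorial : ℝ) ≠ 0 := by positivity
          have h2 : (4 * ((k : ℝ) + 1) * (a + 1 / 2))⁻¹ = (1 / (4 * (a + 1 / 2))) * (k + 1 : ℝ)⁻¹ := by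
            rw [mul_right_comm, mul_inv]; simp only [one_div]
          rw [div_eq_mul_inv, h2, pow_succ]
          field_simp

lemma summable_bes_abs {a : ℝ} (ha : 0 ≤ a) (z : ℝ) :
    Summable (fun k => |besC a k| * |z| ^ (2 * k)) := by
  refine Summable.of_nonneg_of_le (fun k => by positivity) (fun k => ?_)
    ((Real.summable_pow_div_factorial (1 / (4 * (a + 1 / 2)) * z ^ 2)).mul_left |besC a 0|)
  calc |besC a k| * |z| ^ (2 * k) ≤
      (|besC a 0| * ((1 / (4 * (a + 1 / 2))) ^ k / k.factorial)) * |z| ^ (2 * k) := by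
        gcongr; exact abs_besC_le ha k
    _ = _ := by rw [pow_mul, sq_abs, mul_pow]; ring

lemma summable_bes {a : ℝ} (ha : 0 ≤ a) (z : ℝ) :
    Summable (fun k => besC a k * z ^ (2 * k)) := by
  refine Summable.of_norm ((summable_bes_abs ha z).congr fun k => ?_)
  rw [norm_mul, norm_pow, Real.norm_eq_abs, Real.norm_eq_abs]

lemma bes_recurrence {a : ℝ} (ha : 0 ≤ a) (z : ℝ) :
    bes a z = (2 * a + 1) * bes (a + 1) z - z ^ 2 * bes (a + 2) z := by
  have h1 : HasSum (fun k : ℕ => -(2 * (k : ℝ) * besC (a + 1) k * z ^ (2 * k)))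
      (z ^ 2 * bes (a + 2) z) := by
    rw [← hasSum_nat_add_iff' 1]
    simp only [Finset.range_one, Finset.sum_singleton, Nat.cast_zero, mul_zero, zero_mul, neg_zero,
      sub_zero]
    refine ((summable_bes (show 0 ≤ a + 2 by linarith) z).hasSum.mul_left (z ^ 2)).congr_fun ?_
    intro k
    have := besC_succ' (show 0 ≤ a + 1 by linarith) k
    rw [show a + 1 + 1 = a + 2 by ring] at this
    rw [← neg_eq_iff_eq_neg] at this
    rw [← this]; push_cast; ring
  have h2 := (summable_bes (show 0 ≤ a + 1 by linarith) z).hasSum.mul_left (2 * a + 1)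
  refine ((summable_bes ha z).hasSum.unique ((h2.sub h1).congr_fun fun k => ?_))
  rw [besC_add_one ha]; ring

lemma hasDerivAt_bes {a : ℝ} (ha : 0 ≤ a) (z : ℝ) :
    HasDerivAt (bes a) (-(z * bes (a + 1) z)) z := by
  have ha1 : 0 ≤ a + 1 := by linarith
  have hR : |z| < |z| + 1 := by linarith
  set R := |z| + 1
  have hR0 : 0 ≤ R := by positivity
  have hterm : ∀ (k : ℕ) (y : ℝ), besC a (k + 1) * (((2 * (k + 1) : ℕ) : ℝ) * y ^ (2 * (k + 1) - 1))
      = -(y * (besC (a + 1) k * y ^ (2 * k))) := by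
    intro k y
    have := besC_succ' ha k
    rw [show 2 * (k + 1) - 1 = 2 * k + 1 by omega, pow_succ]
    push_cast
    linear_combination (y ^ (2 * k) * y) * this
  have key := hasDerivAt_tsum_of_isPreconnected
    (g := fun k y => besC a k * y ^ (2 * k))
    (g' := fun k y => besC a k * (((2 * k : ℕ) : ℝ) * y ^ (2 * k - 1)))
    (u := fun k => |besC a k * (((2 * k : ℕ) : ℝ) * R ^ (2 * k - 1))|)
    (t := Metric.ball (0 : ℝ) R) (y₀ := z) (y := z) ?_ Metric.isOpen_ball
    (convex_ball _ _).isPreconnected ?_ ?_ (by simpa using hR) (summable_bes ha z) (by simpa using hR)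
  · refine key.congr_deriv ?_
    have : HasSum (fun k => besC a k * (((2 * k : ℕ) : ℝ) * z ^ (2 * k - 1))) (-(z * bes (a + 1) z)) := by
      rw [← hasSum_nat_add_iff' 1]
      simp only [Finset.range_one, Finset.sum_singleton, mul_zero, Nat.cast_zero, zero_mul,
        sub_zero]
      exact ((summable_bes ha1 z).hasSum.mul_left z).neg.congr_fun fun k => hterm k z
    exact this.tsum_eq
  · rw [← summable_nat_add_iff 1]
    refine ((summable_bes_abs ha1 R).mul_left R).congr fun k => ?_
    rw [hterm, abs_neg, abs_mul, abs_mul, abs_of_nonneg hR0, abs_of_nonneg (pow_nonneg hR0 _)]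
  · intro k y _
    exact (hasDerivAt_pow (2 * k) y).const_mul _
  · intro k y hy
    have hy' : |y| ≤ R := by simpa using (mem_ball_zero_iff.1 hy).le
    rw [Real.norm_eq_abs, abs_mul, abs_mul, abs_mul, abs_mul, abs_pow, abs_pow, abs_of_nonneg hR0]
    gcongr

lemma continuous_bes {a : ℝ} (ha : 0 ≤ a) : Continuous (bes a) :=
  continuous_iff_continuousAt.2 fun z => (hasDerivAt_bes ha z).continuousAt

lemma bes_neg (a z : ℝ) : bes a (-z) = bes a z := by
  unfold bes; congr 1; ext k; rw [pow_mul, neg_sq, ← pow_mul]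

/-- The function `z ↦ z Φ_{a+1}(z) = -Φ_a'(z)`. -/
def bes' (a z : ℝ) : ℝ := z * bes (a + 1) z

lemma hasDerivAt_bes'_aux {a : ℝ} (ha : 0 ≤ a) (z : ℝ) :
    HasDerivAt (bes' a) (bes a z - 2 * a * bes (a + 1) z) z := by
  have h := (hasDerivAt_id z).mul (hasDerivAt_bes (show 0 ≤ a + 1 by linarith) z)
  refine h.congr_deriv ?_
  rw [bes_recurrence ha, show a + 1 + 1 = a + 2 by ring]; simp; ring

lemma bes_energy {a : ℝ} (ha : 0 ≤ a) (z : ℝ) : bes a z ^ 2 + bes' a z ^ 2 ≤ bes a 0 ^ 2 := by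
  wlog hz : 0 ≤ z generalizing z
  · have := this (-z) (by linarith)
    simpa [bes', bes_neg] using this
  have hd : ∀ y, HasDerivAt (fun z => bes a z ^ 2 + bes' a z ^ 2)
      (-(4 * a * y * bes (a + 1) y ^ 2)) y := by
    intro y
    refine (((hasDerivAt_bes ha y).pow 2).add ((hasDerivAt_bes'_aux ha y).pow 2)).congr_deriv ?_
    simp only [bes']; push_cast; ring
  have := antitoneOn_of_deriv_nonpos (convex_Ici (0 : ℝ))
    (fun y _ => (hd y).continuousAt.continuousWithinAt)
    (fun y _ => (hd y).differentiableAt.differentiableWithinAt)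
    (fun y hy => by
      rw [(hd y).deriv]
      have : 0 < y := by simpa using hy
      have : 0 ≤ 4 * a * y * bes (a + 1) y ^ 2 := by positivity
      linarith)
  have := this (mem_Ici.2 le_rfl) (mem_Ici.2 hz) hz
  simpa [bes'] using this

lemma abs_bes_le {a : ℝ} (ha : 0 ≤ a) (z : ℝ) : |bes a z| ≤ |bes a 0| :=
  sq_le_sq.1 (by nlinarith [bes_energy ha z, sq_nonneg (bes' a z)])

lemma abs_bes'_le {a : ℝ} (ha : 0 ≤ a) (z : ℝ) : |bes' a z| ≤ |bes a 0| :=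
  sq_le_sq.1 (by nlinarith [bes_energy ha z, sq_nonneg (bes a z)])

lemma besselJ_eq_bes {a z : ℝ} (hz : 0 < z) :
    z ^ (-a + 1 / 2) * besselJ (a - 1 / 2) z = bes a z := by
  unfold besselJ bes
  rw [← tsum_mul_left]
  congr 1; ext k
  unfold besC
  rw [show (k : ℝ) + (a - 1 / 2) + 1 = k + a + 1 / 2 by ring, div_eq_mul_inv z 2,
    Real.mul_rpow hz.le (by norm_num)]
  have h1 : z ^ (-a + 1 / 2) * z ^ (2 * (k : ℝ) + (a - 1 / 2)) = z ^ (2 * k) := by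
    rw [← Real.rpow_add hz, ← Real.rpow_natCast]; congr 1; push_cast; ring
  have h2 : (2⁻¹ : ℝ) ^ (2 * (k : ℝ) + (a - 1 / 2)) = (1 / 2) ^ (a - 1 / 2) * (1 / 4) ^ k := by
    rw [Real.rpow_add (by norm_num), Real.rpow_mul (by norm_num), Real.rpow_natCast]
    norm_num; ring
  rw [h2, ← h1]; ring

lemma bes_gaussian_moment {a s : ℝ} (ha : 0 ≤ a) (hs : 0 < s) (k : ℕ) :
    besC a k * ∫ x in Ioi (0 : ℝ), x ^ (2 * k + 2 * a) * exp (-(s / 2) * x ^ (2 : ℝ))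
      = s ^ (-a - 1 / 2) * ((-(1 / (2 * s))) ^ k / k.factorial) := by
  rw [integral_rpow_mul_exp_neg_mul_rpow (by norm_num)
    (by linarith [show 0 ≤ (k : ℝ) by positivity]) (by positivity)]
  rw [show (2 * (k : ℝ) + 2 * a + 1) / 2 = k + a + 1 / 2 by ring,
    show -(2 * (k : ℝ) + 2 * a + 1) / 2 = (-a - 1 / 2) + -k by ring]
  have h2 : Real.Gamma (k + a + 1 / 2) ≠ 0 := (Real.Gamma_pos_of_pos (by positivity)).ne'
  unfold besC
  rw [Real.rpow_add (by positivity), Real.rpow_neg (by positivity) (k : ℝ), Real.rpow_natCast,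
    div_eq_mul_one_div s 2, Real.mul_rpow hs.le (by norm_num)]
  have h3 : (1 / 2 : ℝ) ^ (a - 1 / 2) * (1 / 2) ^ (-a - 1 / 2) = 2 := by
    rw [← Real.rpow_add (by norm_num), show a - 1 / 2 + (-a - 1 / 2) = -1 by ring]
    norm_num [Real.rpow_neg_one]
  have h4 : (1 / 4 : ℝ) ^ k * ((s * (1 / 2)) ^ k)⁻¹ * (-1) ^ k = (-(1 / (2 * s))) ^ k := by
    rw [← inv_pow, ← mul_pow, ← mul_pow]; congr 1; field_simp; norm_num
  rw [← h4]
  generalize Real.Gamma (k + a + 1 / 2) = G at *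
  generalize (1 / 2 : ℝ) ^ (a - 1 / 2) = P at *
  generalize (1 / 2 : ℝ) ^ (-a - 1 / 2) = Q at *
  generalize ((s * (1 / 2)) ^ k)⁻¹ = W at *
  have h5 : (k.factorial : ℝ) ≠ 0 := by positivity
  field_simp
  linear_combination W * h3

lemma bes_gaussian {a s : ℝ} (ha : 0 ≤ a) (hs : 0 < s) (y : ℝ) :
    ∫ x in Ioi (0 : ℝ), x ^ (2 * a) * (bes a (x * y) * exp (-(s * x ^ 2 / 2)))
      = s ^ (-a - 1 / 2) * exp (-(y ^ 2 / (2 * s))) := by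
  have hfun : ∀ k : ℕ, ∀ x ∈ Ioi (0 : ℝ),
      x ^ (2 * a) * (besC a k * (x * y) ^ (2 * k) * exp (-(s * x ^ 2 / 2)))
        = (besC a k * (y ^ 2) ^ k) * (x ^ (2 * k + 2 * a) * exp (-(s / 2) * x ^ (2 : ℝ))) := by
    intro k x hx
    rw [Real.rpow_add hx, mul_pow, pow_mul y, show (2 * k : ℝ) = ((2 * k : ℕ) : ℝ) by push_cast; ring,
      Real.rpow_natCast, show x ^ (2 : ℝ) = x ^ 2 by norm_cast,
      show -(s * x ^ 2 / 2) = -(s / 2) * x ^ 2 by ring]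
    ring
  have hint : ∀ k : ℕ, IntegrableOn
      (fun x => x ^ (2 * a) * (besC a k * (x * y) ^ (2 * k) * exp (-(s * x ^ 2 / 2)))) (Ioi 0) := by
    intro k
    refine IntegrableOn.congr_fun ?_ (fun x hx => (hfun k x hx).symm) measurableSet_Ioi
    refine Integrable.const_mul ?_ _
    exact integrableOn_rpow_mul_exp_neg_mul_rpow
      (by linarith [show 0 ≤ (k : ℝ) by positivity]) (by norm_num) (by positivity)
  have hval : ∀ k : ℕ, ∫ x in Ioi (0 : ℝ),
      x ^ (2 * a) * (besC a k * (x * y) ^ (2 * k) * exp (-(s * x ^ 2 / 2)))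
      = s ^ (-a - 1 / 2) * ((-(y ^ 2 / (2 * s))) ^ k / k.factorial) := by
    intro k
    rw [setIntegral_congr_fun measurableSet_Ioi (hfun k), integral_const_mul, mul_right_comm,
      bes_gaussian_moment ha hs, show -(y ^ 2 / (2 * s)) = -(1 / (2 * s)) * y ^ 2 by ring, mul_pow]
    ring
  have hnorm : ∀ k : ℕ, ∫ x in Ioi (0 : ℝ),
      ‖x ^ (2 * a) * (besC a k * (x * y) ^ (2 * k) * exp (-(s * x ^ 2 / 2)))‖
      = s ^ (-a - 1 / 2) * ((y ^ 2 / (2 * s)) ^ k / k.factorial) := by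
    intro k
    have h1 : ∀ x ∈ Ioi (0 : ℝ),
        ‖x ^ (2 * a) * (besC a k * (x * y) ^ (2 * k) * exp (-(s * x ^ 2 / 2)))‖ =
        (-1) ^ k * (x ^ (2 * a) * (besC a k * (x * y) ^ (2 * k) * exp (-(s * x ^ 2 / 2)))) := by
      intro x hx
      have hx' : 0 < x := hx
      have h2 : |besC a k| = (-1) ^ k * besC a k := by
        have hG : 0 < Real.Gamma (k + a + 1 / 2) := Real.Gamma_pos_of_pos (by positivity)
        unfold besC
        rw [abs_mul, abs_div, abs_pow, abs_neg, abs_one, one_pow, abs_of_pos (by positivity),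
          abs_of_pos (by positivity)]
        have : ((-1 : ℝ) ^ k) * (-1) ^ k = 1 := by rw [← mul_pow]; norm_num
        linear_combination (-(1 / (k.factorial * Real.Gamma (k + a + 1 / 2)) * ((1 / 2) ^ (a - 1 / 2) * (1 / 4) ^ k))) * this
      rw [Real.norm_eq_abs, abs_mul, abs_mul, abs_mul, h2, abs_of_nonneg (by positivity),
        abs_of_nonneg (by rw [pow_mul]; positivity), abs_of_pos (exp_pos _)]
      ring
    rw [setIntegral_congr_fun measurableSet_Ioi h1, integral_const_mul, hval, neg_pow (y ^ 2 / (2 * s))]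
    have : ((-1 : ℝ) ^ k) * (-1) ^ k = 1 := by rw [← mul_pow]; norm_num
    generalize (y ^ 2 / (2 * s)) ^ k = Z
    linear_combination (s ^ (-a - 1 / 2) * (Z / k.factorial)) * this
  have hsum := hasSum_integral_of_summable_integral_norm (μ := volume.restrict (Ioi (0 : ℝ)))
    (F := fun k x => x ^ (2 * a) * (besC a k * (x * y) ^ (2 * k) * exp (-(s * x ^ 2 / 2))))
    hint (by simp_rw [hnorm]; exact (Real.summable_pow_div_factorial _).mul_left _)
  simp_rw [hval] at hsum
  have h3 : HasSum (fun k : ℕ => s ^ (-a - 1 / 2) * ((-(y ^ 2 / (2 * s))) ^ k / k.factorial))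
      (s ^ (-a - 1 / 2) * exp (-(y ^ 2 / (2 * s)))) := by
    refine HasSum.mul_left _ ?_
    rw [Real.exp_eq_exp_ℝ]
    exact NormedSpace.expSeries_div_hasSum_exp _
  rw [← hsum.unique h3]
  refine integral_congr_ae (Eventually.of_forall fun x => ?_)
  simp only [bes]
  rw [tsum_mul_left, tsum_mul_right]

lemma lintegral_fin_prod_eq_prod {n : ℕ} (μ : Fin n → Measure ℝ) [∀ i, SigmaFinite (μ i)]
    (f : Fin n → ℝ → ℝ≥0∞) (hf : ∀ i, Measurable (f i)) :
    ∫⁻ x, ∏ i, f i (x i) ∂(Measure.pi μ) = ∏ i, ∫⁻ x, f i x ∂(μ i) := by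
  induction n with
  | zero => simp
  | succ n ih =>
    have h := (measurePreserving_piFinSuccAbove μ 0).symm
    rw [← h.lintegral_comp_emb (MeasurableEquiv.measurableEmbedding _)]
    simp_rw [MeasurableEquiv.piFinSuccAbove_symm_apply, Fin.insertNthEquiv,
        Fin.prod_univ_succ, Fin.insertNth_zero]
    simp only [Fin.zero_succAbove, Equiv.coe_fn_mk, Fin.cons_zero, Fin.cons_succ, cast_eq]
    rw [lintegral_prod_mul (f := f 0) (g := fun x : Fin n → ℝ => ∏ i, f i.succ (x i))
      (hf 0).aemeasurable
      (Finset.measurable_prod _ fun i _ => (hf i.succ).comp (measurable_pi_apply i)).aemeasurable,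
      ih (fun i => μ i.succ) (fun i => f i.succ) (fun i => hf _)]

/-- The one dimensional measure `x ^ (2 * a) dx` on `(0,∞)`. -/
def wOne (a : ℝ) : Measure ℝ :=
  (volume.restrict (Ioi 0)).withDensity fun x => ENNReal.ofReal (x ^ (2 * a))

instance (a : ℝ) : SigmaFinite (wOne a) :=
  SigmaFinite.withDensity_ofReal _

lemma measurableSet_posOrth (d : ℕ) : MeasurableSet (posOrth d) := by
  unfold posOrth
  rw [Set.ofPred_forall]
  exact MeasurableSet.iInter fun j => measurableSet_lt measurable_const (measurable_pi_apply j)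

lemma posOrth_eq (d : ℕ) : posOrth d = Set.univ.pi fun _ => Ioi (0 : ℝ) := by
  ext x; simp [posOrth]

lemma wMeasure_eq_pi (d : ℕ) (α : Fin d → ℝ) :
    wMeasure d α = Measure.pi fun j => wOne (α j) := by
  symm
  refine Measure.pi_eq fun s hs => ?_
  unfold wMeasure wOne
  rw [withDensity_apply _ (MeasurableSet.univ_pi hs), Measure.restrict_restrict (MeasurableSet.univ_pi hs),
    posOrth_eq, ← Set.pi_inter_distrib, volume_pi, Measure.restrict_pi_pi]
  have : ∀ x ∈ Set.univ.pi fun _ : Fin d => Ioi (0 : ℝ), ENNReal.ofReal (∏ j, x j ^ (2 * α j))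
      = ∏ j, ENNReal.ofReal (x j ^ (2 * α j)) := by
    intro x hx
    refine ENNReal.ofReal_prod_of_nonneg fun j _ => ?_
    have : 0 < x j := hx j trivial
    positivity
  rw [← Measure.restrict_pi_pi, setLIntegral_congr_fun
    (MeasurableSet.univ_pi fun j => (hs j).inter measurableSet_Ioi)
    (g := fun x => ∏ j, ENNReal.ofReal (x j ^ (2 * α j)))
    (fun x hx => this x fun j _ => (hx j trivial).2), Measure.restrict_pi_pi,
    lintegral_fin_prod_eq_prod _ (fun j x => ENNReal.ofReal (x ^ (2 * α j))) fun j => by fun_prop]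
  refine Finset.prod_congr rfl fun j _ => ?_
  rw [withDensity_apply _ (hs j), Measure.restrict_restrict (hs j)]

instance (d : ℕ) (α : Fin d → ℝ) : SigmaFinite (wMeasure d α) := by
  rw [wMeasure_eq_pi]; infer_instance

lemma ae_posOrth (d : ℕ) (α : Fin d → ℝ) : ∀ᵐ x ∂(wMeasure d α), x ∈ posOrth d :=
  (withDensity_absolutelyContinuous _ _).ae_le (ae_restrict_mem (measurableSet_posOrth d))

lemma integral_wMeasure (d : ℕ) (α : Fin d → ℝ) (F : (Fin d → ℝ) → ℝ) :
    ∫ x, F x ∂(wMeasure d α) = ∫ x in posOrth d, (∏ j, x j ^ (2 * α j)) * F x := by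
  unfold wMeasure
  rw [integral_withDensity_eq_integral_toReal_smul (by fun_prop) (by simp)]
  refine setIntegral_congr_fun (measurableSet_posOrth d) fun x hx => ?_
  rw [ENNReal.toReal_ofReal, smul_eq_mul]
  exact Finset.prod_nonneg fun j _ => Real.rpow_nonneg (hx j).le _

lemma integrable_wMeasure_iff (d : ℕ) (α : Fin d → ℝ) (F : (Fin d → ℝ) → ℝ) :
    Integrable F (wMeasure d α) ↔
      IntegrableOn (fun x => (∏ j, x j ^ (2 * α j)) * F x) (posOrth d) := by
  unfold wMeasure
  rw [integrable_withDensity_iff_integrable_smul' (by fun_prop) (by simp)]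
  refine integrableOn_congr_fun (fun x hx => ?_) (measurableSet_posOrth d)
  rw [ENNReal.toReal_ofReal, smul_eq_mul]
  exact Finset.prod_nonneg fun j _ => Real.rpow_nonneg (hx j).le _

lemma integral_wOne (a : ℝ) (F : ℝ → ℝ) :
    ∫ x, F x ∂(wOne a) = ∫ x in Ioi 0, x ^ (2 * a) * F x := by
  unfold wOne
  rw [integral_withDensity_eq_integral_toReal_smul (by fun_prop) (by simp)]
  refine setIntegral_congr_fun measurableSet_Ioi fun x hx => ?_
  rw [ENNReal.toReal_ofReal (Real.rpow_nonneg (le_of_lt hx) _), smul_eq_mul]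

lemma integrable_wOne_iff (a : ℝ) (F : ℝ → ℝ) :
    Integrable F (wOne a) ↔ IntegrableOn (fun x => x ^ (2 * a) * F x) (Ioi 0) := by
  unfold wOne
  rw [integrable_withDensity_iff_integrable_smul' (by fun_prop) (by simp)]
  refine integrableOn_congr_fun (fun x hx => ?_) measurableSet_Ioi
  rw [ENNReal.toReal_ofReal (Real.rpow_nonneg (le_of_lt hx) _), smul_eq_mul]

lemma prod_rpow_add_single {d : ℕ} (α : Fin d → ℝ) (i : Fin d) {x : Fin d → ℝ} (hx : x ∈ posOrth d) :
    ∏ j, x j ^ (2 * (α + Pi.single i 1 : Fin d → ℝ) j) = (∏ j, x j ^ (2 * α j)) * x i ^ 2 := by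
  have : ∀ j, x j ^ (2 * (α + Pi.single i 1 : Fin d → ℝ) j)
      = x j ^ (2 * α j) * (if j = i then x i ^ 2 else 1) := by
    intro j
    rw [Pi.add_apply, mul_add, Real.rpow_add (hx j)]
    by_cases h : j = i
    · subst h; simp
    · simp [h]
  simp_rw [this, Finset.prod_mul_distrib]
  simp

lemma integral_wMeasure_add_single (d : ℕ) (α : Fin d → ℝ) (i : Fin d) (F : (Fin d → ℝ) → ℝ) :
    ∫ x, F x ∂(wMeasure d (α + Pi.single i 1)) = ∫ x, x i ^ 2 * F x ∂(wMeasure d α) := by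
  rw [integral_wMeasure, integral_wMeasure]
  refine setIntegral_congr_fun (measurableSet_posOrth d) fun x hx => ?_
  rw [prod_rpow_add_single α i hx]; ring

lemma integrable_wMeasure_add_single (d : ℕ) (α : Fin d → ℝ) (i : Fin d) (F : (Fin d → ℝ) → ℝ) :
    Integrable F (wMeasure d (α + Pi.single i 1)) ↔
      Integrable (fun x => x i ^ 2 * F x) (wMeasure d α) := by
  rw [integrable_wMeasure_iff, integrable_wMeasure_iff]
  refine integrableOn_congr_fun (fun x hx => ?_) (measurableSet_posOrth d)
  rw [prod_rpow_add_single α i hx]; ring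

/-- Squared Euclidean norm. -/
def nsq {d : ℕ} (x : Fin d → ℝ) : ℝ := ∑ j, x j ^ 2

lemma nsq_nonneg {d : ℕ} (x : Fin d → ℝ) : 0 ≤ nsq x := Finset.sum_nonneg fun _ _ => sq_nonneg _

@[fun_prop]
lemma continuous_nsq {d : ℕ} : Continuous (nsq : (Fin d → ℝ) → ℝ) := by unfold nsq; fun_prop

lemma sq_le_nsq {d : ℕ} (x : Fin d → ℝ) (i : Fin d) : x i ^ 2 ≤ nsq x :=
  Finset.single_le_sum (f := fun j => x j ^ 2) (fun _ _ => sq_nonneg _) (Finset.mem_univ i)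

lemma integrable_wOne_exp {a s : ℝ} (ha : 0 ≤ a) (hs : 0 < s) :
    Integrable (fun x => exp (-(s * x ^ 2))) (wOne a) := by
  rw [integrable_wOne_iff]
  have := integrableOn_rpow_mul_exp_neg_mul_sq hs (s := 2 * a) (by linarith)
  simpa using this

lemma integrable_wOne_inv {a : ℝ} (ha : 0 ≤ a) {M : ℕ} (hM : a + 1 ≤ M) :
    Integrable (fun x => ((1 + x ^ 2) ^ M)⁻¹) (wOne a) := by
  rw [integrable_wOne_iff]
  refine Integrable.mono' (integrable_inv_one_add_sq.integrableOn (s := Ioi 0)) (by fun_prop) ?_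
  refine (ae_restrict_mem measurableSet_Ioi).mono fun x hx => ?_
  have hx : 0 < x := hx
  rw [Real.norm_eq_abs, abs_of_nonneg (by positivity)]
  have h1 : x ^ (2 * a) ≤ (1 + x ^ 2) ^ a := by
    rw [Real.rpow_mul hx.le]
    refine Real.rpow_le_rpow (by positivity) ?_ ha
    rw [Real.rpow_two]; linarith
  have h2 : (1 + x ^ 2) ^ a * (1 + x ^ 2) ≤ (1 + x ^ 2) ^ M := by
    rw [← Real.rpow_add_one (by positivity), ← Real.rpow_natCast (1 + x ^ 2) M]
    exact Real.rpow_le_rpow_of_exponent_le (le_add_of_nonneg_right (sq_nonneg x)) hM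
  rw [← div_eq_mul_inv, div_le_iff₀ (by positivity), inv_mul_eq_div, le_div_iff₀ (by positivity)]
  nlinarith [sq_nonneg x]

section
variable {d : ℕ} {α : Fin d → ℝ}

lemma exp_nsq (s : ℝ) (x : Fin d → ℝ) : exp (-(s * nsq x)) = ∏ j, exp (-(s * x j ^ 2)) := by
  rw [← Real.exp_sum]; congr 1; unfold nsq; rw [Finset.mul_sum, Finset.sum_neg_distrib]

lemma integrable_exp_nsq (hα : ∀ j, 0 ≤ α j) {s : ℝ} (hs : 0 < s) :
    Integrable (fun x => exp (-(s * nsq x))) (wMeasure d α) := by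
  rw [wMeasure_eq_pi]
  simp_rw [exp_nsq]
  exact Integrable.fintype_prod_dep fun j => integrable_wOne_exp (hα j) hs

lemma exists_integrable_weight (hα : ∀ j, 0 ≤ α j) :
    ∃ N : ℕ, Integrable (fun x => ((1 + nsq x) ^ N)⁻¹) (wMeasure d α) := by
  obtain ⟨M, hM⟩ := exists_nat_ge (∑ j, α j + 1)
  have hM' : ∀ j, α j + 1 ≤ M := fun j =>
    le_trans (by gcongr; exact Finset.single_le_sum (fun j _ => hα j) (Finset.mem_univ j)) hM
  refine ⟨M * d, ?_⟩
  have h1 : Integrable (fun x => ∏ j, ((1 + x j ^ 2) ^ M)⁻¹) (wMeasure d α) := by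
    rw [wMeasure_eq_pi]
    exact Integrable.fintype_prod_dep fun j => integrable_wOne_inv (hα j) (hM' j)
  refine h1.mono' ?_ (Eventually.of_forall fun x => ?_)
  · exact (Measurable.inv (by fun_prop)).aestronglyMeasurable
  · have := nsq_nonneg x
    rw [Real.norm_eq_abs, abs_of_nonneg (by positivity), Finset.prod_inv_distrib]
    refine inv_anti₀ (Finset.prod_pos fun j _ => by positivity) ?_
    calc ∏ j, (1 + x j ^ 2) ^ M ≤ ∏ _j : Fin d, (1 + nsq x) ^ M :=
          Finset.prod_le_prod (fun j _ => by positivity) fun j _ => by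
            gcongr; exact sq_le_nsq x j
      _ = _ := by simp [pow_mul]

end

section
variable {d : ℕ} {α : Fin d → ℝ}

/-- Anisotropic Gaussians. -/
def gau (a : Fin d → ℝ) (x : Fin d → ℝ) : ℝ := exp (-∑ j, a j * x j ^ 2)

/-- `K` is orthogonal to all Gaussians. -/
def GaussNull (α : Fin d → ℝ) (K : (Fin d → ℝ) → ℝ) : Prop :=
  ∀ a : Fin d → ℝ, (∀ j, 0 < a j) →
    Integrable (fun x => K x * gau a x) (wMeasure d α) ∧ ∫ x, K x * gau a x ∂(wMeasure d α) = 0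

/-- Truncation to the closed orthant. -/
def toOrth (x : Fin d → ℝ) : Fin d → NNReal := fun j => (x j).toNNReal

lemma continuous_toOrth : Continuous (toOrth : (Fin d → ℝ) → _) :=
  continuous_pi fun j => continuous_real_toNNReal.comp (continuous_apply j)

/-- Bounded continuous multipliers preserving the functions orthogonal to all Gaussians. -/
def gaussMult (α : Fin d → ℝ) : StarSubalgebra ℝ (BoundedContinuousFunction (Fin d → NNReal) ℝ) where
  carrier := {φ | ∀ k, GaussNull α k → GaussNull α fun x => φ (toOrth x) * k x}
  mul_mem' := by
    intro φ ψ h1 h2 k hk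
    simpa [mul_assoc] using h1 _ (h2 _ hk)
  add_mem' := by
    intro φ ψ h1 h2 k hk a ha
    obtain ⟨i1, e1⟩ := h1 k hk a ha
    obtain ⟨i2, e2⟩ := h2 k hk a ha
    have : (fun x => (φ + ψ) (toOrth x) * k x * gau a x)
      = fun x => φ (toOrth x) * k x * gau a x + ψ (toOrth x) * k x * gau a x := by
      ext x; simp; ring
    rw [this]
    exact ⟨i1.add i2, by rw [integral_add i1 i2, e1, e2, add_zero]⟩
  algebraMap_mem' := by
    intro r k hk a ha
    obtain ⟨i1, e1⟩ := hk a ha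
    have : (fun x => (algebraMap ℝ (BoundedContinuousFunction (Fin d → NNReal) ℝ) r) (toOrth x) * k x * gau a x)
      = fun x => r * (k x * gau a x) := by
      ext x; simp [mul_assoc]
    rw [this]
    exact ⟨i1.const_mul r, by rw [integral_const_mul, e1, mul_zero]⟩
  star_mem' := by
    intro φ h k hk
    have : star φ = φ := by ext x; simp
    rw [this]
    exact h k hk

/-- The function `exp (-x_j^2)` on the closed orthant. -/
def expCoord (j : Fin d) : BoundedContinuousFunction (Fin d → NNReal) ℝ :=
  BoundedContinuousFunction.ofNormedAddCommGroup (fun y => exp (-((y j : ℝ) ^ 2)))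
    (by fun_prop) 1 (fun y => by
      rw [Real.norm_eq_abs, abs_of_pos (exp_pos _), Real.exp_le_one_iff]
      linarith [sq_nonneg (y j : ℝ)])

lemma expCoord_mem (j : Fin d) : expCoord j ∈ gaussMult α := by
  intro k hk a ha
  obtain ⟨i1, e1⟩ := hk (a + Pi.single j 1) fun l => by
    have : 0 ≤ (Pi.single j (1 : ℝ) : Fin d → ℝ) l := by
      by_cases h : l = j
      · subst h; simp
      · simp [h]
    have := ha l
    simp only [Pi.add_apply]; linarith
  have : (fun x => expCoord j (toOrth x) * k x * gau a x) =ᵐ[wMeasure d α]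
      fun x => k x * gau (a + Pi.single j 1) x := by
    filter_upwards [ae_posOrth d α] with x hx
    have h1 : expCoord j (toOrth x) = exp (-(x j ^ 2)) := by
      simp [expCoord, toOrth, (hx j).le]
    have h2 : gau (a + Pi.single j 1) x = gau a x * exp (-(x j ^ 2)) := by
      unfold gau
      rw [← Real.exp_add]; congr 1
      simp [add_mul, Finset.sum_add_distrib, Pi.single_apply]; ring
    rw [h1, h2]; ring
  exact ⟨i1.congr this.symm, by rw [integral_congr_ae this, e1]⟩

lemma gaussMult_separates :
    ((gaussMult α).map (BoundedContinuousFunction.toContinuousMapStarₐ ℝ)).SeparatesPoints := by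
  intro y z hyz
  obtain ⟨j, hj⟩ := Function.ne_iff.1 hyz
  refine ⟨_, ⟨_, ⟨expCoord j, expCoord_mem j, rfl⟩, rfl⟩, ?_⟩
  intro h
  apply hj
  have h := Real.exp_injective (show exp (-((y j : ℝ) ^ 2)) = exp (-((z j : ℝ) ^ 2)) from h)
  have := (sq_eq_sq₀ (y j).2 (z j).2).1 (neg_injective h)
  exact NNReal.coe_injective this

lemma GaussNull.ae_zero {K : (Fin d → ℝ) → ℝ} (hK : GaussNull α K) :
    K =ᵐ[wMeasure d α] 0 := by
  obtain ⟨hi, -⟩ := hK 1 (fun _ => one_pos)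
  set F := fun x => K x * gau 1 x with hF
  set μ := wMeasure d α
  let ν₁ := μ.withDensity fun x => ENNReal.ofReal (F x)
  let ν₂ := μ.withDensity fun x => ENNReal.ofReal (-F x)
  have : IsFiniteMeasure ν₁ := isFiniteMeasure_withDensity_ofReal hi.2
  have : IsFiniteMeasure ν₂ := isFiniteMeasure_withDensity_ofReal hi.neg.2
  have hmeas : Measurable (toOrth : (Fin d → ℝ) → _) := continuous_toOrth.measurable
  have hint : ∀ (φ : BoundedContinuousFunction (Fin d → NNReal) ℝ) (G : (Fin d → ℝ) → ℝ),
      Integrable G μ →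
      ∫ y, φ y ∂(Measure.map toOrth (μ.withDensity fun x => ENNReal.ofReal (G x)))
        = ∫ x, φ (toOrth x) * max (G x) 0 ∂μ := by
    intro φ G hG
    rw [integral_map hmeas.aemeasurable φ.continuous.aestronglyMeasurable,
      integral_withDensity_eq_integral_toReal_smul₀ hG.aemeasurable.ennreal_ofReal (by simp)]
    refine integral_congr_ae (Eventually.of_forall fun x => ?_)
    simp only [ENNReal.toReal_ofReal', smul_eq_mul]; ring
  have hintb : ∀ (φ : BoundedContinuousFunction (Fin d → NNReal) ℝ) (G : (Fin d → ℝ) → ℝ),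
      Integrable G μ → Integrable (fun x => φ (toOrth x) * G x) μ := by
    intro φ G hG
    exact hG.bdd_mul (c := ‖φ‖) (φ.continuous.comp continuous_toOrth).aestronglyMeasurable
      (Eventually.of_forall fun x => φ.norm_coe_le_norm _)
  have hmap : Measure.map toOrth ν₁ = Measure.map toOrth ν₂ := by
    refine ext_of_forall_mem_subalgebra_integral_eq_of_polish (𝕜 := ℝ) (A := gaussMult α)
      gaussMult_separates fun φ hφ => ?_
    have e2 := hint φ (fun x => -F x) hi.neg
    have i2 : Integrable (fun x => φ (toOrth x) * max (-F x) 0) μ := hintb φ _ hi.neg.pos_part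
    rw [hint φ F hi, e2, ← sub_eq_zero,
      ← integral_sub (hintb φ _ hi.pos_part) i2]
    refine Eq.trans ?_ (hφ K hK 1 (fun _ => one_pos)).2
    refine integral_congr_ae (Eventually.of_forall fun x => ?_)
    simp only [hF]
    rw [mul_assoc, ← mul_sub]; congr 1
    rcases le_total 0 (K x * gau 1 x) with h | h
    · rw [max_eq_left h, max_eq_right (by linarith), sub_zero]
    · rw [max_eq_right h, max_eq_left (by linarith)]; ring
  have hback : ∀ G : (Fin d → ℝ) → ℝ, Measure.map (fun (y : Fin d → NNReal) j => (y j : ℝ))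
      (Measure.map toOrth (μ.withDensity fun x => ENNReal.ofReal (G x)))
        = μ.withDensity fun x => ENNReal.ofReal (G x) := by
    intro G
    rw [Measure.map_map (by fun_prop) hmeas]
    conv_rhs => rw [← Measure.map_id (μ := μ.withDensity fun x => ENNReal.ofReal (G x))]
    refine Measure.map_congr ?_
    refine (withDensity_absolutelyContinuous _ _).ae_le ?_
    filter_upwards [ae_posOrth d α] with x hx
    ext j
    simp [toOrth, (hx j).le]
  have heq : ν₁ = ν₂ := by
    have h1 := hback F
    have h2 := hback fun x => -F x
    change Measure.map _ (Measure.map toOrth ν₁) = ν₁ at h1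
    change Measure.map _ (Measure.map toOrth ν₂) = ν₂ at h2
    rw [← h1, ← h2, hmap]
  have h1 := (withDensity_eq_iff hi.aemeasurable.ennreal_ofReal
    hi.neg.aemeasurable.ennreal_ofReal (by
      have := hi.lintegral_lt_top
      exact this.ne)).1 heq
  filter_upwards [h1] with x hx
  simp only [F] at hx
  have hg : 0 < gau 1 x := exp_pos _
  have h0 : K x * gau 1 x = 0 := by
    rcases lt_trichotomy (K x * gau 1 x) 0 with h | h | h
    · rw [ENNReal.ofReal_of_nonpos h.le] at hx
      have := ENNReal.ofReal_eq_zero.1 hx.symm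
      simp only [Pi.neg_apply] at this; linarith
    · exact h
    · simp only [Pi.neg_apply] at hx
      rw [ENNReal.ofReal_of_nonpos (by linarith : -(K x * gau 1 x) ≤ 0)] at hx
      have := ENNReal.ofReal_eq_zero.1 hx
      linarith
  simpa [hg.ne'] using h0

end

section
variable {d : ℕ} {α : Fin d → ℝ}

/-- The Hankel kernel, extended evenly to all of `ℝ^d × ℝ^d`. -/
def hker (α : Fin d → ℝ) (x y : Fin d → ℝ) : ℝ := ∏ j, bes (α j) (x j * y j)

/-- The Hankel transform with the extended kernel. -/
def ht (α : Fin d → ℝ) (f : (Fin d → ℝ) → ℝ) (x : Fin d → ℝ) : ℝ :=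
  ∫ y, hker α x y * f y ∂(wMeasure d α)

/-- A bound for the Hankel kernel. -/
def kerBound (α : Fin d → ℝ) : ℝ := ∏ j, |bes (α j) 0|

lemma hker_comm (x y : Fin d → ℝ) : hker α x y = hker α y x := by
  unfold hker; simp_rw [mul_comm]

lemma abs_ker_le (hα : ∀ j, 0 ≤ α j) (x y : Fin d → ℝ) : |hker α x y| ≤ kerBound α := by
  unfold hker kerBound
  rw [Finset.abs_prod]
  exact Finset.prod_le_prod (fun _ _ => abs_nonneg _) fun j _ => abs_bes_le (hα j) _

lemma continuous_ker (hα : ∀ j, 0 ≤ α j) :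
    Continuous fun p : (Fin d → ℝ) × (Fin d → ℝ) => hker α p.1 p.2 := by
  unfold hker
  exact continuous_finsetProd _ fun j _ => (continuous_bes (hα j)).comp (by fun_prop)

lemma continuous_ker_right (hα : ∀ j, 0 ≤ α j) (x : Fin d → ℝ) : Continuous (hker α x) :=
  (continuous_ker hα).comp (Continuous.prodMk_right x)

lemma continuous_ker_left (hα : ∀ j, 0 ≤ α j) (y : Fin d → ℝ) : Continuous fun x => hker α x y :=
  (continuous_ker hα).comp (Continuous.prodMk_left y)

lemma phiFn_eq_ker {x y : Fin d → ℝ} (hx : x ∈ posOrth d) (hy : y ∈ posOrth d) :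
    phiFn d α y x = hker α x y :=
  Finset.prod_congr rfl fun j _ => besselJ_eq_bes (mul_pos (hx j) (hy j))

lemma hankel_eq_ht (f : (Fin d → ℝ) → ℝ) {x : Fin d → ℝ} (hx : x ∈ posOrth d) :
    hankel d α f x = ht α f x := by
  refine integral_congr_ae ?_
  filter_upwards [ae_posOrth d α] with y hy
  rw [phiFn_eq_ker hx hy]

lemma integrable_ker_mul (hα : ∀ j, 0 ≤ α j) {f : (Fin d → ℝ) → ℝ}
    (hf : Integrable f (wMeasure d α)) (x : Fin d → ℝ) :
    Integrable (fun y => hker α x y * f y) (wMeasure d α) :=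
  hf.bdd_mul (c := kerBound α) (continuous_ker_right hα x).aestronglyMeasurable
    (Eventually.of_forall fun y => abs_ker_le hα x y)

lemma abs_ht_le (hα : ∀ j, 0 ≤ α j) {f : (Fin d → ℝ) → ℝ}
    (hf : Integrable f (wMeasure d α)) (x : Fin d → ℝ) :
    |ht α f x| ≤ kerBound α * ∫ y, |f y| ∂(wMeasure d α) := by
  rw [← integral_const_mul]
  refine norm_integral_le_of_norm_le (f := fun y => hker α x y * f y) (hf.abs.const_mul _) (Eventually.of_forall fun y => ?_)
  rw [norm_mul]
  exact mul_le_mul_of_nonneg_right (abs_ker_le hα x y) (abs_nonneg _)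

lemma continuous_ht (hα : ∀ j, 0 ≤ α j) {f : (Fin d → ℝ) → ℝ}
    (hf : Integrable f (wMeasure d α)) : Continuous (ht α f) := by
  refine continuous_of_dominated (bound := fun y => kerBound α * |f y|)
    (fun x => (integrable_ker_mul hα hf x).aestronglyMeasurable)
    (fun x => Eventually.of_forall fun y => ?_) (hf.abs.const_mul _)
    (Eventually.of_forall fun y => (continuous_ker_left hα y).mul continuous_const)
  rw [norm_mul]
  exact mul_le_mul_of_nonneg_right (abs_ker_le hα x y) (abs_nonneg _)

lemma integral_ht_mul (hα : ∀ j, 0 ≤ α j) {F G : (Fin d → ℝ) → ℝ}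
    (hF : Integrable F (wMeasure d α)) (hG : Integrable G (wMeasure d α)) :
    ∫ x, ht α F x * G x ∂(wMeasure d α) = ∫ x, F x * ht α G x ∂(wMeasure d α) := by
  unfold ht
  simp_rw [← integral_mul_const, ← integral_const_mul]
  rw [integral_integral_swap]
  · refine integral_congr_ae (Eventually.of_forall fun y => ?_)
    refine integral_congr_ae (Eventually.of_forall fun x => ?_)
    simp only [hker_comm x y]; ring
  · have h := (hG.mul_prod hF).bdd_mul (c := kerBound α)
      (continuous_ker hα).aestronglyMeasurable
      (Eventually.of_forall fun p => abs_ker_le hα p.1 p.2)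
    refine h.congr (Eventually.of_forall fun p => ?_)
    simp only [Function.uncurry]; ring

lemma ht_congr {f g : (Fin d → ℝ) → ℝ} (h : f =ᵐ[wMeasure d α] g) : ht α f = ht α g := by
  ext x
  refine integral_congr_ae ?_
  filter_upwards [h] with y hy
  rw [hy]

lemma ht_add (hα : ∀ j, 0 ≤ α j) {F G : (Fin d → ℝ) → ℝ}
    (hF : Integrable F (wMeasure d α)) (hG : Integrable G (wMeasure d α)) :
    ht α (F + G) = ht α F + ht α G := by
  ext x
  simp only [ht, Pi.add_apply, mul_add]
  exact integral_add (integrable_ker_mul hα hF x) (integrable_ker_mul hα hG x)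

lemma ht_smul (c : ℝ) (F : (Fin d → ℝ) → ℝ) : ht α (c • F) = c • ht α F := by
  ext x
  simp only [ht, Pi.smul_apply, smul_eq_mul, ← integral_const_mul]
  refine integral_congr_ae (Eventually.of_forall fun y => ?_)
  simp only; ring

lemma gau_eq_prod (a x : Fin d → ℝ) : gau a x = ∏ j, exp (-(a j * x j ^ 2)) := by
  unfold gau; rw [← Real.exp_sum, Finset.sum_neg_distrib]

lemma continuous_gau (a : Fin d → ℝ) : Continuous (gau a) := by unfold gau; fun_prop

lemma integrable_gau (hα : ∀ j, 0 ≤ α j) {a : Fin d → ℝ} (ha : ∀ j, 0 < a j) :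
    Integrable (gau a) (wMeasure d α) := by
  rw [wMeasure_eq_pi]
  simp_rw [funext (gau_eq_prod a)]
  exact Integrable.fintype_prod_dep (f := fun j x => exp (-(a j * x ^ 2)))
    fun j => integrable_wOne_exp (hα j) (ha j)

lemma memLp_gau (hα : ∀ j, 0 ≤ α j) {a : Fin d → ℝ} (ha : ∀ j, 0 < a j) :
    MemLp (gau a) 2 (wMeasure d α) := by
  rw [memLp_two_iff_integrable_sq (continuous_gau a).aestronglyMeasurable]
  have : (fun x => gau a x ^ 2) = gau (fun j => 2 * a j) := by
    ext x; unfold gau; rw [← Real.exp_nat_mul]; congr 1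
    push_cast
    rw [mul_neg, Finset.mul_sum]; simp_rw [mul_assoc]
  rw [this]
  exact integrable_gau hα fun j => by have := ha j; positivity

lemma ht_gau (hα : ∀ j, 0 ≤ α j) {a : Fin d → ℝ} (ha : ∀ j, 0 < a j) :
    ht α (gau a) = (∏ j, (2 * a j) ^ (-α j - 1 / 2)) • gau fun j => (4 * a j)⁻¹ := by
  ext y
  simp only [ht, Pi.smul_apply, smul_eq_mul]
  simp_rw [gau_eq_prod, hker, ← Finset.prod_mul_distrib]
  rw [wMeasure_eq_pi, integral_fintype_prod_eq_prod
    (f := fun j x => bes (α j) (y j * x) * exp (-(a j * x ^ 2)))]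
  refine Finset.prod_congr rfl fun j _ => ?_
  rw [integral_wOne]
  have := bes_gaussian (hα j) (show 0 < 2 * a j by have := ha j; positivity) (y j)
  rw [show -((4 * a j)⁻¹ * y j ^ 2) = -(y j ^ 2 / (2 * (2 * a j))) by
    have := (ha j).ne'; field_simp; ring, ← this]
  refine setIntegral_congr_fun measurableSet_Ioi fun x _ => ?_
  rw [mul_comm x, show 2 * a j * x ^ 2 / 2 = a j * x ^ 2 by ring]

lemma ht_ht_gau (hα : ∀ j, 0 ≤ α j) {a : Fin d → ℝ} (ha : ∀ j, 0 < a j) :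
    ht α (ht α (gau a)) = gau a := by
  rw [ht_gau hα ha, ht_smul, ht_gau hα fun j => by have := ha j; positivity, smul_smul,
    ← Finset.prod_mul_distrib]
  have h1 : ∀ j, (2 * a j) ^ (-α j - 1 / 2) * (2 * (4 * a j)⁻¹) ^ (-α j - 1 / 2) = 1 := by
    intro j
    have := ha j
    rw [← Real.mul_rpow (by positivity) (by positivity),
      show 2 * a j * (2 * (4 * a j)⁻¹) = 1 by field_simp; norm_num, Real.one_rpow]
  simp only [h1, Finset.prod_const_one, one_smul]
  congr 1; ext j
  have := (ha j).ne'
  field_simp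

/-- Hankel inversion. -/
lemma ht_ht_ae (hα : ∀ j, 0 ≤ α j) {F : (Fin d → ℝ) → ℝ}
    (hF : Integrable F (wMeasure d α)) (hF' : Integrable (ht α F) (wMeasure d α)) :
    ht α (ht α F) =ᵐ[wMeasure d α] F := by
  have : GaussNull α (fun x => ht α (ht α F) x - F x) := by
    intro a ha
    have hg := integrable_gau hα ha
    have hhg : Integrable (ht α (gau a)) (wMeasure d α) := by
      rw [ht_gau hα ha]
      exact (integrable_gau hα fun j => by have := ha j; positivity).smul _
    have i1 : Integrable (fun x => ht α (ht α F) x * gau a x) (wMeasure d α) :=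
      hg.bdd_mul (continuous_ht hα hF').aestronglyMeasurable
        (Eventually.of_forall fun x => abs_ht_le hα hF' x)
    have i2 : Integrable (fun x => F x * gau a x) (wMeasure d α) := by
      refine hF.mul_bdd (c := 1) (continuous_gau a).aestronglyMeasurable
        (Eventually.of_forall fun x => ?_)
      unfold gau
      rw [Real.norm_eq_abs, abs_of_pos (exp_pos _), Real.exp_le_one_iff, neg_nonpos]
      exact Finset.sum_nonneg fun j _ => mul_nonneg (ha j).le (sq_nonneg _)
    simp_rw [sub_mul]
    refine ⟨i1.sub i2, ?_⟩
    rw [integral_sub i1 i2, integral_ht_mul hα hF' hg, integral_ht_mul hα hF hhg, ht_ht_gau hα ha,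
      sub_self]
  filter_upwards [this.ae_zero] with x hx
  simpa [sub_eq_zero] using hx

/-- The linear span of the Gaussians. -/
def gaussSpan (d : ℕ) : Submodule ℝ ((Fin d → ℝ) → ℝ) :=
  Submodule.span ℝ (gau '' {a | ∀ j, 0 < a j})

lemma gaussSpan_spec (hα : ∀ j, 0 ≤ α j) {G : (Fin d → ℝ) → ℝ} (hG : G ∈ gaussSpan d) :
    Integrable G (wMeasure d α) ∧ MemLp G 2 (wMeasure d α) ∧ ht α G ∈ gaussSpan d ∧
      ht α (ht α G) = G ∧ Integrable (ht α G) (wMeasure d α) := by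
  induction hG using Submodule.span_induction with
  | mem G h =>
    obtain ⟨a, ha, rfl⟩ := h
    have ha' : ∀ j, 0 < (4 * a j)⁻¹ := fun j => by have := ha j; positivity
    refine ⟨integrable_gau hα ha, memLp_gau hα ha, ?_, ht_ht_gau hα ha, ?_⟩
    · rw [ht_gau hα ha]
      exact Submodule.smul_mem _ _ (Submodule.subset_span ⟨_, ha', rfl⟩)
    · rw [ht_gau hα ha]
      exact (integrable_gau hα ha').smul _
  | zero =>
    have : ht α 0 = 0 := by ext x; simp [ht]
    rw [this, this]
    exact ⟨integrable_zero _ _ _, MemLp.zero, Submodule.zero_mem _, rfl, integrable_zero _ _ _⟩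
  | add F G _ _ h1 h2 =>
    obtain ⟨a1, b1, c1, d1, e1⟩ := h1
    obtain ⟨a2, b2, c2, d2, e2⟩ := h2
    rw [ht_add hα a1 a2, ht_add hα e1 e2, d1, d2]
    exact ⟨a1.add a2, b1.add b2, Submodule.add_mem _ c1 c2, rfl, e1.add e2⟩
  | smul c F _ h =>
    obtain ⟨a1, b1, c1, d1, e1⟩ := h
    rw [ht_smul, ht_smul, d1]
    exact ⟨a1.smul c, b1.const_smul c, Submodule.smul_mem _ _ c1, rfl, e1.smul c⟩

lemma l2_inner_toLp {μ : Measure (Fin d → ℝ)} {F G : (Fin d → ℝ) → ℝ} (hF : MemLp F 2 μ)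
    (hG : MemLp G 2 μ) : inner ℝ (hF.toLp F) (hG.toLp G) = ∫ x, F x * G x ∂μ := by
  rw [L2.inner_def]
  refine integral_congr_ae ?_
  filter_upwards [hF.coeFn_toLp, hG.coeFn_toLp] with x h1 h2
  rw [h1, h2]
  simp [mul_comm]

/-- Gaussians are dense in `L²`. -/
lemma exists_gaussSpan_tendsto (hα : ∀ j, 0 ≤ α j) (f : Lp ℝ 2 (wMeasure d α)) :
    ∃ G : ℕ → (Fin d → ℝ) → ℝ, ∃ hG : ∀ n, G n ∈ gaussSpan d,
      Tendsto (fun n => (gaussSpan_spec hα (hG n)).2.1.toLp (G n)) atTop (nhds f) := by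
  let W : Submodule ℝ (Lp ℝ 2 (wMeasure d α)) :=
    { carrier := {w | ∃ (G : (Fin d → ℝ) → ℝ) (hG : G ∈ gaussSpan d),
        (gaussSpan_spec hα hG).2.1.toLp G = w}
      add_mem' := by
        rintro _ _ ⟨F, hF, rfl⟩ ⟨G, hG, rfl⟩
        exact ⟨F + G, Submodule.add_mem _ hF hG, rfl⟩
      zero_mem' := ⟨0, Submodule.zero_mem _, rfl⟩
      smul_mem' := by
        rintro c _ ⟨F, hF, rfl⟩
        exact ⟨c • F, Submodule.smul_mem _ _ hF, rfl⟩ }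
  have hW : W.topologicalClosure = ⊤ := by
    rw [Submodule.topologicalClosure_eq_top_iff, Submodule.eq_bot_iff]
    intro k hk
    have hk2 : MemLp k 2 (wMeasure d α) := Lp.memLp k
    have : GaussNull α k := by
      intro a ha
      refine ⟨hk2.integrable_mul (memLp_gau hα ha), ?_⟩
      have h1 := (Submodule.mem_orthogonal' W k).1 hk _
        ⟨gau a, Submodule.subset_span ⟨a, ha, rfl⟩, rfl⟩
      rw [← l2_inner_toLp hk2 (memLp_gau hα ha), Lp.toLp_coeFn]
      exact h1
    exact (Lp.eq_zero_iff_ae_eq_zero).2 this.ae_zero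
  have hf : f ∈ closure (W : Set (Lp ℝ 2 (wMeasure d α))) := by
    have : f ∈ W.topologicalClosure := hW ▸ Submodule.mem_top
    exact this
  obtain ⟨w, hw, hlim⟩ := mem_closure_iff_seq_limit.1 hf
  choose G hG hGw using hw
  exact ⟨G, hG, by simpa only [hGw] using hlim⟩

/-- Plancherel's theorem for the Hankel transform. -/
theorem ht_plancherel (hα : ∀ j, 0 ≤ α j) {F : (Fin d → ℝ) → ℝ}
    (hF : Integrable F (wMeasure d α)) (hF2 : MemLp F 2 (wMeasure d α)) :
    MemLp (ht α F) 2 (wMeasure d α) ∧ ∀ F' : (Fin d → ℝ) → ℝ, Integrable F' (wMeasure d α) →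
      MemLp F' 2 (wMeasure d α) → MemLp (ht α F') 2 (wMeasure d α) →
      ∫ x, ht α F x * ht α F' x ∂(wMeasure d α) = ∫ x, F x * F' x ∂(wMeasure d α) := by
  obtain ⟨G, hG, hlim⟩ := exists_gaussSpan_tendsto hα (hF2.toLp F)
  have hS := fun n => gaussSpan_spec hα (hG n)
  have hS' := fun n => gaussSpan_spec hα (hS n).2.2.1
  set w : ℕ → Lp ℝ 2 (wMeasure d α) := fun n => (hS n).2.1.toLp (G n)
  set k : ℕ → Lp ℝ 2 (wMeasure d α) := fun n => (hS' n).2.1.toLp (ht α (G n))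
  have hinner : ∀ m n, inner ℝ (k m) (k n) = inner ℝ (w m) (w n) := by
    intro m n
    rw [l2_inner_toLp, l2_inner_toLp, integral_ht_mul hα (hS m).1 (hS' n).1, (hS n).2.2.2.1]
  have hdist : ∀ m n, dist (k m) (k n) = dist (w m) (w n) := by
    intro m n
    rw [dist_eq_norm, dist_eq_norm, ← sq_eq_sq₀ (norm_nonneg _) (norm_nonneg _),
      norm_sub_sq_real, norm_sub_sq_real, hinner]
    simp only [← real_inner_self_eq_norm_sq, hinner]
  have hcau : CauchySeq k := by
    have := hlim.cauchySeq
    rw [Metric.cauchySeq_iff] at this ⊢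
    simpa only [hdist] using this
  obtain ⟨K, hK⟩ := cauchySeq_tendsto_of_complete hcau
  have hK2 : MemLp K 2 (wMeasure d α) := Lp.memLp K
  have hnull : GaussNull α fun x => ht α F x - K x := by
    intro a ha
    have hg := integrable_gau hα ha
    have hg2 := memLp_gau hα ha
    have hga : gau a ∈ gaussSpan d := Submodule.subset_span ⟨a, ha, rfl⟩
    have hgs := gaussSpan_spec hα hga
    have hgs' := gaussSpan_spec hα hgs.2.2.1
    have i1 : Integrable (fun x => ht α F x * gau a x) (wMeasure d α) :=
      hg.bdd_mul (continuous_ht hα hF).aestronglyMeasurable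
        (Eventually.of_forall fun x => abs_ht_le hα hF x)
    have i2 : Integrable (fun x => K x * gau a x) (wMeasure d α) := hK2.integrable_mul hg2
    simp_rw [sub_mul]
    refine ⟨i1.sub i2, ?_⟩
    rw [integral_sub i1 i2, integral_ht_mul hα hF hg, sub_eq_zero]
    have l1 : Tendsto (fun n => inner ℝ (k n) (hg2.toLp _)) atTop
        (nhds (inner ℝ K (hg2.toLp _))) := hK.inner tendsto_const_nhds
    have l2 : Tendsto (fun n => inner ℝ (w n) (hgs'.2.1.toLp _)) atTop
        (nhds (inner ℝ (hF2.toLp F) (hgs'.2.1.toLp _))) := hlim.inner tendsto_const_nhds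
    have e : ∀ n, inner ℝ (k n) (hg2.toLp _) = inner ℝ (w n) (hgs'.2.1.toLp _) := by
      intro n
      rw [l2_inner_toLp, l2_inner_toLp, integral_ht_mul hα (hS n).1 hg]
    simp_rw [e] at l1
    have := tendsto_nhds_unique l2 l1
    rw [l2_inner_toLp] at this
    rw [this, ← l2_inner_toLp hK2 hg2, Lp.toLp_coeFn]
  have hae : K =ᵐ[wMeasure d α] ht α F := by
    filter_upwards [hnull.ae_zero] with x hx
    exact (sub_eq_zero.1 hx).symm
  refine ⟨hK2.ae_eq hae, fun F' hF' hF2' hhF' => ?_⟩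
  have l1 : Tendsto (fun n => inner ℝ (k n) (hhF'.toLp _)) atTop
      (nhds (inner ℝ K (hhF'.toLp _))) := hK.inner tendsto_const_nhds
  have l2 : Tendsto (fun n => inner ℝ (w n) (hF2'.toLp _)) atTop
      (nhds (inner ℝ (hF2.toLp F) (hF2'.toLp _))) := hlim.inner tendsto_const_nhds
  have e : ∀ n, inner ℝ (k n) (hhF'.toLp _) = inner ℝ (w n) (hF2'.toLp _) := by
    intro n
    rw [l2_inner_toLp, l2_inner_toLp, ← integral_ht_mul hα (hS' n).1 hF', (hS n).2.2.2.1]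
  simp_rw [e] at l1
  have := tendsto_nhds_unique l1 l2
  rw [l2_inner_toLp] at this
  rw [← this]
  conv_rhs => rw [← Lp.toLp_coeFn K hK2]
  rw [l2_inner_toLp]
  refine integral_congr_ae ?_
  filter_upwards [hae] with x hx
  rw [hx]

end

section
variable {d : ℕ} {α : Fin d → ℝ}

lemma integral_wOne_div {a C lam : ℝ} (ha : 0 ≤ a) (hlam : 0 < lam) {φ φ' : ℝ → ℝ}
    (hd : ∀ s, 0 < s → HasDerivAt φ (φ' s) s)
    (hb : ∀ s, 0 < s → |φ s| ≤ C * s * exp (-(lam * s ^ 2)))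
    (hint : Integrable (fun s => φ' s + 2 * a / s * φ s) (wOne a)) :
    ∫ s, φ' s + 2 * a / s * φ s ∂(wOne a) = 0 := by
  rw [integral_wOne]
  rw [integrable_wOne_iff] at hint
  have hC : 0 ≤ C := by
    have h := (abs_nonneg _).trans (hb 1 one_pos)
    have h2 : 0 < exp (-(lam * 1 ^ 2)) := exp_pos _
    nlinarith
  set ψ : ℝ → ℝ := fun s => if s ≤ 0 then 0 else s ^ (2 * a) * φ s with hψ
  have hbψ : ∀ s, 0 ≤ s → |ψ s| ≤ C * (s ^ (2 * a + 1) * exp (-lam * s ^ 2)) := by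
    intro s hs
    rcases hs.eq_or_lt with rfl | hs
    · simp [hψ, Real.zero_rpow (by linarith : 2 * a + 1 ≠ 0)]
    · simp only [hψ, if_neg (not_le.2 hs)]
      rw [abs_mul, abs_of_nonneg (Real.rpow_nonneg hs.le _), Real.rpow_add_one hs.ne', neg_mul]
      have := mul_le_mul_of_nonneg_left (hb s hs) (Real.rpow_nonneg hs.le (2 * a))
      linarith
  have h0 : ψ 0 = 0 := by simp [hψ]
  have key := integral_Ioi_of_hasDerivAt_of_tendsto (a := 0) (m := 0) (f := ψ)
    (f' := fun s => s ^ (2 * a) * (φ' s + 2 * a / s * φ s)) ?_ ?_ hint ?_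
  · rw [key, h0, sub_zero]
  · rw [ContinuousWithinAt, h0]
    refine squeeze_zero_norm' (a := fun s => C * (s ^ (2 * a + 1) * exp (-lam * s ^ 2))) ?_ ?_
    · filter_upwards [self_mem_nhdsWithin] with s hs using hbψ s hs
    · have : Continuous fun s : ℝ => C * (s ^ (2 * a + 1) * exp (-lam * s ^ 2)) := by
        have := Real.continuous_rpow_const (q := 2 * a + 1) (by linarith)
        fun_prop
      have h := this.tendsto 0
      simp only [Real.zero_rpow (by linarith : 2 * a + 1 ≠ 0), zero_mul, mul_zero] at h
      exact h.mono_left nhdsWithin_le_nhds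
  · intro s hs
    have hs : 0 < s := hs
    have h1 := ((Real.hasDerivAt_rpow_const (x := s) (p := 2 * a) (Or.inl hs.ne')).mul (hd s hs))
    have h2 : HasDerivAt ψ (2 * a * s ^ (2 * a - 1) * φ s + s ^ (2 * a) * φ' s) s := by
      refine h1.congr_of_eventuallyEq ?_
      filter_upwards [lt_mem_nhds hs] with r hr
      simp [hψ, not_le.2 hr]
    have e : s ^ (2 * a) * (φ' s + 2 * a / s * φ s)
        = 2 * a * s ^ (2 * a - 1) * φ s + s ^ (2 * a) * φ' s := by
      rw [Real.rpow_sub_one hs.ne']; field_simp; ring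
    simp only [e]; exact h2
  · refine squeeze_zero_norm' (a := fun s => C * (s ^ (2 * a + 1) * exp (-lam * s ^ 2))) ?_ ?_
    · filter_upwards [Ici_mem_atTop 0] with s hs using hbψ s hs
    · have h := (rpow_mul_exp_neg_mul_sq_isLittleO_exp_neg hlam (2 * a + 1)).trans_tendsto
        (Real.tendsto_exp_neg_atTop_nhds_zero.comp (tendsto_id.const_mul_atTop (by norm_num : (0:ℝ) < 1 / 2)) |>.congr fun x => by simp)
      simpa using h.const_mul C

lemma integral_wMeasure_div (hα : ∀ j, 0 ≤ α j) (i : Fin d) {C lam : ℝ} (hlam : 0 < lam)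
    {F F' : (Fin d → ℝ) → ℝ}
    (hd : ∀ x ∈ posOrth d, HasDerivAt (fun s => F (Function.update x i s)) (F' x) (x i))
    (hb : ∀ x ∈ posOrth d, |F x| ≤ C * x i * exp (-(lam * nsq x)))
    (hint : Integrable (fun x => F' x + 2 * α i / x i * F x) (wMeasure d α)) :
    ∫ x, F' x + 2 * α i / x i * F x ∂(wMeasure d α) = 0 := by
  cases d with
  | zero => exact i.elim0
  | succ n =>
    rw [wMeasure_eq_pi] at hint ⊢
    have hmp := (measurePreserving_piFinSuccAbove (fun j => wOne (α j)) i).symm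
    rw [← hmp.integral_comp (MeasurableEquiv.measurableEmbedding _)]
    have hint' := (hmp.integrable_comp_emb (MeasurableEquiv.measurableEmbedding _)).2 hint
    refine (integral_prod_symm _ hint').trans ?_
    refine integral_eq_zero_of_ae ?_
    have hz : ∀ᵐ z ∂(Measure.pi fun j => wOne (α (i.succAbove j))), z ∈ posOrth n := by
      have := ae_posOrth n (fun j => α (i.succAbove j))
      rwa [wMeasure_eq_pi] at this
    filter_upwards [hint'.prod_left_ae, hz] with z hz1 hz
    have hmem : ∀ s, 0 < s → (Fin.insertNth i s z : Fin (n + 1) → ℝ) ∈ posOrth (n + 1) := by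
      intro s hs j
      rcases Fin.eq_self_or_eq_succAbove i j with rfl | ⟨k, rfl⟩
      · simpa using hs
      · simpa using hz k
    have := integral_wOne_div (φ := fun s => F (Fin.insertNth i s z))
      (φ' := fun s => F' (Fin.insertNth i s z)) (C := C) (hα i) hlam ?_ ?_ ?_
    · simpa [Fin.insertNthEquiv] using this
    · intro s hs
      have := hd _ (hmem s hs)
      simpa using this
    · intro s hs
      refine (hb _ (hmem s hs)).trans ?_
      have hC : 0 ≤ C * s := by
        have h := (abs_nonneg _).trans (hb _ (hmem s hs))
        have h2 := exp_pos (-(lam * nsq (Fin.insertNth i s z : Fin (n + 1) → ℝ)))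
        simp only [Fin.insertNth_apply_same] at h
        exact nonneg_of_mul_nonneg_left h h2
      simp only [Fin.insertNth_apply_same]
      gcongr
      simpa using sq_le_nsq (Fin.insertNth i s z : Fin (n + 1) → ℝ) i
    · simpa [Fin.insertNthEquiv] using hz1

end

section
variable {d : ℕ} {α : Fin d → ℝ}

/-- Bounded continuous functions on the line. -/
def BddCont (k : ℝ → ℝ) : Prop := Continuous k ∧ ∃ B, ∀ z, |k z| ≤ B

/-- A product kernel. -/
def pker (k : Fin d → ℝ → ℝ) (x y : Fin d → ℝ) : ℝ := ∏ j, k j (x j * y j)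

lemma pker_bound {k : Fin d → ℝ → ℝ} (hk : ∀ j, BddCont (k j)) :
    ∃ B, 0 ≤ B ∧ ∀ x y, |pker k x y| ≤ B := by
  choose B hB using fun j => (hk j).2
  refine ⟨∏ j, B j, Finset.prod_nonneg fun j _ => (abs_nonneg _).trans (hB j 0), fun x y => ?_⟩
  unfold pker
  rw [Finset.abs_prod]
  exact Finset.prod_le_prod (fun _ _ => abs_nonneg _) fun j _ => hB j _

lemma continuous_pker {k : Fin d → ℝ → ℝ} (hk : ∀ j, BddCont (k j)) :
    Continuous fun p : (Fin d → ℝ) × (Fin d → ℝ) => pker k p.1 p.2 := by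
  unfold pker
  exact continuous_finsetProd _ fun j _ => (hk j).1.comp (by fun_prop)

lemma pker_update (k : Fin d → ℝ → ℝ) (i : Fin d) (k' : ℝ → ℝ) (x y : Fin d → ℝ) :
    pker (Function.update k i k') x y
      = k' (x i * y i) * ∏ j ∈ Finset.univ.erase i, k j (x j * y j) := by
  unfold pker
  rw [← Finset.mul_prod_erase _ _ (Finset.mem_univ i)]
  congr 1
  · simp
  · refine Finset.prod_congr rfl fun j hj => ?_
    rw [Function.update_of_ne (Finset.ne_of_mem_erase hj)]

lemma pker_eq (k : Fin d → ℝ → ℝ) (i : Fin d) (x y : Fin d → ℝ) :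
    pker k x y = k i (x i * y i) * ∏ j ∈ Finset.univ.erase i, k j (x j * y j) := by
  rw [← pker_update, Function.update_eq_self]

lemma hasDerivAt_pker {k : Fin d → ℝ → ℝ} {i : Fin d} {k' : ℝ → ℝ}
    (hk : ∀ z, HasDerivAt (k i) (k' z) z) (x y : Fin d → ℝ) (s : ℝ) :
    HasDerivAt (fun s => pker k (Function.update x i s) y)
      (y i * pker (Function.update k i k') (Function.update x i s) y) s := by
  have h1 : ∀ s, pker k (Function.update x i s) y
      = k i (s * y i) * ∏ j ∈ Finset.univ.erase i, k j (x j * y j) := by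
    intro s
    rw [pker_eq k i]
    congr 1
    · simp
    · refine Finset.prod_congr rfl fun j hj => ?_
      rw [Function.update_of_ne (Finset.ne_of_mem_erase hj)]
  have h2 : pker (Function.update k i k') (Function.update x i s) y
      = k' (s * y i) * ∏ j ∈ Finset.univ.erase i, k j (x j * y j) := by
    rw [pker_update]
    congr 1
    · simp
    · refine Finset.prod_congr rfl fun j hj => ?_
      rw [Function.update_of_ne (Finset.ne_of_mem_erase hj)]
  simp_rw [h1]
  rw [h2]
  have h3 := ((hk (s * y i)).comp s ((hasDerivAt_id s).mul_const (y i))).mul_const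
    (∏ j ∈ Finset.univ.erase i, k j (x j * y j))
  refine h3.congr_deriv ?_
  ring

lemma bddCont_update {k : Fin d → ℝ → ℝ} (hk : ∀ j, BddCont (k j)) {i : Fin d} {k' : ℝ → ℝ}
    (hk' : BddCont k') (j : Fin d) : BddCont (Function.update k i k' j) := by
  by_cases h : j = i
  · subst h; simpa using hk'
  · rw [Function.update_of_ne h]; exact hk j

lemma BddCont.neg {k : ℝ → ℝ} (h : BddCont k) : BddCont (fun z => -k z) :=
  ⟨h.1.neg, h.2.imp fun B hB z => by rw [abs_neg]; exact hB z⟩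

lemma BddCont.const_mul {k : ℝ → ℝ} (c : ℝ) (h : BddCont k) : BddCont (fun z => c * k z) := by
  obtain ⟨h1, B, hB⟩ := h
  exact ⟨by fun_prop, |c| * B, fun z => by
    rw [abs_mul]; exact mul_le_mul_of_nonneg_left (hB z) (abs_nonneg _)⟩

lemma BddCont.add {k l : ℝ → ℝ} (hk : BddCont k) (hl : BddCont l) : BddCont (fun z => k z + l z) := by
  obtain ⟨h1, B, hB⟩ := hk
  obtain ⟨h2, C, hC⟩ := hl
  exact ⟨by fun_prop, B + C, fun z => (abs_add_le _ _).trans (add_le_add (hB z) (hC z))⟩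

lemma bddCont_bes {a : ℝ} (ha : 0 ≤ a) : BddCont (bes a) :=
  ⟨continuous_bes ha, _, abs_bes_le ha⟩

lemma bddCont_bes' {a : ℝ} (ha : 0 ≤ a) : BddCont (bes' a) := by
  refine ⟨?_, _, abs_bes'_le ha⟩
  unfold bes'
  exact continuous_id.mul (continuous_bes (by linarith))

lemma hker_eq_pker (x y : Fin d → ℝ) : hker α x y = pker (fun j => bes (α j)) x y := rfl

/-- Partial derivative. -/
def pdv (i : Fin d) (f : (Fin d → ℝ) → ℝ) (x : Fin d → ℝ) : ℝ := fderiv ℝ f x (Pi.single i 1)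

lemma exp_bound_of_hasCompactSupport {f : (Fin d → ℝ) → ℝ} (hf : Continuous f)
    (hs : HasCompactSupport f) : ∃ C, 0 ≤ C ∧ ∀ x, |f x| ≤ C * exp (-(nsq x)) := by
  have hc : Continuous fun x => f x * exp (nsq x) := hf.mul (by fun_prop)
  obtain ⟨C, hC⟩ := hc.bounded_above_of_compact_support hs.mul_right
  refine ⟨C, (norm_nonneg _).trans (hC 0), fun x => ?_⟩
  have := hC x
  rw [norm_mul, Real.norm_eq_abs, Real.norm_eq_abs, abs_of_pos (exp_pos _)] at this
  rw [Real.exp_neg, ← div_eq_mul_inv, le_div_iff₀ (exp_pos _)]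
  exact this

lemma integrable_of_hasCompactSupport (hα : ∀ j, 0 ≤ α j) {f : (Fin d → ℝ) → ℝ}
    (hf : Continuous f) (hs : HasCompactSupport f) : Integrable f (wMeasure d α) := by
  obtain ⟨C, -, hC⟩ := exp_bound_of_hasCompactSupport hf hs
  refine Integrable.mono' (((integrable_exp_nsq hα one_pos).const_mul C))
    hf.aestronglyMeasurable (Eventually.of_forall fun x => ?_)
  simpa using hC x

namespace CcInfPos
variable {f g : (Fin d → ℝ) → ℝ}

lemma continuous (hf : CcInfPos d f) : Continuous f := hf.1.continuous

lemma exp_bound (hf : CcInfPos d f) : ∃ C, 0 ≤ C ∧ ∀ x, |f x| ≤ C * exp (-(nsq x)) :=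
  exp_bound_of_hasCompactSupport hf.continuous hf.2.1

lemma integrable (hα : ∀ j, 0 ≤ α j) (hf : CcInfPos d f) : Integrable f (wMeasure d α) :=
  integrable_of_hasCompactSupport hα hf.continuous hf.2.1

lemma mul_of_contDiffAt {h : (Fin d → ℝ) → ℝ}
    (hh : ∀ x ∈ posOrth d, ContDiffAt ℝ (⊤ : ℕ∞) h x) (hf : CcInfPos d f) :
    CcInfPos d (fun x => h x * f x) := by
  have hts : tsupport (fun x => h x * f x) ⊆ tsupport f := tsupport_mul_subset_right
  refine ⟨?_, hf.2.1.mul_left, hts.trans hf.2.2⟩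
  rw [contDiff_iff_contDiffAt]
  intro x
  by_cases hx : x ∈ tsupport f
  · exact (hh x (hf.2.2 hx)).mul hf.1.contDiffAt
  · refine (contDiffAt_const (c := (0 : ℝ))).congr_of_eventuallyEq ?_
    filter_upwards [notMem_tsupport_iff_eventuallyEq.1 hx] with z hz
    simp [hz]

lemma inv_mul (hf : CcInfPos d f) (i : Fin d) : CcInfPos d (fun x => (x i)⁻¹ * f x) :=
  mul_of_contDiffAt (fun _ hx => (contDiff_apply ℝ ℝ i).contDiffAt.inv (hx i).ne') hf

lemma const_mul (hf : CcInfPos d f) (c : ℝ) : CcInfPos d (fun x => c * f x) :=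
  mul_of_contDiffAt (fun _ _ => contDiffAt_const) hf

lemma mul (hf : CcInfPos d f) (hg : CcInfPos d g) : CcInfPos d (fun x => f x * g x) :=
  mul_of_contDiffAt (fun _ _ => hf.1.contDiffAt) hg

lemma add (hf : CcInfPos d f) (hg : CcInfPos d g) : CcInfPos d (fun x => f x + g x) :=
  ⟨hf.1.add hg.1, hf.2.1.add hg.2.1,
    (tsupport_add f g).trans (union_subset hf.2.2 hg.2.2)⟩

lemma sum {ι : Type*} (s : Finset ι) {F : ι → (Fin d → ℝ) → ℝ} (hF : ∀ i, CcInfPos d (F i)) :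
    CcInfPos d (fun x => ∑ i ∈ s, F i x) := by
  classical
  induction s using Finset.induction_on with
  | empty =>
    have h0 : tsupport (fun _ : Fin d → ℝ => (0 : ℝ)) = ∅ := tsupport_eq_empty_iff.2 rfl
    exact ⟨by simpa using contDiff_const, by simp [HasCompactSupport, h0], by simp [h0]⟩
  | insert a s ha ih =>
    simp_rw [Finset.sum_insert ha]
    exact (hF a).add ih

lemma pdv (hf : CcInfPos d f) (i : Fin d) : CcInfPos d (pdv i f) :=
  ⟨(hf.1.fderiv_right (m := (⊤ : ℕ∞)) (by simp)).clm_apply contDiff_const,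
    hf.2.1.fderiv_apply ℝ _, (tsupport_fderiv_apply_subset ℝ _).trans hf.2.2⟩

lemma hasDerivAt (hf : CcInfPos d f) (i : Fin d) (x : Fin d → ℝ) (s : ℝ) :
    HasDerivAt (fun s => f (Function.update x i s)) (_root_.pdv i f (Function.update x i s)) s := by
  have h1 := (hf.1.differentiable (by simp) (Function.update x i s)).hasFDerivAt
  exact h1.comp_hasDerivAt s (hasDerivAt_update x i s)

end CcInfPos

/-- The one-variable Bessel operator. -/
def besselOp (α : Fin d → ℝ) (i : Fin d) (f : (Fin d → ℝ) → ℝ) (x : Fin d → ℝ) : ℝ :=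
  pdv i (pdv i f) x + 2 * α i * ((x i)⁻¹ * pdv i f x)

lemma CcInfPos.besselOp {f : (Fin d → ℝ) → ℝ} (hf : CcInfPos d f) (i : Fin d) :
    CcInfPos d (besselOp α i f) :=
  ((hf.pdv i).pdv i).add (((hf.pdv i).inv_mul i).const_mul _)

lemma hasDerivAt_neg_bes' {a : ℝ} (ha : 0 ≤ a) (z : ℝ) :
    HasDerivAt (fun z => -bes' a z) (-(bes a z - 2 * a * bes (a + 1) z)) z :=
  (hasDerivAt_bes'_aux ha z).neg

lemma ht_besselOp (hα : ∀ j, 0 ≤ α j) {f : (Fin d → ℝ) → ℝ} (hf : CcInfPos d f) (i : Fin d)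
    (y : Fin d → ℝ) : ht α (besselOp α i f) y = -(y i) ^ 2 * ht α f y := by
  set k : Fin d → ℝ → ℝ := fun j => bes (α j) with hk
  set k₁ := Function.update k i (fun z => -bes' (α i) z) with hk₁
  set k₂ := Function.update k₁ i (fun z => -(bes (α i) z - 2 * α i * bes (α i + 1) z)) with hk₂
  have hkb : ∀ j, BddCont (k j) := fun j => bddCont_bes (hα j)
  have hkb₁ : ∀ j, BddCont (k₁ j) := bddCont_update hkb (bddCont_bes' (hα i)).neg
  have hd₁ : ∀ x s, HasDerivAt (fun s => pker k (Function.update x i s) y)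
      (y i * pker k₁ (Function.update x i s) y) s :=
    fun x s => hasDerivAt_pker (hasDerivAt_bes (hα i)) x y s
  have hd₂ : ∀ x s, HasDerivAt (fun s => pker k₁ (Function.update x i s) y)
      (y i * pker k₂ (Function.update x i s) y) s := by
    intro x s
    refine hasDerivAt_pker (k := k₁) (fun z => ?_) x y s
    simp only [hk₁, Function.update_self]
    exact hasDerivAt_neg_bes' (hα i) z
  obtain ⟨B, hB0, hB⟩ := pker_bound hkb
  obtain ⟨B₁, hB₁0, hB₁⟩ := pker_bound hkb₁
  obtain ⟨C, hC0, hC⟩ := (hf.inv_mul i).exp_bound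
  obtain ⟨C₁, hC₁0, hC₁⟩ := ((hf.pdv i).inv_mul i).exp_bound
  have hode : ∀ x ∈ posOrth d, y i * (y i * pker k₂ x y) + 2 * α i / x i * (y i * pker k₁ x y)
      = -(y i) ^ 2 * pker k x y := by
    intro x hx
    have := (hx i).ne'
    rw [hk₂, hk₁, Function.update_idem, pker_update, pker_update, pker_eq k i, bes']
    field_simp
    ring
  have hpt : ∀ x ∈ posOrth d, (pdv i (pdv i f) x * pker k x y
        - f x * (y i * (y i * pker k₂ x y)))
      + 2 * α i / x i * (pdv i f x * pker k x y - f x * (y i * pker k₁ x y))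
      = hker α y x * besselOp α i f x + y i ^ 2 * (hker α y x * f x) := by
    intro x hx
    rw [hker_comm, hker_eq_pker]
    unfold besselOp
    linear_combination (-f x) * hode x hx
  have hi1 := integrable_ker_mul hα ((hf.besselOp (α := α) i).integrable hα) y
  have hi2 := (integrable_ker_mul hα (hf.integrable hα) y).const_mul (y i ^ 2)
  have key := integral_wMeasure_div (α := α) hα i (C := C₁ * B + C * (|y i| * B₁)) one_pos
    (F := fun x => pdv i f x * pker k x y - f x * (y i * pker k₁ x y))
    (F' := fun x => pdv i (pdv i f) x * pker k x y - f x * (y i * (y i * pker k₂ x y)))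
    ?_ ?_ ?_
  · rw [integral_congr_ae ((ae_posOrth d α).mono hpt), integral_add hi1 hi2,
      integral_const_mul] at key
    change ht α _ y + _ * ht α f y = 0 at key
    linarith
  · intro x hx
    have h1 := ((hf.pdv i).hasDerivAt i x (x i)).mul (hd₁ x (x i))
    have h2 := (hf.hasDerivAt i x (x i)).mul ((hd₂ x (x i)).const_mul (y i))
    refine (h1.sub h2).congr_deriv ?_
    simp only [Function.update_eq_self]
    ring
  · intro x hx
    have hxi := hx i
    have h1 := hC x
    have h2 := hC₁ x
    rw [abs_mul, abs_inv, abs_of_pos hxi, inv_mul_le_iff₀ hxi] at h1 h2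
    rw [one_mul]
    calc |pdv i f x * pker k x y - f x * (y i * pker k₁ x y)|
        ≤ |pdv i f x| * |pker k x y| + |f x| * (|y i| * |pker k₁ x y|) := by
          refine (abs_sub _ _).trans ?_
          rw [abs_mul, abs_mul, abs_mul]
      _ ≤ (x i * (C₁ * exp (-nsq x))) * B + (x i * (C * exp (-nsq x))) * (|y i| * B₁) := by
          gcongr
          · exact hB _ _
          · exact hB₁ _ _
      _ = _ := by ring
  · refine (hi1.add hi2).congr ?_
    filter_upwards [ae_posOrth d α] with x hx
    exact (hpt x hx).symm

/-- Continuous functions decaying faster than any power. -/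
def Rapid (c : (Fin d → ℝ) → ℝ) : Prop :=
  Continuous c ∧ ∀ N : ℕ, ∃ C, ∀ y, |c y| ≤ C * ((1 + nsq y) ^ N)⁻¹

lemma rapid_ht (hα : ∀ j, 0 ≤ α j) {f : (Fin d → ℝ) → ℝ} (hf : CcInfPos d f) :
    Rapid (ht α f) := by
  refine ⟨continuous_ht hα (hf.integrable hα), fun N => ?_⟩
  have key : ∀ N : ℕ, ∃ g, CcInfPos d g ∧ ∀ y, ht α g y = (1 + nsq y) ^ N * ht α f y := by
    intro N
    induction N with
    | zero => exact ⟨f, hf, fun y => by simp⟩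
    | succ N ih =>
      obtain ⟨g, hg, h⟩ := ih
      have hL : ∀ i, CcInfPos d (fun x => (-1) * besselOp α i g x) :=
        fun i => (hg.besselOp i).const_mul (-1)
      refine ⟨fun x => g x + ∑ i, (-1) * besselOp α i g x, hg.add (CcInfPos.sum _ hL), fun y => ?_⟩
      have h1 : ht α (fun x => g x + ∑ i, (-1) * besselOp α i g x) y
          = ht α g y + ∑ i, (-1) * ht α (besselOp α i g) y := by
        simp only [ht, mul_add, Finset.mul_sum]
        rw [integral_add (integrable_ker_mul hα (hg.integrable hα) y)
          (integrable_finsetSum _ fun i _ => integrable_ker_mul hα ((hL i).integrable hα) y),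
          integral_finsetSum _ fun i _ => integrable_ker_mul hα ((hL i).integrable hα) y]
        congr 1
        refine Finset.sum_congr rfl fun i _ => ?_
        rw [← integral_const_mul]
        congr 1; ext x; ring
      rw [h1]
      simp_rw [ht_besselOp hα hg]
      rw [pow_succ, h y]
      unfold nsq
      simp only [← mul_assoc, ← Finset.sum_mul, neg_neg, neg_one_mul]
      ring
  obtain ⟨g, hg, h⟩ := key N
  refine ⟨kerBound α * ∫ y, |g y| ∂(wMeasure d α), fun y => ?_⟩
  have h1 := abs_ht_le hα (hg.integrable hα) y
  have hpos : 0 < (1 + nsq y) ^ N := by have := nsq_nonneg y; positivity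
  rw [h y, abs_mul, abs_of_pos hpos] at h1
  rw [← div_eq_mul_inv, le_div_iff₀ hpos, mul_comm]
  exact h1

end

section
variable {d : ℕ} {α : Fin d → ℝ}

lemma eNorm_eq (y : Fin d → ℝ) : eNorm d y = √(nsq y) := rfl

lemma eNorm_nonneg (y : Fin d → ℝ) : 0 ≤ eNorm d y := Real.sqrt_nonneg _

lemma eNorm_sq (y : Fin d → ℝ) : eNorm d y ^ 2 = nsq y := Real.sq_sqrt (nsq_nonneg y)

@[fun_prop]
lemma continuous_eNorm : Continuous (eNorm d) := by
  change Continuous fun y => √(nsq y)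
  fun_prop

lemma eNorm_pos {y : Fin d → ℝ} (hy : y ∈ posOrth d) (i : Fin d) : 0 < eNorm d y := by
  have h1 := sq_le_nsq y i
  have h2 := hy i
  rw [eNorm_eq]
  exact Real.sqrt_pos.2 (lt_of_lt_of_le (by positivity) h1)

lemma abs_le_eNorm (y : Fin d → ℝ) (i : Fin d) : |y i| ≤ eNorm d y :=
  Real.abs_le_sqrt (sq_le_nsq y i)

lemma eNorm_le (y : Fin d → ℝ) : eNorm d y ≤ 1 + nsq y := by
  have := eNorm_sq y
  nlinarith [sq_nonneg (eNorm d y - 1), eNorm_nonneg y]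

/-- The Poisson multiplier. -/
def pexp (t : ℝ) (y : Fin d → ℝ) : ℝ := exp (-(|t| * eNorm d y))

lemma pexp_pos (t : ℝ) (y : Fin d → ℝ) : 0 < pexp t y := exp_pos _

lemma pexp_le_one (t : ℝ) (y : Fin d → ℝ) : pexp t y ≤ 1 :=
  Real.exp_le_one_iff.2 (neg_nonpos.2 (mul_nonneg (abs_nonneg _) (eNorm_nonneg y)))

lemma pexp_zero (y : Fin d → ℝ) : pexp 0 y = 1 := by simp [pexp]

lemma continuous_pexp : Continuous fun p : ℝ × (Fin d → ℝ) => pexp p.1 p.2 := by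
  unfold pexp; fun_prop

namespace Rapid
variable {c c' : (Fin d → ℝ) → ℝ}

lemma bound (hc : Rapid c) : ∃ C, 0 ≤ C ∧ ∀ y, |c y| ≤ C := by
  obtain ⟨C, hC⟩ := hc.2 0
  simp only [pow_zero, inv_one, mul_one] at hC
  exact ⟨C, (abs_nonneg _).trans (hC 0), hC⟩

lemma integrable (hα : ∀ j, 0 ≤ α j) (hc : Rapid c) : Integrable c (wMeasure d α) := by
  obtain ⟨N, hN⟩ := exists_integrable_weight hα
  obtain ⟨C, hC⟩ := hc.2 N
  exact (hN.const_mul C).mono' hc.1.aestronglyMeasurable (Eventually.of_forall hC)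

lemma mul_of_le {h : (Fin d → ℝ) → ℝ} (hc : Rapid c) (hh : Continuous h)
    (hb : ∀ y, |h y| ≤ 1 + nsq y) : Rapid (fun y => h y * c y) := by
  refine ⟨hh.mul hc.1, fun N => ?_⟩
  obtain ⟨C, hC⟩ := hc.2 (N + 1)
  refine ⟨C, fun y => ?_⟩
  have hp : 0 < 1 + nsq y := by have := nsq_nonneg y; linarith
  rw [abs_mul]
  calc |h y| * |c y| ≤ (1 + nsq y) * (C * ((1 + nsq y) ^ (N + 1))⁻¹) :=
        mul_le_mul (hb y) (hC y) (abs_nonneg _) hp.le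
    _ = _ := by field_simp; ring

lemma coord_mul (hc : Rapid c) (i : Fin d) : Rapid (fun y => y i * c y) :=
  hc.mul_of_le (by fun_prop) fun y => (abs_le_eNorm y i).trans (eNorm_le y)

lemma eNorm_mul (hc : Rapid c) : Rapid (fun y => eNorm d y * c y) :=
  hc.mul_of_le (by fun_prop) fun y => by rw [abs_of_nonneg (eNorm_nonneg y)]; exact eNorm_le y

lemma pexp_mul (hc : Rapid c) (t : ℝ) : Rapid (fun y => pexp t y * c y) :=
  hc.mul_of_le (continuous_pexp.comp (Continuous.prodMk_right t)) fun y => by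
    rw [abs_of_pos (pexp_pos t y)]; have := pexp_le_one t y; have := nsq_nonneg y; linarith

lemma neg (hc : Rapid c) : Rapid (fun y => -c y) :=
  ⟨hc.1.neg, fun N => (hc.2 N).imp fun C hC y => by rw [abs_neg]; exact hC y⟩

lemma mul (hc : Rapid c) (hc' : Rapid c') : Rapid (fun y => c y * c' y) := by
  obtain ⟨B, hB0, hB⟩ := hc.bound
  refine ⟨hc.1.mul hc'.1, fun N => ?_⟩
  obtain ⟨C, hC⟩ := hc'.2 N
  refine ⟨B * C, fun y => ?_⟩
  rw [abs_mul, mul_assoc]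
  exact mul_le_mul (hB y) (hC y) (abs_nonneg _) hB0

lemma memLp_two (hα : ∀ j, 0 ≤ α j) (hc : Rapid c) : MemLp c 2 (wMeasure d α) := by
  rw [memLp_two_iff_integrable_sq hc.1.aestronglyMeasurable]
  simpa [pow_two] using (hc.mul hc).integrable hα

end Rapid

/-- The Poisson-type extension with product kernel `k` and spectral density `c`. -/
def pext (α : Fin d → ℝ) (k : Fin d → ℝ → ℝ) (c : (Fin d → ℝ) → ℝ) (x : Fin d → ℝ) (t : ℝ) : ℝ :=
  ∫ y, pker k x y * (pexp t y * c y) ∂(wMeasure d α)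

section pext
variable {k : Fin d → ℝ → ℝ} {c : (Fin d → ℝ) → ℝ}

lemma integrable_pext (hα : ∀ j, 0 ≤ α j) (hk : ∀ j, BddCont (k j)) (hc : Rapid c)
    (x : Fin d → ℝ) (t : ℝ) :
    Integrable (fun y => pker k x y * (pexp t y * c y)) (wMeasure d α) := by
  obtain ⟨B, -, hB⟩ := pker_bound hk
  exact ((hc.pexp_mul t).integrable hα).bdd_mul (c := B)
    ((continuous_pker hk).comp (Continuous.prodMk_right x)).aestronglyMeasurable
    (Eventually.of_forall fun y => hB x y)

lemma pext_term_le {B : ℝ} (hB0 : 0 ≤ B) (hB : ∀ x y, |pker k x y| ≤ B) (x : Fin d → ℝ) (t : ℝ)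
    (y : Fin d → ℝ) : |pker k x y * (pexp t y * c y)| ≤ B * |c y| := by
  rw [abs_mul, abs_mul, abs_of_pos (pexp_pos t y)]
  refine mul_le_mul (hB x y) ?_ (by have := pexp_pos t y; positivity) hB0
  exact mul_le_of_le_one_left (abs_nonneg _) (pexp_le_one t y)

lemma pext_bound (hα : ∀ j, 0 ≤ α j) (hk : ∀ j, BddCont (k j)) (hc : Rapid c) :
    ∃ M, ∀ x t, |pext α k c x t| ≤ M := by
  obtain ⟨B, hB0, hB⟩ := pker_bound hk
  exact ⟨_, fun x t => norm_integral_le_of_norm_le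
    (f := fun y => pker k x y * (pexp t y * c y)) ((hc.integrable hα).abs.const_mul B)
    (Eventually.of_forall fun y => pext_term_le hB0 hB x t y)⟩

lemma continuous_pext (hα : ∀ j, 0 ≤ α j) (hk : ∀ j, BddCont (k j)) (hc : Rapid c) :
    Continuous fun p : (Fin d → ℝ) × ℝ => pext α k c p.1 p.2 := by
  obtain ⟨B, hB0, hB⟩ := pker_bound hk
  refine continuous_of_dominated (bound := fun y => B * |c y|)
    (fun p => (integrable_pext hα hk hc p.1 p.2).aestronglyMeasurable)
    (fun p => Eventually.of_forall fun y => pext_term_le hB0 hB p.1 p.2 y)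
    ((hc.integrable hα).abs.const_mul B) (Eventually.of_forall fun y => ?_)
  exact ((continuous_pker hk).comp (by fun_prop : Continuous fun p : (Fin d → ℝ) × ℝ => (p.1, y))).mul
    ((continuous_pexp.comp (by fun_prop : Continuous fun p : (Fin d → ℝ) × ℝ => (p.2, y))).mul
      continuous_const)

lemma hasDerivAt_pext_coord (hα : ∀ j, 0 ≤ α j) (hk : ∀ j, BddCont (k j)) (hc : Rapid c)
    {i : Fin d} {k' : ℝ → ℝ} (hk' : BddCont k') (hd : ∀ z, HasDerivAt (k i) (k' z) z)
    (x : Fin d → ℝ) (t s : ℝ) :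
    HasDerivAt (fun s => pext α k c (Function.update x i s) t)
      (pext α (Function.update k i k') (fun y => y i * c y) (Function.update x i s) t) s := by
  have hku : ∀ j, BddCont (Function.update k i k' j) := bddCont_update hk hk'
  obtain ⟨B, hB0, hB⟩ := pker_bound hku
  refine (hasDerivAt_integral_of_dominated_loc_of_deriv_le (s := univ)
    (bound := fun y => B * |y i * c y|)
    (F' := fun s y => pker (Function.update k i k') (Function.update x i s) y
      * (pexp t y * (y i * c y))) univ_mem
    (Eventually.of_forall fun s => (integrable_pext hα hk hc _ t).aestronglyMeasurable)
    (integrable_pext hα hk hc _ t)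
    (integrable_pext hα hku (hc.coord_mul i) _ t).aestronglyMeasurable
    (Eventually.of_forall fun y s _ => pext_term_le (c := fun y => y i * c y) hB0 hB _ t y)
    (((hc.coord_mul i).integrable hα).abs.const_mul B)
    (Eventually.of_forall fun y s _ => ?_)).2
  refine ((hasDerivAt_pker hd x y s).mul_const (pexp t y * c y)).congr_deriv ?_
  ring

lemma hasDerivAt_pext_time (hα : ∀ j, 0 ≤ α j) (hk : ∀ j, BddCont (k j)) (hc : Rapid c)
    (x : Fin d → ℝ) {t : ℝ} (ht : 0 < t) :
    HasDerivAt (fun t => pext α k c x t) (pext α k (fun y => -(eNorm d y * c y)) x t) t := by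
  obtain ⟨B, hB0, hB⟩ := pker_bound hk
  refine (hasDerivAt_integral_of_dominated_loc_of_deriv_le (s := Ioi 0)
    (bound := fun y => B * |-(eNorm d y * c y)|)
    (F' := fun t y => pker k x y * (pexp t y * (-(eNorm d y * c y)))) (Ioi_mem_nhds ht)
    (Eventually.of_forall fun s => (integrable_pext hα hk hc x s).aestronglyMeasurable)
    (integrable_pext hα hk hc x t)
    (integrable_pext hα hk hc.eNorm_mul.neg x t).aestronglyMeasurable
    (Eventually.of_forall fun y s _ =>
      pext_term_le (c := fun y => -(eNorm d y * c y)) hB0 hB x s y)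
    ((hc.eNorm_mul.neg.integrable hα).abs.const_mul B)
    (Eventually.of_forall fun y s hs => ?_)).2
  have hs : 0 < s := hs
  have h1 : HasDerivAt (fun s => pexp s y) (pexp s y * -(1 * eNorm d y)) s := by
    have h2 : HasDerivAt (fun s => exp (-(s * eNorm d y)))
        (exp (-(s * eNorm d y)) * -(1 * eNorm d y)) s :=
      ((hasDerivAt_id s).mul_const (eNorm d y)).neg.exp
    have h3 : pexp s y = exp (-(s * eNorm d y)) := by rw [pexp, abs_of_pos hs]
    rw [h3]
    refine h2.congr_of_eventuallyEq ?_
    filter_upwards [lt_mem_nhds hs] with r hr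
    rw [pexp, abs_of_pos hr]
  refine ((h1.mul_const (c y)).const_mul (pker k x y)).congr_deriv ?_
  ring

lemma pext_factor (α : Fin d → ℝ) (k : Fin d → ℝ → ℝ) (i : Fin d) (l : ℝ → ℝ)
    (c : (Fin d → ℝ) → ℝ) (x : Fin d → ℝ) (t : ℝ) :
    pext α (Function.update k i fun z => z * l z) c x t
      = x i * pext α (Function.update k i l) (fun y => y i * c y) x t := by
  unfold pext
  rw [← integral_const_mul]
  congr 1; ext y
  rw [pker_update, pker_update]
  ring

lemma pext_bes (α : Fin d → ℝ) (c : (Fin d → ℝ) → ℝ) (x : Fin d → ℝ) (t : ℝ) :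
    pext α (fun j => bes (α j)) c x t = ht α (fun y => pexp t y * c y) x := rfl

lemma pext_bes' (α : Fin d → ℝ) (i : Fin d) (c : (Fin d → ℝ) → ℝ) (x : Fin d → ℝ) (t : ℝ) :
    pext α (Function.update (fun j => bes (α j)) i (bes' (α i))) (fun y => y i * c y) x t
      = x i * ht (α + Pi.single i 1) (fun y => pexp t y * c y) x := by
  change pext α (Function.update (fun j => bes (α j)) i fun z => z * bes (α i + 1) z) _ x t = _
  rw [pext_factor, ht, integral_wMeasure_add_single]
  unfold pext
  congr 2; ext y
  have : hker (α + Pi.single i 1) x y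
      = pker (Function.update (fun j => bes (α j)) i (bes (α i + 1))) x y := by
    rw [hker_eq_pker]
    congr 1; ext j z
    by_cases h : j = i
    · subst h; simp
    · simp [h]
  rw [this]
  ring

end pext

end

section
variable {d : ℕ} {α : Fin d → ℝ}

/-- A function of `(x, t)` with its first and pure second derivatives. -/
structure Jet (d : ℕ) where
  v : (Fin d → ℝ) → ℝ → ℝ
  vx : Fin d → (Fin d → ℝ) → ℝ → ℝ
  vxx : Fin d → (Fin d → ℝ) → ℝ → ℝ
  vt : (Fin d → ℝ) → ℝ → ℝ
  vtt : (Fin d → ℝ) → ℝ → ℝ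

/-- Regularity, boundedness and subharmonicity of a Poisson-type extension. -/
structure Jet.IsPoisson (α : Fin d → ℝ) (F : Jet d) : Prop where
  cont_v : Continuous fun p : (Fin d → ℝ) × ℝ => F.v p.1 p.2
  cont_vx : ∀ i, Continuous fun p : (Fin d → ℝ) × ℝ => F.vx i p.1 p.2
  cont_vxx : ∀ i, Continuous fun p : (Fin d → ℝ) × ℝ => F.vxx i p.1 p.2
  cont_vt : Continuous fun p : (Fin d → ℝ) × ℝ => F.vt p.1 p.2
  cont_vtt : Continuous fun p : (Fin d → ℝ) × ℝ => F.vtt p.1 p.2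
  bdd : ∃ M, 0 ≤ M ∧ ∀ x t, |F.v x t| ≤ M ∧ (∀ i, |F.vx i x t| ≤ M) ∧ (∀ i, |F.vxx i x t| ≤ M) ∧
    |F.vt x t| ≤ M ∧ |F.vtt x t| ≤ M ∧ ∀ i, |F.v x t * F.vx i x t| ≤ M * |x i|
  deriv_x : ∀ i x t s, HasDerivAt (fun s => F.v (Function.update x i s) t)
    (F.vx i (Function.update x i s) t) s
  deriv_xx : ∀ i x t s, HasDerivAt (fun s => F.vx i (Function.update x i s) t)
    (F.vxx i (Function.update x i s) t) s
  deriv_t : ∀ x t, 0 < t → HasDerivAt (fun t => F.v x t) (F.vt x t) t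
  deriv_tt : ∀ x t, 0 < t → HasDerivAt (fun t => F.vt x t) (F.vtt x t) t
  pde : ∀ x ∈ posOrth d, ∀ t,
    0 ≤ F.v x t * (F.vtt x t + ∑ i, (F.vxx i x t + 2 * α i / x i * F.vx i x t))
  sq_int : ∀ t, Integrable (fun x => F.v x t ^ 2) (wMeasure d α)
  sq_bdd : ∃ C, ∀ t, ∫ x, F.v x t ^ 2 ∂(wMeasure d α) ≤ C
  sq_tendsto : Tendsto (fun t => ∫ x, F.v x t ^ 2 ∂(wMeasure d α)) atTop (nhds 0)

/-- The jet of a Poisson-type extension. -/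
def pextJet (α : Fin d → ℝ) (k k₁ k₂ : Fin d → ℝ → ℝ) (c : (Fin d → ℝ) → ℝ) : Jet d where
  v := pext α k c
  vx i := pext α (Function.update k i (k₁ i)) (fun y => y i * c y)
  vxx i := pext α (Function.update k i (k₂ i)) (fun y => y i * (y i * c y))
  vt := pext α k (fun y => -(eNorm d y * c y))
  vtt := pext α k (fun y => -(eNorm d y * -(eNorm d y * c y)))

lemma sq_pext_ht (hd : 0 < d) (hα : ∀ j, 0 ≤ α j) {c : (Fin d → ℝ) → ℝ} (hc : Rapid c) :
    (∀ t, Integrable (fun x => ht α (fun y => pexp t y * c y) x ^ 2) (wMeasure d α)) ∧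
    (∃ C, ∀ t, ∫ x, ht α (fun y => pexp t y * c y) x ^ 2 ∂(wMeasure d α) ≤ C) ∧
    (Tendsto (fun t => ∫ x, ht α (fun y => pexp t y * c y) x ^ 2 ∂(wMeasure d α)) atTop
      (nhds 0)) := by
  have hr := fun t => hc.pexp_mul t
  have hP := fun t => ht_plancherel hα ((hr t).integrable hα) ((hr t).memLp_two hα)
  have heq : ∀ t, ∫ x, ht α (fun y => pexp t y * c y) x ^ 2 ∂(wMeasure d α)
      = ∫ x, pexp t x ^ 2 * c x ^ 2 ∂(wMeasure d α) := by
    intro t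
    have := (hP t).2 _ ((hr t).integrable hα) ((hr t).memLp_two hα) (hP t).1
    simpa [← pow_two, mul_pow] using this
  have hc2 : Integrable (fun y => c y ^ 2) (wMeasure d α) := (hc.memLp_two hα).integrable_sq
  have hle : ∀ t x, pexp t x ^ 2 * c x ^ 2 ≤ c x ^ 2 := fun t x =>
    mul_le_of_le_one_left (sq_nonneg _) (pow_le_one₀ (pexp_pos t x).le (pexp_le_one t x))
  have hcm : ∀ t, Continuous (fun x => pexp t x ^ 2 * c x ^ 2) := fun t =>
    ((continuous_pexp.comp (Continuous.prodMk_right t)).pow 2).mul (hc.1.pow 2)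
  refine ⟨fun t => (hP t).1.integrable_sq, ⟨∫ x, c x ^ 2 ∂(wMeasure d α), fun t => ?_⟩, ?_⟩
  · rw [heq]
    refine integral_mono_of_nonneg (Eventually.of_forall fun x => ?_) hc2
      (Eventually.of_forall fun x => hle t x)
    positivity
  · simp_rw [heq]
    have h0 : ∫ _x, (0 : ℝ) ∂(wMeasure d α) = 0 := by simp
    rw [← h0]
    refine tendsto_integral_filter_of_dominated_convergence (fun y => c y ^ 2)
      (Eventually.of_forall fun t => (hcm t).aestronglyMeasurable)
      (Eventually.of_forall fun t => Eventually.of_forall fun x => ?_) hc2 ?_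
    · rw [Real.norm_eq_abs, abs_of_nonneg (by positivity)]
      exact hle t x
    · filter_upwards [ae_posOrth d α] with y hy
      have hn := eNorm_pos hy ⟨0, hd⟩
      have h1 : Tendsto (fun t => pexp t y) atTop (nhds 0) := by
        refine Real.tendsto_exp_atBot.comp (tendsto_neg_atTop_atBot.comp ?_)
        exact tendsto_abs_atTop_atTop.atTop_mul_const hn
      simpa using (h1.pow 2).mul_const (c y ^ 2)

section
variable {k k₁ k₂ : Fin d → ℝ → ℝ} {c : (Fin d → ℝ) → ℝ}

lemma pext_ode (hα : ∀ j, 0 ≤ α j) (hk : ∀ j, BddCont (k j)) (hk₁ : ∀ j, BddCont (k₁ j))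
    (hk₂ : ∀ j, BddCont (k₂ j)) (hc : Rapid c) {e : ℝ} {i : Fin d}
    (hode : ∀ x y, 0 < x → 0 < y → y ^ 2 * k₂ i (x * y) + 2 * α i / x * (y * k₁ i (x * y))
      = -(y ^ 2 * k i (x * y)) + e / x ^ 2 * k i (x * y))
    {x : Fin d → ℝ} (hx : x ∈ posOrth d) (t : ℝ) :
    pext α (Function.update k i (k₂ i)) (fun y => y i * (y i * c y)) x t
      + 2 * α i / x i * pext α (Function.update k i (k₁ i)) (fun y => y i * c y) x t
      = -pext α k (fun y => y i * (y i * c y)) x t + e / x i ^ 2 * pext α k c x t := by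
  have h1 := integrable_pext (α := α) hα (bddCont_update hk (hk₁ i) (i := i)) (hc.coord_mul i) x t
  have h2 := integrable_pext (α := α) hα (bddCont_update hk (hk₂ i) (i := i))
    ((hc.coord_mul i).coord_mul i) x t
  have h3 := integrable_pext (α := α) hα hk ((hc.coord_mul i).coord_mul i) x t
  have h4 := integrable_pext (α := α) hα hk hc x t
  unfold pext
  rw [← integral_const_mul, ← integral_const_mul, ← integral_neg,
    ← integral_add h2 (h1.const_mul _)]
  refine Eq.trans ?_ (integral_add h3.neg (h4.const_mul _))
  refine integral_congr_ae ?_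
  filter_upwards [ae_posOrth d α] with y hy
  rw [pker_update, pker_update, pker_eq k i]
  linear_combination (∏ j ∈ Finset.univ.erase i, k j (x j * y j)) * (pexp t y * c y)
    * hode (x i) (y i) (hx i) (hy i)

lemma sum_pext_sq (hα : ∀ j, 0 ≤ α j) (hk : ∀ j, BddCont (k j)) (hc : Rapid c)
    (x : Fin d → ℝ) (t : ℝ) :
    ∑ i, pext α k (fun y => y i * (y i * c y)) x t
      = pext α k (fun y => -(eNorm d y * -(eNorm d y * c y))) x t := by
  unfold pext
  rw [← integral_finsetSum _ fun i _ => integrable_pext hα hk ((hc.coord_mul i).coord_mul i) x t]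
  congr 1; ext y
  have h : eNorm d y * (eNorm d y * c y) = ∑ i, y i * (y i * c y) := by
    rw [← mul_assoc, ← pow_two, eNorm_sq, nsq, Finset.sum_mul]
    exact Finset.sum_congr rfl fun i _ => by ring
  beta_reduce
  rw [mul_neg (eNorm d y), neg_neg, h, Finset.mul_sum, Finset.mul_sum]

lemma pextJet_isPoisson (hα : ∀ j, 0 ≤ α j) (hk : ∀ j, BddCont (k j)) (hk₁ : ∀ j, BddCont (k₁ j))
    (hk₂ : ∀ j, BddCont (k₂ j)) (hc : Rapid c)
    (hd₁ : ∀ j z, HasDerivAt (k j) (k₁ j z) z) (hd₂ : ∀ j z, HasDerivAt (k₁ j) (k₂ j z) z)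
    {e : Fin d → ℝ} (he : ∀ j, 0 ≤ e j)
    (hode : ∀ i x y, 0 < x → 0 < y → y ^ 2 * k₂ i (x * y) + 2 * α i / x * (y * k₁ i (x * y))
      = -(y ^ 2 * k i (x * y)) + e i / x ^ 2 * k i (x * y))
    (hfac : ∀ i, (∃ l, BddCont l ∧ k i = fun z => z * l z) ∨
      ∃ l, BddCont l ∧ k₁ i = fun z => z * l z)
    (hsq : (∀ t, Integrable (fun x => pext α k c x t ^ 2) (wMeasure d α)) ∧
      (∃ C, ∀ t, ∫ x, pext α k c x t ^ 2 ∂(wMeasure d α) ≤ C) ∧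
      Tendsto (fun t => ∫ x, pext α k c x t ^ 2 ∂(wMeasure d α)) atTop (nhds 0)) :
    (pextJet α k k₁ k₂ c).IsPoisson α := by
  have hu₁ : ∀ i j, BddCont (Function.update k i (k₁ i) j) := fun i => bddCont_update hk (hk₁ i)
  have hu₂ : ∀ i j, BddCont (Function.update k i (k₂ i) j) := fun i => bddCont_update hk (hk₂ i)
  have hc₁ := fun i => hc.coord_mul i
  have hc₂ := fun i => (hc₁ i).coord_mul i
  refine ⟨continuous_pext hα hk hc, fun i => continuous_pext hα (hu₁ i) (hc₁ i),
    fun i => continuous_pext hα (hu₂ i) (hc₂ i), continuous_pext hα hk hc.eNorm_mul.neg,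
    continuous_pext hα hk hc.eNorm_mul.neg.eNorm_mul.neg, ?_,
    fun i x t s => hasDerivAt_pext_coord hα hk hc (hk₁ i) (hd₁ i) x t s, fun i x t s => ?_,
    fun x t ht => hasDerivAt_pext_time hα hk hc x ht,
    fun x t ht => hasDerivAt_pext_time hα hk hc.eNorm_mul.neg x ht, fun x hx t => ?_,
    hsq.1, hsq.2.1, hsq.2.2⟩
  · obtain ⟨A, hA⟩ := pext_bound (α := α) hα hk hc
    choose A₁ hA₁ using fun i => pext_bound (α := α) hα (hu₁ i) (hc₁ i)
    choose A₂ hA₂ using fun i => pext_bound (α := α) hα (hu₂ i) (hc₂ i)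
    obtain ⟨A₃, hA₃⟩ := pext_bound (α := α) hα hk hc.eNorm_mul.neg
    obtain ⟨A₄, hA₄⟩ := pext_bound (α := α) hα hk hc.eNorm_mul.neg.eNorm_mul.neg
    have h5 : ∀ i, ∃ C, ∀ x t, |pext α k c x t
        * pext α (Function.update k i (k₁ i)) (fun y => y i * c y) x t| ≤ C * |x i| := by
      intro i
      rcases hfac i with ⟨l, hl, h⟩ | ⟨l, hl, h⟩
      · obtain ⟨D, hD⟩ := pext_bound (α := α) hα (bddCont_update hk hl (i := i)) (hc₁ i)
        refine ⟨D * A₁ i, fun x t => ?_⟩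
        have : pext α k c x t = x i * pext α (Function.update k i l) (fun y => y i * c y) x t := by
          rw [← pext_factor, ← h, Function.update_eq_self]
        rw [this, abs_mul, abs_mul]
        have h1 := mul_le_mul (hD x t) (hA₁ i x t) (abs_nonneg _) ((abs_nonneg _).trans (hD x t))
        nlinarith [mul_le_mul_of_nonneg_left h1 (abs_nonneg (x i))]
      · obtain ⟨D, hD⟩ := pext_bound (α := α) hα (bddCont_update hk hl (i := i)) (hc₂ i)
        refine ⟨A * D, fun x t => ?_⟩
        rw [h, pext_factor, abs_mul, abs_mul]
        have h1 := mul_le_mul (hA x t) (hD x t) (abs_nonneg _) ((abs_nonneg _).trans (hA x t))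
        nlinarith [mul_le_mul_of_nonneg_left h1 (abs_nonneg (x i))]
    choose A₅ hA₅ using h5
    set M := |A| + ∑ i, |A₁ i| + ∑ i, |A₂ i| + |A₃| + |A₄| + ∑ i, |A₅ i| with hM
    have s₁ : ∀ i, |A₁ i| ≤ ∑ i, |A₁ i| := fun i =>
      Finset.single_le_sum (f := fun i => |A₁ i|) (fun _ _ => abs_nonneg _) (Finset.mem_univ i)
    have s₂ : ∀ i, |A₂ i| ≤ ∑ i, |A₂ i| := fun i =>
      Finset.single_le_sum (f := fun i => |A₂ i|) (fun _ _ => abs_nonneg _) (Finset.mem_univ i)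
    have s₅ : ∀ i, |A₅ i| ≤ ∑ i, |A₅ i| := fun i =>
      Finset.single_le_sum (f := fun i => |A₅ i|) (fun _ _ => abs_nonneg _) (Finset.mem_univ i)
    have t₁ : 0 ≤ ∑ i, |A₁ i| := Finset.sum_nonneg fun _ _ => abs_nonneg _
    have t₂ : 0 ≤ ∑ i, |A₂ i| := Finset.sum_nonneg fun _ _ => abs_nonneg _
    have t₅ : 0 ≤ ∑ i, |A₅ i| := Finset.sum_nonneg fun _ _ => abs_nonneg _
    have t := abs_nonneg A
    have t₃ := abs_nonneg A₃
    have t₄ := abs_nonneg A₄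
    refine ⟨M, by positivity, fun x t => ⟨(hA x t).trans ?_, fun i => (hA₁ i x t).trans ?_,
      fun i => (hA₂ i x t).trans ?_, (hA₃ x t).trans ?_, (hA₄ x t).trans ?_,
      fun i => (hA₅ i x t).trans ?_⟩⟩
    · linarith [le_abs_self A]
    · linarith [le_abs_self (A₁ i), s₁ i]
    · linarith [le_abs_self (A₂ i), s₂ i]
    · linarith [le_abs_self A₃]
    · linarith [le_abs_self A₄]
    · exact mul_le_mul_of_nonneg_right (by linarith [le_abs_self (A₅ i), s₅ i]) (abs_nonneg _)
  · have h := hasDerivAt_pext_coord (α := α) hα (hu₁ i) (hc₁ i) (hk₂ i) (i := i)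
      (fun z => by simpa using hd₂ i z) x t s
    simpa [pextJet] using h
  · have h : (pextJet α k k₁ k₂ c).vtt x t + ∑ i, ((pextJet α k k₁ k₂ c).vxx i x t
        + 2 * α i / x i * (pextJet α k k₁ k₂ c).vx i x t)
        = (∑ i, e i / x i ^ 2) * (pextJet α k k₁ k₂ c).v x t := by
      simp only [pextJet]
      rw [Finset.sum_congr rfl fun i _ => pext_ode hα hk hk₁ hk₂ hc (hode i) hx t,
        Finset.sum_add_distrib, Finset.sum_neg_distrib, sum_pext_sq hα hk hc, Finset.sum_mul]
      ring
    rw [h]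
    have : 0 ≤ ∑ i, e i / x i ^ 2 := Finset.sum_nonneg fun i _ => div_nonneg (he i) (sq_nonneg _)
    nlinarith [mul_nonneg this (sq_nonneg ((pextJet α k k₁ k₂ c).v x t))]

end

/-- The jet of the Poisson extension with spectral density `c`. -/
def poissonJet (α : Fin d → ℝ) (c : (Fin d → ℝ) → ℝ) : Jet d :=
  pextJet α (fun j => bes (α j)) (fun j z => -bes' (α j) z)
    (fun j z => -(bes (α j) z - 2 * α j * bes (α j + 1) z)) c

lemma bddCont_psi₁ {a : ℝ} (ha : 0 ≤ a) : BddCont fun z => bes a z - 2 * a * bes (a + 1) z := by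
  simpa [sub_eq_add_neg] using
    (bddCont_bes ha).add (((bddCont_bes (by linarith : 0 ≤ a + 1)).const_mul (2 * a)).neg)

lemma poissonJet_isPoisson (hd : 0 < d) (hα : ∀ j, 0 ≤ α j) {c : (Fin d → ℝ) → ℝ} (hc : Rapid c) :
    (poissonJet α c).IsPoisson α := by
  refine pextJet_isPoisson (e := 0) hα (fun j => bddCont_bes (hα j))
    (fun j => (bddCont_bes' (hα j)).neg) (fun j => (bddCont_psi₁ (hα j)).neg) hc
    (fun j => hasDerivAt_bes (hα j)) (fun j => hasDerivAt_neg_bes' (hα j)) (fun _ => le_rfl)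
    (fun i x y hx hy => ?_)
    (fun i => Or.inr ⟨fun z => -bes (α i + 1) z,
      (bddCont_bes (by linarith [hα i])).neg, by ext z; rw [bes']; ring⟩) ?_
  · rw [bes']
    simp only [Pi.zero_apply]
    field_simp
    ring
  · simp_rw [pext_bes]
    exact sq_pext_ht hd hα hc

/-- The jet of the conjugate Poisson extension in direction `i`. -/
def conjJet (α : Fin d → ℝ) (i : Fin d) (c : (Fin d → ℝ) → ℝ) : Jet d :=
  pextJet α (Function.update (fun j => bes (α j)) i (bes' (α i)))
    (Function.update (fun j z => -bes' (α j) z) i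
      (fun z => bes (α i) z - 2 * α i * bes (α i + 1) z))
    (Function.update (fun j z => -(bes (α j) z - 2 * α j * bes (α j + 1) z)) i
      (fun z => -bes' (α i) z + 2 * α i * bes' (α i + 1) z)) (fun y => y i * c y)

lemma add_single_nonneg (hα : ∀ j, 0 ≤ α j) (i j : Fin d) :
    0 ≤ (α + Pi.single i 1 : Fin d → ℝ) j := by
  by_cases h : j = i
  · subst h; simpa using (hα j).trans (by linarith)
  · simpa [h] using hα j

lemma conjJet_isPoisson (hd : 0 < d) (hα : ∀ j, 0 ≤ α j) (i : Fin d) {c : (Fin d → ℝ) → ℝ}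
    (hc : Rapid c) : (conjJet α i c).IsPoisson α := by
  refine pextJet_isPoisson (e := Function.update 0 i (2 * α i)) hα
    (bddCont_update (fun j => bddCont_bes (hα j)) (bddCont_bes' (hα i)))
    (bddCont_update (fun j => (bddCont_bes' (hα j)).neg) (bddCont_psi₁ (hα i)))
    (bddCont_update (fun j => (bddCont_psi₁ (hα j)).neg) ((bddCont_bes' (hα i)).neg.add
      ((bddCont_bes' (by linarith [hα i])).const_mul _))) (hc.coord_mul i) ?_ ?_ ?_ ?_ ?_ ?_
  · intro j z
    by_cases h : j = i
    · subst h; simpa using hasDerivAt_bes'_aux (hα j) z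
    · simpa [h, bes'] using hasDerivAt_bes (hα j) z
  · intro j z
    by_cases h : j = i
    · subst h
      simp only [Function.update_self]
      refine ((hasDerivAt_bes (hα j) z).sub ((hasDerivAt_bes (by linarith [hα j] : 0 ≤ α j + 1)
        z).const_mul (2 * α j))).congr_deriv ?_
      simp only [bes']
      ring
    · simpa [h] using hasDerivAt_neg_bes' (hα j) z
  · intro j
    by_cases h : j = i
    · subst h; simpa using hα j
    · simp [h]
  · intro j x y hx hy
    by_cases h : j = i
    · subst h
      simp only [Function.update_self, bes']
      have hr := bes_recurrence (hα j) (x * y)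
      have e : α j + 1 + 1 = α j + 2 := by ring
      rw [hr, e]
      field_simp
      ring
    · simp only [Function.update_of_ne h, bes', Pi.zero_apply]
      field_simp
      ring
  · intro j
    by_cases h : j = i
    · subst h
      exact Or.inl ⟨bes (α j + 1), bddCont_bes (by linarith [hα j]), by
        ext z; simp [bes']⟩
    · exact Or.inr ⟨fun z => -bes (α j + 1) z,
        (bddCont_bes (by linarith [hα j])).neg, by ext z; simp [h, bes']⟩
  · simp_rw [pext_bes']
    have h := sq_pext_ht (α := α + Pi.single i 1) hd (add_single_nonneg hα i) hc
    simp_rw [mul_pow, ← integral_wMeasure_add_single, ← integrable_wMeasure_add_single]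
    exact h

end

section
variable {d : ℕ} {α : Fin d → ℝ}

lemma ae_wMeasure_iff (d : ℕ) (α : Fin d → ℝ) (P : (Fin d → ℝ) → Prop) :
    (∀ᵐ x ∂(wMeasure d α), P x) ↔ ∀ᵐ x ∂(volume.restrict (posOrth d)), P x := by
  have h1 : wMeasure d α ≪ volume.restrict (posOrth d) := withDensity_absolutelyContinuous _ _
  have h2 : volume.restrict (posOrth d) ≪ wMeasure d α := by
    refine withDensity_absolutelyContinuous' (Measurable.aemeasurable (by fun_prop)) ?_
    refine (ae_restrict_mem (measurableSet_posOrth d)).mono fun x hx => ?_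
    rw [Ne, ENNReal.ofReal_eq_zero, not_le]
    exact Finset.prod_pos fun j _ => Real.rpow_pos_of_pos (hx j) _
  exact ⟨fun h => h2.ae_le h, fun h => h1.ae_le h⟩

lemma poissonJet_v_zero (hα : ∀ j, 0 ≤ α j) {f : (Fin d → ℝ) → ℝ} (hf : CcInfPos d f) :
    (fun x => (poissonJet α (ht α f)).v x 0) =ᵐ[wMeasure d α] f := by
  have h := ht_ht_ae hα (hf.integrable hα) ((rapid_ht hα hf).integrable hα)
  filter_upwards [h] with x hx
  change pext α (fun j => bes (α j)) _ x 0 = _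
  rw [pext_bes]
  simpa [pexp_zero] using hx

/-- The spectral density of the conjugate extension. -/
def conjHat (α : Fin d → ℝ) (i : Fin d) (g : (Fin d → ℝ) → ℝ) : (Fin d → ℝ) → ℝ :=
  ht (α + Pi.single i 1) fun x => (x i)⁻¹ * g x

lemma rapid_conjHat (hα : ∀ j, 0 ≤ α j) (i : Fin d) {g : (Fin d → ℝ) → ℝ} (hg : CcInfPos d g) :
    Rapid (conjHat α i g) := rapid_ht (add_single_nonneg hα i) (hg.inv_mul i)

lemma conjJet_v_zero (hα : ∀ j, 0 ≤ α j) (i : Fin d) {g : (Fin d → ℝ) → ℝ} (hg : CcInfPos d g) :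
    (fun x => (conjJet α i (conjHat α i g)).v x 0) =ᵐ[wMeasure d α] g := by
  have hα' := add_single_nonneg hα i
  have h := ht_ht_ae hα' ((hg.inv_mul i).integrable hα')
    ((rapid_conjHat hα i hg).integrable hα')
  have h' := (ae_wMeasure_iff d _ _).1 h
  have h2 := (ae_wMeasure_iff d α _).2 h'
  filter_upwards [h2, ae_posOrth d α] with x hx hp
  change pext α _ _ x 0 = _
  rw [pext_bes']
  have := (hp i).ne'
  simp only [pexp_zero, one_mul]
  unfold conjHat
  rw [hx]
  field_simp

lemma pext_neg (k : Fin d → ℝ → ℝ) (i : Fin d) (l : ℝ → ℝ) (c : (Fin d → ℝ) → ℝ)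
    (x : Fin d → ℝ) (t : ℝ) : pext α (Function.update k i fun z => -l z) c x t
      = -pext α (Function.update k i l) c x t := by
  unfold pext
  rw [← integral_neg]
  congr 1; ext y
  rw [pker_update, pker_update]
  ring

lemma poissonJet_vx (α : Fin d → ℝ) (i : Fin d) (c : (Fin d → ℝ) → ℝ) (x : Fin d → ℝ) (t : ℝ) :
    (poissonJet α c).vx i x t = -(x i * ht (α + Pi.single i 1) (fun y => pexp t y * c y) x) := by
  change pext α (Function.update _ i fun z => -bes' (α i) z) _ x t = _
  rw [pext_neg, pext_bes']

lemma conjJet_vt (α : Fin d → ℝ) (i : Fin d) (c : (Fin d → ℝ) → ℝ) (x : Fin d → ℝ) (t : ℝ) :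
    (conjJet α i c).vt x t
      = -(x i * ht (α + Pi.single i 1) (fun y => pexp t y * (eNorm d y * c y)) x) := by
  change pext α _ (fun y => -(eNorm d y * (y i * c y))) x t = _
  have : (fun y => -(eNorm d y * (y i * c y))) = fun y => y i * (-(eNorm d y * c y)) := by
    ext y; ring
  rw [this, pext_bes', ← mul_neg]
  congr 1
  unfold ht
  rw [← integral_neg]
  congr 1; ext y; ring

lemma integrable_poissonJet_vx_sq (hα : ∀ j, 0 ≤ α j) (i : Fin d) {c : (Fin d → ℝ) → ℝ}
    (hd : 0 < d) (hc : Rapid c) :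
    (∀ t, Integrable (fun x => (poissonJet α c).vx i x t ^ 2) (wMeasure d α)) ∧
    ∃ C, ∀ t, ∫ x, (poissonJet α c).vx i x t ^ 2 ∂(wMeasure d α) ≤ C := by
  simp_rw [poissonJet_vx, neg_sq, mul_pow, ← integral_wMeasure_add_single,
    ← integrable_wMeasure_add_single]
  have h := sq_pext_ht hd (add_single_nonneg hα i) hc
  exact ⟨h.1, h.2.1⟩

lemma integrable_conjJet_vt_sq (hα : ∀ j, 0 ≤ α j) (i : Fin d) {c : (Fin d → ℝ) → ℝ}
    (hd : 0 < d) (hc : Rapid c) :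
    (∀ t, Integrable (fun x => (conjJet α i c).vt x t ^ 2) (wMeasure d α)) ∧
    ∃ C, ∀ t, ∫ x, (conjJet α i c).vt x t ^ 2 ∂(wMeasure d α) ≤ C := by
  simp_rw [conjJet_vt, neg_sq, mul_pow, ← integral_wMeasure_add_single,
    ← integrable_wMeasure_add_single]
  have h := sq_pext_ht hd (add_single_nonneg hα i) hc.eNorm_mul
  exact ⟨h.1, h.2.1⟩

lemma integral_vx_mul_vt (hα : ∀ j, 0 ≤ α j) (i : Fin d) {c c' : (Fin d → ℝ) → ℝ}
    (hc : Rapid c) (hc' : Rapid c') (t : ℝ) :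
    ∫ x, (poissonJet α c).vx i x t * (conjJet α i c').vt x t ∂(wMeasure d α)
      = ∫ y, pexp t y ^ 2 * (eNorm d y * c y * c' y) ∂(wMeasure d (α + Pi.single i 1)) := by
  have hα' := add_single_nonneg hα i
  have h1 := hc.pexp_mul t
  have h2 := hc'.eNorm_mul.pexp_mul t
  have P1 := ht_plancherel hα' (h1.integrable hα') (h1.memLp_two hα')
  have P2 := ht_plancherel hα' (h2.integrable hα') (h2.memLp_two hα')
  have key := P1.2 _ (h2.integrable hα') (h2.memLp_two hα') P2.1
  rw [integral_wMeasure_add_single] at key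
  simp_rw [poissonJet_vx, conjJet_vt]
  refine Eq.trans ?_ (key.trans ?_)
  · congr 1; ext x; ring
  · congr 1; ext x; ring

lemma rapid_div_integrable (hα : ∀ j, 0 ≤ α j) (i : Fin d) {c : (Fin d → ℝ) → ℝ}
    (hc : Rapid c) :
    Integrable (fun y => 1 / eNorm d y * c y) (wMeasure d (α + Pi.single i 1)) := by
  rw [integrable_wMeasure_add_single]
  refine ((hc.coord_mul i).integrable hα).mono ?_ ?_
  · have := hc.1
    exact Measurable.aestronglyMeasurable (by fun_prop)
  · filter_upwards [ae_posOrth d α] with y hy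
    have hn := eNorm_pos hy i
    have h1 := abs_le_eNorm y i
    rw [norm_mul, norm_mul, norm_mul, ← mul_assoc]
    refine mul_le_mul_of_nonneg_right ?_ (norm_nonneg _)
    simp only [Real.norm_eq_abs, one_div, abs_inv, abs_of_pos hn, abs_pow]
    rw [← div_eq_mul_inv, div_le_iff₀ hn, pow_two]
    exact mul_le_mul_of_nonneg_left h1 (abs_nonneg _)

lemma integral_riesz_mul (hα : ∀ j, 0 ≤ α j) (i : Fin d) {f g : (Fin d → ℝ) → ℝ}
    (hf : CcInfPos d f) (hg : CcInfPos d g) :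
    ∫ x, riesz d α i f x * g x ∂(wMeasure d α)
      = -∫ y, 1 / eNorm d y * ht α f y * conjHat α i g y ∂(wMeasure d (α + Pi.single i 1)) := by
  have hα' := add_single_nonneg hα i
  have hH := rapid_div_integrable hα i (rapid_ht hα hf)
  have hG := (hg.inv_mul i).integrable hα'
  rw [conjHat, ← integral_ht_mul hα' hH hG, integral_wMeasure_add_single, ← integral_neg]
  refine integral_congr_ae ?_
  filter_upwards [ae_posOrth d α] with x hx
  have hr : riesz d α i f x
      = -(x i) * ht (α + Pi.single i 1) (fun y => 1 / eNorm d y * ht α f y) x := by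
    unfold riesz
    rw [hankel_eq_ht _ hx]
    congr 1
    refine congrFun (ht_congr ?_) x
    filter_upwards [ae_posOrth d (α + Pi.single i 1)] with y hy
    rw [hankel_eq_ht _ hy]
  have := (hx i).ne'
  rw [hr]
  field_simp

lemma integral_parabola_mul_exp {a T : ℝ} (ha : 0 < a) (hT : 0 < T) :
    ∫ t in (0 : ℝ)..T, (t - t ^ 2 / T) * exp (-(a * t))
      = exp (-(a * T)) * (1 / a ^ 2 + 2 / (T * a ^ 3)) + 1 / a ^ 2 - 2 / (T * a ^ 3) := by
  have hd : ∀ t ∈ uIcc 0 T, HasDerivAt (fun t => -exp (-(a * t)) *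
      ((t - t ^ 2 / T) / a + (1 - 2 * t / T) / a ^ 2 + (-2 / T) / a ^ 3))
      ((t - t ^ 2 / T) * exp (-(a * t))) t := by
    intro t _
    have h1 : HasDerivAt (fun t => -exp (-(a * t))) (-(exp (-(a * t)) * -(a * 1))) t :=
      (((hasDerivAt_id t).const_mul a).neg.exp).neg
    have h2 : HasDerivAt (fun t : ℝ => (t - t ^ 2 / T) / a + (1 - 2 * t / T) / a ^ 2
        + (-2 / T) / a ^ 3) ((1 - 2 * t / T) / a + (0 - 2 / T) / a ^ 2) t := by
      have e1 : HasDerivAt (fun t : ℝ => t - t ^ 2 / T) (1 - 2 * t / T) t := by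
        have := (hasDerivAt_id' t).fun_sub ((hasDerivAt_pow 2 t).div_const T)
        simpa using this
      have e2 : HasDerivAt (fun t : ℝ => 1 - 2 * t / T) (0 - 2 / T) t := by
        simpa using (((hasDerivAt_id t).const_mul 2).div_const T).const_sub 1
      exact ((e1.div_const a).add (e2.div_const (a ^ 2))).add_const _
    refine (h1.mul h2).congr_deriv ?_
    field_simp
    ring
  rw [intervalIntegral.integral_eq_sub_of_hasDerivAt hd
    (Continuous.intervalIntegrable (by fun_prop) _ _)]
  simp
  field_simp
  ring

lemma integral_parabola_mul_exp_nonneg {a T : ℝ} (hT : 0 < T) :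
    0 ≤ ∫ t in (0 : ℝ)..T, (t - t ^ 2 / T) * exp (-(a * t)) := by
  refine intervalIntegral.integral_nonneg hT.le fun t ht => mul_nonneg ?_ (exp_pos _).le
  rw [sub_nonneg, div_le_iff₀ hT]
  nlinarith [ht.1, ht.2]

lemma integral_parabola_mul_exp_le {a T : ℝ} (ha : 0 < a) (hT : 0 < T) :
    ∫ t in (0 : ℝ)..T, (t - t ^ 2 / T) * exp (-(a * t)) ≤ 1 / a ^ 2 := by
  rw [integral_parabola_mul_exp ha hT]
  have h1 : exp (-(a * T)) * (a * T + 1) ≤ 1 := by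
    have := add_one_le_exp (a * T)
    have h2 : exp (-(a * T)) * exp (a * T) = 1 := by rw [← exp_add]; simp
    nlinarith [exp_pos (-(a * T))]
  have hs : 0 < a * T := by positivity
  have h3 : exp (-(a * T)) * (a * T + 2) ≤ 2 := by nlinarith [exp_pos (-(a * T))]
  have h4 : exp (-(a * T)) * (1 / a ^ 2 + 2 / (T * a ^ 3))
      = exp (-(a * T)) * (a * T + 2) * (1 / (T * a ^ 3)) := by field_simp
  rw [h4]
  have h5 : 0 < 1 / (T * a ^ 3) := by positivity
  have h6 : 2 / (T * a ^ 3) = 2 * (1 / (T * a ^ 3)) := by ring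
  rw [h6]
  nlinarith

lemma tendsto_integral_parabola_mul_exp {a : ℝ} (ha : 0 < a) :
    Tendsto (fun T => ∫ t in (0 : ℝ)..T, (t - t ^ 2 / T) * exp (-(a * t))) atTop
      (nhds (1 / a ^ 2)) := by
  have h1 : Tendsto (fun T => exp (-(a * T))) atTop (nhds 0) :=
    Real.tendsto_exp_atBot.comp (tendsto_neg_atTop_atBot.comp (tendsto_id.const_mul_atTop ha))
  have h2 : Tendsto (fun T : ℝ => 2 / (T * a ^ 3)) atTop (nhds 0) :=
    (tendsto_id.atTop_mul_const (by positivity : 0 < a ^ 3)).const_div_atTop 2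
  have h3 := ((h1.mul (h2.const_add (1 / a ^ 2))).add_const (1 / a ^ 2)).sub h2
  simp only [zero_mul, zero_add, sub_zero] at h3
  refine h3.congr' ?_
  filter_upwards [eventually_gt_atTop 0] with T hT
  rw [integral_parabola_mul_exp ha hT]

lemma tendsto_integral_vx_mul_vt (hα : ∀ j, 0 ≤ α j) (i : Fin d) {f g : (Fin d → ℝ) → ℝ}
    (hf : CcInfPos d f) (hg : CcInfPos d g) :
    Tendsto (fun T => ∫ t in (0 : ℝ)..T, (t - t ^ 2 / T) *
        ∫ x, (poissonJet α (ht α f)).vx i x t * (conjJet α i (conjHat α i g)).vt x t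
          ∂(wMeasure d α)) atTop
      (nhds (-(1 / 4) * ∫ x, riesz d α i f x * g x ∂(wMeasure d α))) := by
  have hα' := add_single_nonneg hα i
  have hc := rapid_ht hα hf
  have hc' := rapid_conjHat hα i hg
  set c := ht α f
  set c' := conjHat α i g
  set ν := wMeasure d (α + Pi.single i 1)
  set h : (Fin d → ℝ) → ℝ := fun y => eNorm d y * c y * c' y
  have hhR : Rapid h := hc.eNorm_mul.mul hc'
  have hh : Integrable h ν := hhR.integrable hα'
  have hswap : ∀ T > 0, ∫ t in (0 : ℝ)..T, (t - t ^ 2 / T) *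
        ∫ x, (poissonJet α c).vx i x t * (conjJet α i c').vt x t ∂(wMeasure d α)
      = ∫ y, (∫ t in (0 : ℝ)..T, (t - t ^ 2 / T) * exp (-(2 * eNorm d y * t))) * h y ∂ν := by
    intro T hT
    have e1 : ∀ t ∈ uIcc 0 T, (t - t ^ 2 / T) *
        ∫ x, (poissonJet α c).vx i x t * (conjJet α i c').vt x t ∂(wMeasure d α)
        = ∫ y, (t - t ^ 2 / T) * exp (-(2 * eNorm d y * t)) * h y ∂ν := by
      intro t ht
      rw [uIcc_of_le hT.le] at ht
      rw [integral_vx_mul_vt hα i hc hc' t, ← integral_const_mul]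
      congr 1; ext y
      have : pexp t y ^ 2 = exp (-(2 * eNorm d y * t)) := by
        rw [pexp, abs_of_nonneg ht.1, ← exp_nat_mul]
        congr 1
        push_cast; ring
      rw [this]
      ring
    rw [intervalIntegral.integral_congr e1, intervalIntegral_integral_swap]
    · congr 1; ext y
      rw [intervalIntegral.integral_mul_const]
    · have hφ : Integrable (fun t : ℝ => t - t ^ 2 / T) (volume.restrict (uIoc 0 T)) :=
        intervalIntegrable_iff.1 (Continuous.intervalIntegrable (by fun_prop) _ _)
      refine (hφ.mul_prod hh).mono ?_ ?_
      · have h1 := continuous_eNorm (d := d)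
        have h2 := hhR.1
        exact Continuous.aestronglyMeasurable (by fun_prop)
      · have : ∀ᵐ p : ℝ × (Fin d → ℝ) ∂((volume.restrict (uIoc 0 T)).prod ν), p.1 ∈ uIoc 0 T :=
          Measure.quasiMeasurePreserving_fst.ae (ae_restrict_mem measurableSet_uIoc)
        filter_upwards [this] with p hp
        rw [uIoc_of_le hT.le] at hp
        change ‖(p.1 - p.1 ^ 2 / T) * exp (-(2 * eNorm d p.2 * p.1)) * h p.2‖ ≤ ‖(p.1 - p.1 ^ 2 / T) * h p.2‖
        have h3 : exp (-(2 * eNorm d p.2 * p.1)) ≤ 1 := by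
          rw [exp_le_one_iff, neg_nonpos]
          exact mul_nonneg (mul_nonneg two_pos.le (eNorm_nonneg _)) hp.1.le
        generalize h p.2 = z
        rw [norm_mul, norm_mul, norm_mul]
        refine mul_le_mul_of_nonneg_right ?_ (norm_nonneg _)
        refine mul_le_of_le_one_right (norm_nonneg _) ?_
        rwa [Real.norm_eq_abs, abs_of_pos (exp_pos _)]
  have hlim : -(1 / 4) * ∫ x, riesz d α i f x * g x ∂(wMeasure d α)
      = ∫ y, 1 / (2 * eNorm d y) ^ 2 * h y ∂ν := by
    rw [integral_riesz_mul hα i hf hg, neg_mul_neg, ← integral_const_mul]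
    refine integral_congr_ae ?_
    filter_upwards [ae_posOrth d (α + Pi.single i 1)] with y hy
    have hn := (eNorm_pos hy i).ne'
    simp only [h, c, c']
    field_simp
    ring
  rw [hlim]
  refine Tendsto.congr' (f₁ := fun T => ∫ y, (∫ t in (0 : ℝ)..T, (t - t ^ 2 / T) *
      exp (-(2 * eNorm d y * t))) * h y ∂ν) ?_ ?_
  · filter_upwards [eventually_gt_atTop 0] with T hT
    exact (hswap T hT).symm
  refine tendsto_integral_filter_of_dominated_convergence
    (fun y => ‖1 / eNorm d y * (c y * c' y)‖) ?_ ?_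
    (rapid_div_integrable hα i (hc.mul hc')).norm ?_
  · filter_upwards [eventually_gt_atTop 0] with T hT
    refine AEStronglyMeasurable.mul ?_ hh.1
    have : Continuous fun y : Fin d → ℝ => ∫ t in (0 : ℝ)..T, (t - t ^ 2 / T) *
        exp (-(2 * eNorm d y * t)) := by
      refine intervalIntegral.continuous_parametric_intervalIntegral_of_continuous' ?_ _ _
      have := continuous_eNorm (d := d)
      fun_prop
    exact this.aestronglyMeasurable
  · filter_upwards [eventually_gt_atTop 0] with T hT
    filter_upwards [ae_posOrth d (α + Pi.single i 1)] with y hy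
    have hn := eNorm_pos hy i
    have h1 := integral_parabola_mul_exp_le (a := 2 * eNorm d y) (by positivity) hT
    have h0 := integral_parabola_mul_exp_nonneg (a := 2 * eNorm d y) hT
    rw [norm_mul, Real.norm_eq_abs, abs_of_nonneg h0]
    refine (mul_le_mul_of_nonneg_right h1 (norm_nonneg _)).trans ?_
    simp only [h, norm_mul, Real.norm_eq_abs, abs_of_pos hn, one_div, abs_inv]
    have hcc : 0 ≤ |c y| * |c' y| := by positivity
    have : ((2 * eNorm d y) ^ 2)⁻¹ * (eNorm d y * |c y| * |c' y|)
        = (1 / 4) * ((eNorm d y)⁻¹ * (|c y| * |c' y|)) := by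
      field_simp; ring
    rw [this]
    have : 0 ≤ (eNorm d y)⁻¹ * (|c y| * |c' y|) := by positivity
    linarith
  · filter_upwards [ae_posOrth d (α + Pi.single i 1)] with y hy
    have hn := eNorm_pos hy i
    exact (tendsto_integral_parabola_mul_exp (by positivity)).mul_const _

end

/-- `∂_u∂_u` of the Bellman function, as a function of `u`, `ρ`. -/
def bellUU (δ u ρ : ℝ) : ℝ :=
  (1 + δ) / δ ^ 2 * |u| ^ ((1 - δ) / δ) + 3 / 10 * δ * (ρ / √(u ^ 2 * ρ + 4 * ρ ^ (1 + δ))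
    - u ^ 2 * ρ ^ 2 / √(u ^ 2 * ρ + 4 * ρ ^ (1 + δ)) ^ 3)

/-- `∂_u∂_ρ` of the Bellman function. -/
def bellUR (δ u ρ : ℝ) : ℝ :=
  3 / 10 * δ * (u / √(u ^ 2 * ρ + 4 * ρ ^ (1 + δ))
    - u * ρ * (u ^ 2 + 4 * (1 + δ) * ρ ^ δ) / (2 * √(u ^ 2 * ρ + 4 * ρ ^ (1 + δ)) ^ 3))

/-- `∂_ρ∂_ρ` of the Bellman function. -/
def bellRR (δ u ρ : ℝ) : ℝ :=
  (1 - 3 / 5 * δ) * ((1 + δ) / 2 * ((δ - 1) / 2)) * ρ ^ ((δ - 3) / 2)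
    + 3 / 10 * δ * (2 * (1 + δ) * δ * ρ ^ (δ - 1) / √(u ^ 2 * ρ + 4 * ρ ^ (1 + δ))
      - (u ^ 2 + 4 * (1 + δ) * ρ ^ δ) ^ 2 / (4 * √(u ^ 2 * ρ + 4 * ρ ^ (1 + δ)) ^ 3))

/-- The nonnegative quotient `∂_u β / u`. -/
def bellUq (δ u ρ : ℝ) : ℝ :=
  (1 + δ) / δ * |u| ^ ((1 - δ) / δ) + 3 / 10 * δ * (ρ / √(u ^ 2 * ρ + 4 * ρ ^ (1 + δ)))

/-- `∂_ρ` of the Bellman function. -/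
def bellR (δ u ρ : ℝ) : ℝ :=
  (1 - 3 / 5 * δ) * ((1 + δ) / 2) * ρ ^ ((δ - 1) / 2)
    + 3 / 10 * δ * ((u ^ 2 + 4 * (1 + δ) * ρ ^ δ) / (2 * √(u ^ 2 * ρ + 4 * ρ ^ (1 + δ))))

/-- The Bellman function. -/
def bell (δ ε u ρ : ℝ) : ℝ :=
  |u| ^ ((1 + δ) / δ) + (1 - 3 / 5 * δ) * ρ ^ ((1 + δ) / 2)
    + 3 / 10 * δ * √(u ^ 2 * ρ + 4 * ρ ^ (1 + δ)) - ε ^ (1 + δ)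

/-- The convexity constant of the Bellman function. -/
def bellC (δ : ℝ) : ℝ := δ * (9 / 25 + 6 / 25 * δ)

section
variable {δ : ℝ}

lemma bellR_nonneg (h0 : 0 < δ) (h1 : δ ≤ 1) (u : ℝ) {ρ : ℝ} (hρ : 0 < ρ) : 0 ≤ bellR δ u ρ := by
  have : 0 ≤ 1 - 3 / 5 * δ := by linarith
  unfold bellR
  positivity

lemma bellUq_nonneg (h0 : 0 < δ) (u : ℝ) {ρ : ℝ} (hρ : 0 < ρ) : 0 ≤ bellUq δ u ρ := by
  unfold bellUq
  positivity

lemma sq_rpow {r : ℝ} (hr : 0 < r) (a : ℝ) : (r ^ 2) ^ a = r ^ (2 * a) := by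
  rw [← Real.rpow_natCast, ← Real.rpow_mul hr.le]; norm_num

lemma sqrt_bell {r m u n : ℝ} (hr : 0 < r) (hm : m = r ^ δ) (hn0 : 0 < n)
    (hn : n ^ 2 = u ^ 2 + 4 * m ^ 2) :
    √(u ^ 2 * r ^ 2 + 4 * (r ^ 2) ^ (1 + δ)) = r * n := by
  have : (r ^ 2) ^ (1 + δ) = r ^ 2 * m ^ 2 := by
    rw [sq_rpow hr, hm, ← Real.rpow_natCast r 2, ← Real.rpow_mul_natCast hr.le,
      ← Real.rpow_add hr]
    congr 1; push_cast; ring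
  rw [this]
  have : u ^ 2 * r ^ 2 + 4 * (r ^ 2 * m ^ 2) = (r * n) ^ 2 := by rw [mul_pow, hn]; ring
  rw [this, Real.sqrt_sq (by positivity)]

lemma quad_lower {P M N c : ℝ} (hP : 0 < P) (hN : 0 < N) (hM : 0 ≤ M)
    (h : (M + c / 2) ^ 2 ≤ P * N) :
    ∃ τ > 0, ∀ a w : ℝ, 0 ≤ w →
      c / 2 * (τ * a ^ 2 + w / τ) ≤ P * a ^ 2 - 2 * M * (|a| * √w) + N * w := by
  have hk : M + c / 2 ≤ √(P * N) := Real.le_sqrt_of_sq_le h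
  refine ⟨√(P / N), by positivity, fun a w hw => ?_⟩
  set τ := √(P / N)
  set k := √(P * N)
  have hτ : 0 < τ := by positivity
  have h1 : P = k * τ := by
    rw [← Real.sqrt_mul (by positivity)]
    have : P * N * (P / N) = P ^ 2 := by field_simp
    rw [this, Real.sqrt_sq hP.le]
  have h2 : N = k / τ := by
    rw [eq_div_iff hτ.ne']
    have : N * τ = √(N ^ 2 * (P / N)) := by
      rw [Real.sqrt_mul (by positivity), Real.sqrt_sq hN.le]
    rw [this]; congr 1; field_simp
  have h3 : 2 * (|a| * √w) ≤ τ * a ^ 2 + w / τ := by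
    have e1 : w = √w ^ 2 := (Real.sq_sqrt hw).symm
    have e2 : τ * a ^ 2 + w / τ - 2 * (|a| * √w) = (τ * |a| - √w) ^ 2 / τ := by
      nth_rewrite 1 [e1]
      rw [← sq_abs a]
      field_simp
      ring
    have : 0 ≤ (τ * |a| - √w) ^ 2 / τ := by positivity
    linarith
  have h4 : 0 ≤ τ * a ^ 2 + w / τ := by positivity
  have h5 : P * a ^ 2 + N * w = k * (τ * a ^ 2 + w / τ) := by
    rw [h1, h2]; field_simp
  have h6 : M * (2 * (|a| * √w)) ≤ M * (τ * a ^ 2 + w / τ) := mul_le_mul_of_nonneg_left h3 hM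
  have h7 : (M + c / 2) * (τ * a ^ 2 + w / τ) ≤ k * (τ * a ^ 2 + w / τ) :=
    mul_le_mul_of_nonneg_right hk h4
  linarith

/-- The discriminant bound behind the convexity of the Bellman function. -/
lemma bell_discriminant (h0 : 0 < δ) (h1 : δ ≤ 1) {r m u n L : ℝ} (hr : 0 < r) (hm0 : 0 < m)
    (hn0 : 0 < n) (hn : n ^ 2 = u ^ 2 + 4 * m ^ 2) (hL0 : 0 ≤ L) (hL : m ≤ |u| → r / m ≤ L) :
    (3 / 10 * δ * |u| / n + bellC δ / 2) ^ 2 ≤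
      ((1 + δ) / δ ^ 2 * L + 3 / 10 * δ * (4 * r * m ^ 2 / n ^ 3)) *
      ((1 + δ) * δ / r * ((1 - 3 / 5 * δ) * m + 3 / 10 * δ * (4 * m ^ 2 / n))) := by
  have hκ : 0 ≤ 1 - 3 / 5 * δ := by linarith
  unfold bellC
  rcases le_total |u| m with hu | hu
  · have hu2 : u ^ 2 ≤ m ^ 2 := by rw [← sq_abs u]; gcongr
    have hn5 : n ≤ 2.2361 * m := by
      refine abs_le_of_sq_le_sq' ?_ (by positivity) |>.2
      nlinarith
    have hM : |u| / n ≤ 0.4473 := by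
      rw [div_le_iff₀ hn0]
      refine abs_le_of_sq_le_sq' ?_ (by positivity) |>.2
      rw [sq_abs, mul_pow, hn]; nlinarith
    have hPl : 0.3571 * (r / m) ≤ 4 * r * m ^ 2 / n ^ 3 := by
      rw [← mul_div_assoc, div_le_div_iff₀ hm0 (by positivity)]
      have : n ^ 3 ≤ 5 * m ^ 2 * (2.2361 * m) := by
        have : n ^ 3 = n ^ 2 * n := by ring
        rw [this]; gcongr
        nlinarith
      calc 0.3571 * r * n ^ 3 ≤ 0.3571 * r * (5 * m ^ 2 * (2.2361 * m)) := by gcongr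
        _ ≤ _ := by nlinarith [mul_pos hr (pow_pos hm0 3)]
    have hNl : m * 1.78 ≤ 4 * m ^ 2 / n := by
      rw [le_div_iff₀ hn0]
      nlinarith
    have hx : (3 / 10 * δ * |u| / n + δ * (9 / 25 + 6 / 25 * δ) / 2) ^ 2
        ≤ (δ * (0.3142 + 0.12 * δ)) ^ 2 := by
      refine pow_le_pow_left₀ (by positivity) ?_ 2
      rw [mul_div_assoc]; nlinarith
    refine hx.trans ?_
    have hy : 3 / 10 * δ * (0.3571 * (r / m)) * ((1 + δ) * δ / r * (m * (1 - 0.066 * δ))) ≤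
        ((1 + δ) / δ ^ 2 * L + 3 / 10 * δ * (4 * r * m ^ 2 / n ^ 3)) *
        ((1 + δ) * δ / r * ((1 - 3 / 5 * δ) * m + 3 / 10 * δ * (4 * m ^ 2 / n))) := by
      have hq : 0 ≤ m * (1 - 0.066 * δ) := mul_nonneg hm0.le (by linarith)
      refine mul_le_mul ?_ ?_ (by positivity) (by positivity)
      · have : 0 ≤ (1 + δ) / δ ^ 2 * L := by positivity
        have : 3 / 10 * δ * (0.3571 * (r / m)) ≤ 3 / 10 * δ * (4 * r * m ^ 2 / n ^ 3) := by gcongr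
        linarith
      · refine mul_le_mul_of_nonneg_left ?_ (by positivity)
        have : 3 / 10 * δ * (m * 1.78) ≤ 3 / 10 * δ * (4 * m ^ 2 / n) := by gcongr
        linarith
    refine le_trans ?_ hy
    have e : 3 / 10 * δ * (0.3571 * (r / m)) * ((1 + δ) * δ / r * (m * (1 - 0.066 * δ)))
        = δ ^ 2 * (0.10713 * (1 + δ) * (1 - 0.066 * δ)) := by field_simp; ring
    rw [e, mul_pow]
    refine mul_le_mul_of_nonneg_left ?_ (by positivity)
    nlinarith [mul_nonneg h0.le (sub_nonneg.2 h1)]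
  · have hM : |u| / n ≤ 1 := by
      rw [div_le_one hn0]
      refine abs_le_of_sq_le_sq' ?_ hn0.le |>.2
      rw [sq_abs, hn]; nlinarith
    have hx : (3 / 10 * δ * |u| / n + δ * (9 / 25 + 6 / 25 * δ) / 2) ^ 2 ≤ 0.6 ^ 2 := by
      refine pow_le_pow_left₀ (by positivity) ?_ 2
      rw [mul_div_assoc]; nlinarith
    refine hx.trans ?_
    have hy : (1 + δ) / δ ^ 2 * (r / m) * ((1 + δ) * δ / r * ((1 - 3 / 5 * δ) * m)) ≤
        ((1 + δ) / δ ^ 2 * L + 3 / 10 * δ * (4 * r * m ^ 2 / n ^ 3)) *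
        ((1 + δ) * δ / r * ((1 - 3 / 5 * δ) * m + 3 / 10 * δ * (4 * m ^ 2 / n))) := by
      refine mul_le_mul ?_ ?_ (by positivity) (by positivity)
      · have : (1 + δ) / δ ^ 2 * (r / m) ≤ (1 + δ) / δ ^ 2 * L := by gcongr; exact hL hu
        have : 0 ≤ 3 / 10 * δ * (4 * r * m ^ 2 / n ^ 3) := by positivity
        linarith
      · refine mul_le_mul_of_nonneg_left ?_ (by positivity)
        have : 0 ≤ 3 / 10 * δ * (4 * m ^ 2 / n) := by positivity
        linarith
    refine le_trans ?_ hy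
    have e : (1 + δ) / δ ^ 2 * (r / m) * ((1 + δ) * δ / r * ((1 - 3 / 5 * δ) * m))
        = (1 + δ) ^ 2 * (1 - 3 / 5 * δ) / δ := by field_simp
    rw [e, le_div_iff₀ h0]
    nlinarith [mul_nonneg h0.le (sub_nonneg.2 h1)]

set_option maxHeartbeats 800000 in
lemma bell_convex (h0 : 0 < δ) (h1 : δ ≤ 1) (u : ℝ) {ρ : ℝ} (hρ : 0 < ρ) :
    ∃ τ > 0, ∀ a b w : ℝ, b ^ 2 ≤ 4 * ρ * w →
      bellC δ / 2 * (τ * a ^ 2 + w / τ) ≤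
        bellUU δ u ρ * a ^ 2 + 2 * bellUR δ u ρ * a * b + bellRR δ u ρ * b ^ 2
          + 2 * bellR δ u ρ * w := by
  obtain ⟨r, hr, rfl⟩ : ∃ r, 0 < r ∧ ρ = r ^ 2 := ⟨√ρ, by positivity, (Real.sq_sqrt hρ.le).symm⟩
  have hκ : 0 ≤ 1 - 3 / 5 * δ := by linarith
  obtain ⟨m, hm⟩ : ∃ m, m = r ^ δ := ⟨_, rfl⟩
  have hm0 : 0 < m := by rw [hm]; positivity
  obtain ⟨n, hn0, hn⟩ : ∃ n, 0 < n ∧ n ^ 2 = u ^ 2 + 4 * m ^ 2 :=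
    ⟨√(u ^ 2 + 4 * m ^ 2), by positivity, Real.sq_sqrt (by positivity)⟩
  have hS := sqrt_bell hr hm hn0 hn
  set L := |u| ^ ((1 - δ) / δ) with hLd
  have hL : m ≤ |u| → r / m ≤ L := by
    intro hmu
    have : r / m = m ^ ((1 - δ) / δ) := by
      rw [hm, ← Real.rpow_mul hr.le, mul_div_cancel₀ _ h0.ne', Real.rpow_sub hr, Real.rpow_one]
    rw [this]
    exact Real.rpow_le_rpow hm0.le hmu (div_nonneg (by linarith) h0.le)
  have e1 : (r ^ 2) ^ δ = m ^ 2 := by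
    rw [sq_rpow hr, hm, ← Real.rpow_mul_natCast hr.le]; congr 1; push_cast; ring
  have e2 : (r ^ 2) ^ (δ - 1) = m ^ 2 / r ^ 2 := by
    rw [Real.rpow_sub (by positivity), e1, Real.rpow_one]
  have e3 : (r ^ 2) ^ ((δ - 1) / 2) = m / r := by
    rw [sq_rpow hr, mul_div_cancel₀ _ two_ne_zero, Real.rpow_sub hr, Real.rpow_one, hm]
  have e4 : (r ^ 2) ^ ((δ - 3) / 2) = m / r ^ 3 := by
    rw [sq_rpow hr, mul_div_cancel₀ _ two_ne_zero, Real.rpow_sub hr, hm]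
    norm_cast
  have hUU : bellUU δ u (r ^ 2)
      = (1 + δ) / δ ^ 2 * L + 3 / 10 * δ * (4 * r * m ^ 2 / n ^ 3) := by
    unfold bellUU
    rw [hS]
    congr 2
    have : 4 * m ^ 2 = n ^ 2 - u ^ 2 := by linarith
    have h4 : 4 * r * m ^ 2 = r * (n ^ 2 - u ^ 2) := by rw [← this]; ring
    rw [h4]; field_simp
  have hUR : 2 * r * bellUR δ u (r ^ 2)
      = 3 / 10 * δ * u / n * ((u ^ 2 + 4 * (1 - δ) * m ^ 2) / n ^ 2) := by
    unfold bellUR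
    rw [hS, e1]
    field_simp
    rw [hn]; ring
  have hR : 2 * bellR δ u (r ^ 2) = (1 + δ) / r * ((1 - 3 / 5 * δ) * m)
      + 3 / 10 * δ * ((u ^ 2 + 4 * (1 + δ) * m ^ 2) / (r * n)) := by
    unfold bellR
    rw [hS, e1, e3]
    field_simp
  have hRR : 4 * r ^ 2 * bellRR δ u (r ^ 2) + 2 * bellR δ u (r ^ 2)
      = (1 + δ) * δ / r * ((1 - 3 / 5 * δ) * m)
        + 3 / 10 * δ * (δ * m ^ 2 * ((4 + 8 * δ) * u ^ 2 + 16 * (1 + δ) * m ^ 2) / (r * n ^ 3)) := by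
    have key : δ * m ^ 2 * ((4 + 8 * δ) * u ^ 2 + 16 * (1 + δ) * m ^ 2)
        = 8 * (1 + δ) * δ * m ^ 2 * n ^ 2 + (u ^ 2 + 4 * (1 + δ) * m ^ 2) * n ^ 2
          - (u ^ 2 + 4 * (1 + δ) * m ^ 2) ^ 2 := by rw [hn]; ring
    rw [key]
    unfold bellR bellRR
    rw [hS, e1, e2, e3, e4]
    field_simp
    ring
  set N := (1 + δ) * δ / r * ((1 - 3 / 5 * δ) * m + 3 / 10 * δ * (4 * m ^ 2 / n)) with hN
  have hN1 : N ≤ 2 * bellR δ u (r ^ 2) := by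
    rw [hR, hN, mul_add]
    refine add_le_add ?_ ?_
    · have : (1 + δ) * δ / r ≤ (1 + δ) / r := by
        gcongr; nlinarith
      exact mul_le_mul_of_nonneg_right this (by positivity)
    · have : (1 + δ) * δ / r * (3 / 10 * δ * (4 * m ^ 2 / n))
        = 3 / 10 * δ * (4 * (1 + δ) * δ * m ^ 2 / (r * n)) := by field_simp
      rw [this]
      gcongr
      have : 4 * (1 + δ) * m ^ 2 * δ ≤ 4 * (1 + δ) * m ^ 2 * 1 := by gcongr
      nlinarith [sq_nonneg u]
  have hN2 : N ≤ 4 * r ^ 2 * bellRR δ u (r ^ 2) + 2 * bellR δ u (r ^ 2) := by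
    rw [hRR, hN, mul_add]
    refine add_le_add le_rfl ?_
    have : (1 + δ) * δ / r * (3 / 10 * δ * (4 * m ^ 2 / n))
        = 3 / 10 * δ * (δ * m ^ 2 * (4 * (1 + δ) * n ^ 2) / (r * n ^ 3)) := by field_simp
    rw [this]
    gcongr
    rw [hn]
    nlinarith [mul_nonneg h0.le (sq_nonneg u)]
  have hM : |2 * r * bellUR δ u (r ^ 2)| ≤ 3 / 10 * δ * |u| / n := by
    rw [hUR, abs_mul, abs_div, abs_mul, abs_of_pos hn0, abs_of_pos (by positivity : 0 < 3 / 10 * δ)]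
    refine mul_le_of_le_one_right (by positivity) ?_
    have : 0 ≤ 4 * (1 - δ) * m ^ 2 := mul_nonneg (by linarith) (by positivity)
    rw [abs_of_nonneg (by positivity), div_le_one (by positivity), hn]
    nlinarith [mul_pos h0 (pow_pos hm0 2)]
  have hdisc := bell_discriminant h0 h1 hr hm0 hn0 hn (by positivity : 0 ≤ L) hL
  rw [← hUU, ← hN] at hdisc
  obtain ⟨τ, hτ, H⟩ := quad_lower (by rw [hUU]; positivity) (by positivity) (by positivity) hdisc
  refine ⟨τ, hτ, fun a b w hb => ?_⟩
  have hw : 0 ≤ w := by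
    have : 0 ≤ 4 * r ^ 2 * w := (sq_nonneg b).trans hb
    exact nonneg_of_mul_nonneg_right this (by positivity)
  refine (H a w hw).trans ?_
  have i1 : N * w ≤ bellRR δ u (r ^ 2) * b ^ 2 + 2 * bellR δ u (r ^ 2) * w := by
    rcases le_total 0 (bellRR δ u (r ^ 2)) with hs | hs
    · have k1 := mul_nonneg hs (sq_nonneg b)
      have k2 := mul_le_mul_of_nonneg_right hN1 hw
      linarith
    · have k1 := mul_le_mul_of_nonpos_left hb hs
      have k2 := mul_le_mul_of_nonneg_right hN2 hw
      linarith
  have hb' : |b| ≤ 2 * r * √w := by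
    refine abs_le_of_sq_le_sq ?_ (by positivity)
    rw [mul_pow, Real.sq_sqrt hw]; nlinarith
  have i2 : -(2 * (3 / 10 * δ * |u| / n) * (|a| * √w)) ≤ 2 * bellUR δ u (r ^ 2) * a * b := by
    have j1 : |2 * bellUR δ u (r ^ 2) * a * b| ≤ 2 * (3 / 10 * δ * |u| / n) * (|a| * √w) := by
      rw [abs_mul, abs_mul, abs_mul, abs_two]
      calc 2 * |bellUR δ u (r ^ 2)| * |a| * |b|
          ≤ 2 * |bellUR δ u (r ^ 2)| * |a| * (2 * r * √w) := by gcongr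
        _ = 2 * |2 * r * bellUR δ u (r ^ 2)| * (|a| * √w) := by
          rw [abs_mul, abs_mul, abs_two, abs_of_pos hr]; ring
        _ ≤ _ := by gcongr
    exact (neg_le_of_abs_le j1)
  linarith

end

lemma hasDerivAt_abs_rpow_mul_self {a : ℝ} (ha : 0 ≤ a) (x : ℝ) :
    HasDerivAt (fun x : ℝ => |x| ^ a * x) ((a + 1) * |x| ^ a) x := by
  rcases ha.eq_or_lt with rfl | ha
  · simpa using hasDerivAt_id' x
  rcases lt_trichotomy x 0 with hx | rfl | hx
  · have h1 : HasDerivAt (fun x : ℝ => -(-x) ^ (a + 1)) (-(-1 * (a + 1) * (-x) ^ (a + 1 - 1))) x :=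
      ((hasDerivAt_id' x).fun_neg.rpow_const (Or.inl (by linarith))).fun_neg
    have h2 : (fun x : ℝ => |x| ^ a * x) =ᶠ[nhds x] fun x => -(-x) ^ (a + 1) := by
      filter_upwards [gt_mem_nhds hx] with y hy
      rw [abs_of_neg hy, Real.rpow_add_one (by linarith)]; ring
    refine (h1.congr_of_eventuallyEq h2).congr_deriv ?_
    rw [abs_of_neg hx]; simp; ring
  · rw [hasDerivAt_iff_tendsto_slope]
    have h1 : Tendsto (fun x : ℝ => |x| ^ a) (nhdsWithin 0 {0}ᶜ) (nhds 0) := by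
      have : Continuous fun x : ℝ => |x| ^ a := continuous_abs.rpow_const fun _ => Or.inr ha.le
      have h := (this.tendsto 0).mono_left (nhdsWithin_le_nhds (s := {0}ᶜ))
      simpa [Real.zero_rpow ha.ne'] using h
    simp only [abs_zero, Real.zero_rpow ha.ne', mul_zero]
    refine h1.congr' ?_
    filter_upwards [self_mem_nhdsWithin] with y hy
    have hy : y ≠ 0 := hy
    simp [slope_def_field, hy]
  · have h1 : HasDerivAt (fun x : ℝ => x ^ (a + 1)) (1 * (a + 1) * x ^ (a + 1 - 1)) x :=
      (hasDerivAt_id' x).rpow_const (Or.inl hx.ne')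
    have h2 : (fun x : ℝ => |x| ^ a * x) =ᶠ[nhds x] fun x => x ^ (a + 1) := by
      filter_upwards [lt_mem_nhds hx] with y hy
      rw [abs_of_pos hy, Real.rpow_add_one hy.ne']
    refine (h1.congr_of_eventuallyEq h2).congr_deriv ?_
    rw [abs_of_pos hx]; simp

section
variable {δ : ℝ} {u ρ : ℝ → ℝ} {u' ρ' s : ℝ}

lemma hasDerivAt_sqrt_bell (hu : HasDerivAt u u' s) (hρ : HasDerivAt ρ ρ' s)
    (hp : 0 < ρ s) :
    HasDerivAt (fun s => √(u s ^ 2 * ρ s + 4 * ρ s ^ (1 + δ)))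
      (u s * ρ s / √(u s ^ 2 * ρ s + 4 * ρ s ^ (1 + δ)) * u'
        + (u s ^ 2 + 4 * (1 + δ) * ρ s ^ δ) / (2 * √(u s ^ 2 * ρ s + 4 * ρ s ^ (1 + δ))) * ρ')
      s := by
  have hD : 0 < u s ^ 2 * ρ s + 4 * ρ s ^ (1 + δ) := by positivity
  have h1 : HasDerivAt (fun s => u s ^ 2 * ρ s + 4 * ρ s ^ (1 + δ))
      (2 * u s * u' * ρ s + u s ^ 2 * ρ' + 4 * (ρ' * (1 + δ) * ρ s ^ δ)) s := by
    have e1 := (hu.fun_pow 2).fun_mul hρ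
    have e2 := (hρ.rpow_const (p := 1 + δ) (Or.inl hp.ne')).const_mul 4
    refine (e1.fun_add e2).congr_deriv ?_
    simp
  refine (h1.sqrt hD.ne').congr_deriv ?_
  have := Real.sqrt_pos.2 hD
  field_simp
  ring

lemma hasDerivAt_bell (h0 : 0 < δ) (ε : ℝ) (hu : HasDerivAt u u' s)
    (hρ : HasDerivAt ρ ρ' s) (hp : 0 < ρ s) :
    HasDerivAt (fun s => bell δ ε (u s) (ρ s))
      (bellUq δ (u s) (ρ s) * u s * u' + bellR δ (u s) (ρ s) * ρ') s := by
  have hp1 : 1 < (1 + δ) / δ := by rw [lt_div_iff₀ h0]; linarith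
  have e1 := (hasDerivAt_abs_rpow (u s) hp1).comp s hu
  have e2 := (hρ.rpow_const (p := (1 + δ) / 2) (Or.inl hp.ne')).const_mul (1 - 3 / 5 * δ)
  have e3 := (hasDerivAt_sqrt_bell (δ := δ) hu hρ hp).const_mul (3 / 10 * δ)
  refine (((e1.fun_add e2).fun_add e3).sub_const (ε ^ (1 + δ))).congr_deriv ?_
  have k1 : (1 + δ) / δ - 2 = (1 - δ) / δ := by field_simp; ring
  have k2 : (1 + δ) / 2 - 1 = (δ - 1) / 2 := by ring
  rw [k1, k2]
  unfold bellUq bellR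
  ring

lemma hasDerivAt_bellUq_mul (h0 : 0 < δ) (h1 : δ ≤ 1) (hu : HasDerivAt u u' s)
    (hρ : HasDerivAt ρ ρ' s) (hp : 0 < ρ s) :
    HasDerivAt (fun s => bellUq δ (u s) (ρ s) * u s)
      (bellUU δ (u s) (ρ s) * u' + bellUR δ (u s) (ρ s) * ρ') s := by
  have ha : 0 ≤ (1 - δ) / δ := div_nonneg (by linarith) h0.le
  have hS : 0 < √(u s ^ 2 * ρ s + 4 * ρ s ^ (1 + δ)) := by positivity
  have e1 := ((hasDerivAt_abs_rpow_mul_self ha (u s)).comp s hu).const_mul ((1 + δ) / δ)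
  have e2 := ((hu.fun_mul hρ).fun_div (hasDerivAt_sqrt_bell (δ := δ) hu hρ hp) hS.ne').const_mul
    (3 / 10 * δ)
  have e3 : (fun s => bellUq δ (u s) (ρ s) * u s) = fun s =>
      (1 + δ) / δ * (((fun x : ℝ => |x| ^ ((1 - δ) / δ) * x) ∘ u) s)
        + 3 / 10 * δ * (u s * ρ s / √(u s ^ 2 * ρ s + 4 * ρ s ^ (1 + δ))) := by
    ext s; unfold bellUq; simp only [Function.comp]; ring
  rw [e3]
  refine (e1.fun_add e2).congr_deriv ?_
  unfold bellUU bellUR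
  field_simp
  ring

lemma hasDerivAt_bellR (hu : HasDerivAt u u' s)
    (hρ : HasDerivAt ρ ρ' s) (hp : 0 < ρ s) :
    HasDerivAt (fun s => bellR δ (u s) (ρ s))
      (bellUR δ (u s) (ρ s) * u' + bellRR δ (u s) (ρ s) * ρ') s := by
  have hS : 0 < √(u s ^ 2 * ρ s + 4 * ρ s ^ (1 + δ)) := by positivity
  have e1 := (hρ.rpow_const (p := (δ - 1) / 2) (Or.inl hp.ne')).const_mul
    ((1 - 3 / 5 * δ) * ((1 + δ) / 2))
  have e0 := (hu.fun_pow 2).fun_add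
    ((hρ.rpow_const (p := δ) (Or.inl hp.ne')).const_mul (4 * (1 + δ)))
  have e2 := (e0.fun_div ((hasDerivAt_sqrt_bell (δ := δ) hu hρ hp).const_mul 2)
    (by positivity)).const_mul (3 / 10 * δ)
  refine (e1.fun_add e2).congr_deriv ?_
  have k2 : (δ - 1) / 2 - 1 = (δ - 3) / 2 := by ring
  rw [k2]
  unfold bellUR bellRR
  set S := √(u s ^ 2 * ρ s + 4 * ρ s ^ (1 + δ))
  field_simp
  ring

end

section
variable {δ : ℝ}

lemma continuousOn_rpow_snd (a : ℝ) :
    ContinuousOn (fun z : ℝ × ℝ => z.2 ^ a) (univ ×ˢ Ioi 0) :=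
  continuousOn_snd.rpow_const fun _ hz => Or.inl (ne_of_gt hz.2)

lemma continuousOn_sqrt_bell (δ : ℝ) :
    ContinuousOn (fun z : ℝ × ℝ => √(z.1 ^ 2 * z.2 + 4 * z.2 ^ (1 + δ))) (univ ×ˢ Ioi 0) := by
  have := continuousOn_rpow_snd (1 + δ)
  fun_prop

lemma sqrt_bell_pos {z : ℝ × ℝ} (hz : z ∈ (univ : Set ℝ) ×ˢ Ioi (0 : ℝ)) :
    0 < √(z.1 ^ 2 * z.2 + 4 * z.2 ^ (1 + δ)) := by
  have : 0 < z.2 := hz.2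
  positivity

lemma continuousOn_abs_rpow (h0 : 0 < δ) (h1 : δ ≤ 1) :
    ContinuousOn (fun z : ℝ × ℝ => |z.1| ^ ((1 - δ) / δ)) (univ ×ˢ Ioi 0) := by
  have ha : 0 ≤ (1 - δ) / δ := div_nonneg (by linarith) h0.le
  exact (continuous_fst.abs.rpow_const fun _ => Or.inr ha).continuousOn

lemma continuousOn_bell (h0 : 0 < δ) (ε : ℝ) :
    ContinuousOn (fun z : ℝ × ℝ => bell δ ε z.1 z.2) (univ ×ˢ Ioi 0) := by
  have h1 := continuousOn_sqrt_bell δ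
  have h2 := continuousOn_rpow_snd ((1 + δ) / 2)
  have h3 : Continuous fun z : ℝ × ℝ => |z.1| ^ ((1 + δ) / δ) :=
    continuous_fst.abs.rpow_const fun _ => Or.inr (by positivity)
  unfold bell
  exact (((h3.continuousOn.add (continuousOn_const.mul h2)).add (continuousOn_const.mul h1))).sub
    continuousOn_const

lemma continuousOn_bellUq (h0 : 0 < δ) (h1 : δ ≤ 1) :
    ContinuousOn (fun z : ℝ × ℝ => bellUq δ z.1 z.2) (univ ×ˢ Ioi 0) := by
  have h2 := continuousOn_sqrt_bell δ
  have h3 := continuousOn_abs_rpow h0 h1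
  unfold bellUq
  exact (continuousOn_const.mul h3).add
    (continuousOn_const.mul (continuousOn_snd.div h2 fun z hz => (sqrt_bell_pos hz).ne'))

lemma continuousOn_bellR (δ : ℝ) :
    ContinuousOn (fun z : ℝ × ℝ => bellR δ z.1 z.2) (univ ×ˢ Ioi 0) := by
  have h2 := continuousOn_sqrt_bell δ
  have h3 := continuousOn_rpow_snd ((δ - 1) / 2)
  have h4 := continuousOn_rpow_snd δ
  unfold bellR
  refine (continuousOn_const.mul h3).add (continuousOn_const.mul (ContinuousOn.div ?_
    (continuousOn_const.mul h2) fun z hz => (mul_pos two_pos (sqrt_bell_pos hz)).ne'))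
  fun_prop

lemma continuousOn_bellUU (h0 : 0 < δ) (h1 : δ ≤ 1) :
    ContinuousOn (fun z : ℝ × ℝ => bellUU δ z.1 z.2) (univ ×ˢ Ioi 0) := by
  have h2 := continuousOn_sqrt_bell δ
  have h3 := continuousOn_abs_rpow h0 h1
  unfold bellUU
  refine (continuousOn_const.mul h3).add (continuousOn_const.mul
    ((continuousOn_snd.div h2 fun z hz => (sqrt_bell_pos hz).ne').sub (ContinuousOn.div ?_
      (h2.pow 3) fun z hz => (pow_pos (sqrt_bell_pos hz) 3).ne')))
  fun_prop

lemma continuousOn_bellUR (δ : ℝ) :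
    ContinuousOn (fun z : ℝ × ℝ => bellUR δ z.1 z.2) (univ ×ˢ Ioi 0) := by
  have h2 := continuousOn_sqrt_bell δ
  have h4 := continuousOn_rpow_snd δ
  unfold bellUR
  refine continuousOn_const.mul
    ((continuousOn_fst.div h2 fun z hz => (sqrt_bell_pos hz).ne').sub (ContinuousOn.div ?_
      (continuousOn_const.mul (h2.pow 3)) fun z hz =>
        (mul_pos two_pos (pow_pos (sqrt_bell_pos hz) 3)).ne'))
  fun_prop

lemma continuousOn_bellRR (δ : ℝ) :
    ContinuousOn (fun z : ℝ × ℝ => bellRR δ z.1 z.2) (univ ×ˢ Ioi 0) := by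
  have h2 := continuousOn_sqrt_bell δ
  have h3 := continuousOn_rpow_snd ((δ - 3) / 2)
  have h4 := continuousOn_rpow_snd δ
  have h5 := continuousOn_rpow_snd (δ - 1)
  unfold bellRR
  refine (continuousOn_const.mul h3).add (continuousOn_const.mul
    ((ContinuousOn.div ?_ h2 fun z hz => (sqrt_bell_pos hz).ne').sub (ContinuousOn.div ?_
      (continuousOn_const.mul (h2.pow 3)) fun z hz =>
        (mul_pos four_pos (pow_pos (sqrt_bell_pos hz) 3)).ne'))) <;>
  fun_prop

end

section
variable {δ : ℝ}

lemma sqrt_bell_eq {ρ : ℝ} (hρ : 0 < ρ) (u : ℝ) :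
    √(u ^ 2 * ρ + 4 * ρ ^ (1 + δ)) = √(u ^ 2 * ρ + (2 * ρ ^ ((1 + δ) / 2)) ^ 2) := by
  rw [mul_pow, ← Real.rpow_mul_natCast hρ.le]
  norm_num

lemma two_mul_rpow_le_sqrt_bell {ρ : ℝ} (hρ : 0 < ρ) (u : ℝ) :
    2 * ρ ^ ((1 + δ) / 2) ≤ √(u ^ 2 * ρ + 4 * ρ ^ (1 + δ)) := by
  rw [sqrt_bell_eq hρ]
  exact Real.le_sqrt_of_sq_le (by nlinarith [mul_nonneg (sq_nonneg u) hρ.le])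

lemma sqrt_bell_le {ρ : ℝ} (hρ : 0 < ρ) (u : ℝ) :
    √(u ^ 2 * ρ + 4 * ρ ^ (1 + δ)) ≤ 2 * ρ ^ ((1 + δ) / 2) + u ^ 2 * ρ ^ ((1 - δ) / 2) / 4 := by
  rw [sqrt_bell_eq hρ]
  have h : ρ = ρ ^ ((1 + δ) / 2) * ρ ^ ((1 - δ) / 2) := by
    rw [← Real.rpow_add hρ]; ring_nf; simp
  refine Real.sqrt_le_iff.2 ⟨by positivity, ?_⟩
  set R := ρ ^ ((1 + δ) / 2)
  set k := ρ ^ ((1 - δ) / 2)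
  rw [h]
  nlinarith [sq_nonneg (u ^ 2 * k)]

lemma rpow_eps {ε : ℝ} (hε : 0 < ε) : (ε ^ 2) ^ ((1 + δ) / 2) = ε ^ (1 + δ) := by
  rw [sq_rpow hε]; ring_nf

lemma bell_nonneg (h0 : 0 < δ) {ε : ℝ} (hε : 0 < ε) (u : ℝ) {ρ : ℝ} (hρ : ε ^ 2 ≤ ρ) :
    0 ≤ bell δ ε u ρ := by
  have hρ0 : 0 < ρ := lt_of_lt_of_le (by positivity) hρ
  have h1 : ε ^ (1 + δ) ≤ ρ ^ ((1 + δ) / 2) := by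
    rw [← rpow_eps hε]
    exact Real.rpow_le_rpow (by positivity) hρ (by positivity)
  have h2 := mul_le_mul_of_nonneg_left (two_mul_rpow_le_sqrt_bell (δ := δ) hρ0 u)
    (by positivity : 0 ≤ 3 / 10 * δ)
  have h3 : 0 ≤ |u| ^ ((1 + δ) / δ) := by positivity
  unfold bell
  linarith

lemma bell_le_aux (h0 : 0 < δ) (ε u : ℝ) {ρ : ℝ} (hρ : 0 < ρ) :
    bell δ ε u ρ ≤ |u| ^ ((1 + δ) / δ) + (ρ ^ ((1 + δ) / 2) - ε ^ (1 + δ))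
      + 3 / 10 * δ / 4 * (u ^ 2 * ρ ^ ((1 - δ) / 2)) := by
  have h2 := mul_le_mul_of_nonneg_left (sqrt_bell_le (δ := δ) hρ u)
    (by positivity : 0 ≤ 3 / 10 * δ)
  unfold bell
  linarith

lemma bell_le_quadratic (h0 : 0 < δ) (h1 : δ ≤ 1) {ε : ℝ} (hε : 0 < ε) (R : ℝ) :
    ∃ C, 0 ≤ C ∧ ∀ u w, |u| ≤ R → 0 ≤ w → w ≤ R →
      bell δ ε u (ε ^ 2 + w) ≤ C * (u ^ 2 + w) := by
  rcases lt_or_ge R 0 with hR | hR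
  · exact ⟨0, le_rfl, fun u w hu => absurd (hu.trans_lt hR) (not_lt.2 (abs_nonneg u))⟩
  set C1 := R ^ ((1 - δ) / δ) + 3 / 10 * δ / 4 * (ε ^ 2 + R) ^ ((1 - δ) / 2)
  set C2 := ε ^ (1 + δ) * ((1 + δ) / 2 / ε ^ 2)
  have hC1 : 0 ≤ C1 := by positivity
  have hC2 : 0 ≤ C2 := by positivity
  refine ⟨C1 + C2, by positivity, fun u w hu hw hwR => ?_⟩
  have hρ : 0 < ε ^ 2 + w := by positivity
  refine (bell_le_aux h0 ε u hρ).trans ?_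
  have e1 : |u| ^ ((1 + δ) / δ) ≤ R ^ ((1 - δ) / δ) * u ^ 2 := by
    have : (1 + δ) / δ = (1 - δ) / δ + (2 : ℕ) := by push_cast; field_simp; ring
    have hδ : 0 ≤ (1 - δ) / δ := div_nonneg (by linarith) h0.le
    rw [this, Real.rpow_add_natCast' (abs_nonneg u) (by positivity), sq_abs]
    gcongr
  have e2 : (ε ^ 2 + w) ^ ((1 - δ) / 2) ≤ (ε ^ 2 + R) ^ ((1 - δ) / 2) := by
    gcongr
  have e3 : (ε ^ 2 + w) ^ ((1 + δ) / 2) - ε ^ (1 + δ) ≤ C2 * w := by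
    have : ε ^ 2 + w = ε ^ 2 * (1 + w / ε ^ 2) := by field_simp
    rw [this, Real.mul_rpow (by positivity) (by positivity), rpow_eps hε]
    have hb := rpow_one_add_le_one_add_mul_self (s := w / ε ^ 2) (p := (1 + δ) / 2)
      (by have : 0 ≤ w / ε ^ 2 := by positivity
          linarith) (by positivity) (by linarith)
    have := mul_le_mul_of_nonneg_left hb (by positivity : 0 ≤ ε ^ (1 + δ))
    have e : C2 * w = ε ^ (1 + δ) * ((1 + δ) / 2 * (w / ε ^ 2)) := by
      simp only [C2]; field_simp
    rw [e]; linarith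
  have e4 : 3 / 10 * δ / 4 * (u ^ 2 * (ε ^ 2 + w) ^ ((1 - δ) / 2))
      ≤ 3 / 10 * δ / 4 * (u ^ 2 * (ε ^ 2 + R) ^ ((1 - δ) / 2)) := by gcongr
  have e5 : 0 ≤ C1 * w := by positivity
  have e6 : 0 ≤ C2 * u ^ 2 := by positivity
  have e7 : C1 * u ^ 2 = R ^ ((1 - δ) / δ) * u ^ 2
    + 3 / 10 * δ / 4 * (u ^ 2 * (ε ^ 2 + R) ^ ((1 - δ) / 2)) := by simp only [C1]; ring
  linarith

lemma sq_mul_rpow_le (h0 : 0 < δ) (h1 : δ ≤ 1) (u : ℝ) {ρ : ℝ} (hρ : 0 < ρ) :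
    u ^ 2 * ρ ^ ((1 - δ) / 2) ≤ |u| ^ ((1 + δ) / δ) + ρ ^ ((1 + δ) / 2) := by
  rcases le_total |u| (ρ ^ (δ / 2)) with h | h
  · have e : ρ ^ ((1 + δ) / 2) = (ρ ^ (δ / 2)) ^ 2 * ρ ^ ((1 - δ) / 2) := by
      rw [← Real.rpow_mul_natCast hρ.le, ← Real.rpow_add hρ]
      congr 1; push_cast; ring
    have : u ^ 2 * ρ ^ ((1 - δ) / 2) ≤ ρ ^ ((1 + δ) / 2) := by
      rw [e, ← sq_abs u]; gcongr
    have := Real.rpow_nonneg (abs_nonneg u) ((1 + δ) / δ)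
    linarith
  · have e : |u| ^ ((1 + δ) / δ) = |u| ^ 2 * |u| ^ ((1 - δ) / δ) := by
      have : (1 + δ) / δ = (1 - δ) / δ + (2 : ℕ) := by push_cast; field_simp; ring
      have hδ : 0 ≤ (1 - δ) / δ := div_nonneg (by linarith) h0.le
      rw [this, Real.rpow_add_natCast' (abs_nonneg u) (by positivity), mul_comm]
    have e2 : ρ ^ ((1 - δ) / 2) = (ρ ^ (δ / 2)) ^ ((1 - δ) / δ) := by
      rw [← Real.rpow_mul hρ.le]; congr 1; field_simp
    have : u ^ 2 * ρ ^ ((1 - δ) / 2) ≤ |u| ^ ((1 + δ) / δ) := by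
      rw [e, e2, sq_abs]
      have hδ : 0 ≤ (1 - δ) / δ := div_nonneg (by linarith) h0.le
      gcongr
    have := Real.rpow_nonneg hρ.le ((1 + δ) / 2)
    linarith

lemma bell_le_rpow (h0 : 0 < δ) (h1 : δ ≤ 1) {ε : ℝ} (hε : 0 < ε) (u : ℝ) {w : ℝ} (hw : 0 ≤ w) :
    bell δ ε u (ε ^ 2 + w) ≤ (1 + 3 / 40 * δ) * (|u| ^ ((1 + δ) / δ) + w ^ ((1 + δ) / 2))
      + 3 / 40 * δ * ε ^ (1 + δ) := by
  have hρ : 0 < ε ^ 2 + w := by positivity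
  have e1 := bell_le_aux h0 ε u hρ
  have e2 := mul_le_mul_of_nonneg_left (sq_mul_rpow_le h0 h1 u hρ)
    (by positivity : 0 ≤ 3 / 10 * δ / 4)
  have e3 := Real.rpow_add_le_add_rpow (sq_nonneg ε) hw (by positivity : 0 ≤ (1 + δ) / 2)
    (by linarith)
  rw [rpow_eps hε] at e3
  have e4 := mul_le_mul_of_nonneg_left e3 (by positivity : 0 ≤ 3 / 10 * δ / 4)
  linarith

/-- First derivative of the Bellman function along a curve. -/
def bellD1 (δ u ρ a b : ℝ) : ℝ := bellUq δ u ρ * u * a + bellR δ u ρ * b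

/-- Second derivative of the Bellman function along a curve. -/
def bellD2 (δ u ρ a b a₂ b₂ : ℝ) : ℝ :=
  (bellUU δ u ρ * a + bellUR δ u ρ * b) * a + bellUq δ u ρ * u * a₂
    + ((bellUR δ u ρ * a + bellRR δ u ρ * b) * b + bellR δ u ρ * b₂)

lemma hasDerivAt_bellD1 (h0 : 0 < δ) (h1 : δ ≤ 1) {u ρ a b : ℝ → ℝ} {a₂ b₂ s : ℝ}
    (hu : HasDerivAt u (a s) s) (hρ : HasDerivAt ρ (b s) s) (ha : HasDerivAt a a₂ s)
    (hb : HasDerivAt b b₂ s) (hp : 0 < ρ s) :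
    HasDerivAt (fun s => bellD1 δ (u s) (ρ s) (a s) (b s))
      (bellD2 δ (u s) (ρ s) (a s) (b s) a₂ b₂) s :=
  ((hasDerivAt_bellUq_mul h0 h1 hu hρ hp).fun_mul ha).fun_add
    ((hasDerivAt_bellR hu hρ hp).fun_mul hb)

lemma bellD2_lower (h0 : 0 < δ) (h1 : δ ≤ 1) {d : ℕ} {ε : ℝ} (hε : 0 < ε) (u : ℝ)
    (v : Fin d → ℝ) {ρ : ℝ} (hρ : ρ = ε ^ 2 + ∑ j, v j ^ 2) :
    ∃ τ > 0, ∀ (a a₂ : ℝ) (y y₂ : Fin d → ℝ),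
      bellC δ / 2 * (τ * a ^ 2 + (∑ j, y j ^ 2) / τ) + bellUq δ u ρ * (u * a₂)
        + 2 * bellR δ u ρ * ∑ j, v j * y₂ j
      ≤ bellD2 δ u ρ a (∑ j, 2 * v j * y j) a₂ (∑ j, 2 * (y j ^ 2 + v j * y₂ j)) := by
  have hv : 0 ≤ ∑ j, v j ^ 2 := Finset.sum_nonneg fun j _ => sq_nonneg _
  have hρ0 : 0 < ρ := by rw [hρ]; positivity
  obtain ⟨τ, hτ, H⟩ := bell_convex h0 h1 u hρ0
  refine ⟨τ, hτ, fun a a₂ y y₂ => ?_⟩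
  have hb : (∑ j, 2 * v j * y j) ^ 2 ≤ 4 * ρ * ∑ j, y j ^ 2 := by
    have hc := Finset.sum_mul_sq_le_sq_mul_sq Finset.univ v y
    have hy : 0 ≤ ∑ j, y j ^ 2 := Finset.sum_nonneg fun j _ => sq_nonneg _
    have e : ∑ j, 2 * v j * y j = 2 * ∑ j, v j * y j := by
      rw [Finset.mul_sum]; exact Finset.sum_congr rfl fun j _ => by ring
    have : (∑ j, v j ^ 2) * ∑ j, y j ^ 2 ≤ ρ * ∑ j, y j ^ 2 := by
      refine mul_le_mul_of_nonneg_right ?_ hy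
      rw [hρ]; linarith [sq_nonneg ε]
    rw [e, mul_pow]; linarith
  have e2 : ∑ j, 2 * (y j ^ 2 + v j * y₂ j) = 2 * ∑ j, y j ^ 2 + 2 * ∑ j, v j * y₂ j := by
    rw [← Finset.mul_sum, Finset.sum_add_distrib]; ring
  have := H a _ _ hb
  rw [e2]
  unfold bellD2
  linarith

end

section
variable {d : ℕ} {α : Fin d → ℝ} {δ : ℝ}

/-- A bounded jet which is even-like in each coordinate, in the sense that its first derivatives
vanish at the walls. -/
structure Jet.IsRegular (F : Jet d) : Prop where
  cont_v : Continuous fun p : (Fin d → ℝ) × ℝ => F.v p.1 p.2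
  cont_vx : ∀ i, Continuous fun p : (Fin d → ℝ) × ℝ => F.vx i p.1 p.2
  cont_vxx : ∀ i, Continuous fun p : (Fin d → ℝ) × ℝ => F.vxx i p.1 p.2
  cont_vt : Continuous fun p : (Fin d → ℝ) × ℝ => F.vt p.1 p.2
  cont_vtt : Continuous fun p : (Fin d → ℝ) × ℝ => F.vtt p.1 p.2
  bdd : ∃ M, 0 ≤ M ∧ ∀ x t, |F.v x t| ≤ M ∧ (∀ i, |F.vx i x t| ≤ M * |x i|) ∧
    (∀ i, |F.vxx i x t| ≤ M) ∧ |F.vt x t| ≤ M ∧ |F.vtt x t| ≤ M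
  deriv_x : ∀ i x t s, HasDerivAt (fun s => F.v (Function.update x i s) t)
    (F.vx i (Function.update x i s) t) s
  deriv_xx : ∀ i x t s, HasDerivAt (fun s => F.vx i (Function.update x i s) t)
    (F.vxx i (Function.update x i s) t) s
  deriv_t : ∀ x t, 0 < t → HasDerivAt (fun t => F.v x t) (F.vt x t) t
  deriv_tt : ∀ x t, 0 < t → HasDerivAt (fun t => F.vt x t) (F.vtt x t) t

/-- The regularized square of the vector of conjugate extensions. -/
def bellRho (ε : ℝ) (V : Fin d → Jet d) (x : Fin d → ℝ) (t : ℝ) : ℝ :=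
  ε ^ 2 + ∑ j, (V j).v x t ^ 2

/-- The Bellman function evaluated along a Poisson-type extension and its conjugates. -/
def bellJet (δ ε : ℝ) (U : Jet d) (V : Fin d → Jet d) : Jet d where
  v x t := bell δ ε (U.v x t) (bellRho ε V x t)
  vx i x t := bellD1 δ (U.v x t) (bellRho ε V x t) (U.vx i x t)
    (∑ j, 2 * (V j).v x t * (V j).vx i x t)
  vxx i x t := bellD2 δ (U.v x t) (bellRho ε V x t) (U.vx i x t)
    (∑ j, 2 * (V j).v x t * (V j).vx i x t) (U.vxx i x t)
    (∑ j, 2 * ((V j).vx i x t ^ 2 + (V j).v x t * (V j).vxx i x t))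
  vt x t := bellD1 δ (U.v x t) (bellRho ε V x t) (U.vt x t)
    (∑ j, 2 * (V j).v x t * (V j).vt x t)
  vtt x t := bellD2 δ (U.v x t) (bellRho ε V x t) (U.vt x t)
    (∑ j, 2 * (V j).v x t * (V j).vt x t) (U.vtt x t)
    (∑ j, 2 * ((V j).vt x t ^ 2 + (V j).v x t * (V j).vtt x t))

lemma sq_le_bellRho (ε : ℝ) (V : Fin d → Jet d) (x : Fin d → ℝ) (t : ℝ) :
    ε ^ 2 ≤ bellRho ε V x t :=
  le_add_of_nonneg_right (Finset.sum_nonneg fun _ _ => sq_nonneg _)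

lemma bellRho_pos {ε : ℝ} (hε : 0 < ε) (V : Fin d → Jet d) (x : Fin d → ℝ) (t : ℝ) :
    0 < bellRho ε V x t :=
  lt_of_lt_of_le (by positivity) (sq_le_bellRho ε V x t)

lemma hasDerivAt_bellRho (ε : ℝ) {v v' : Fin d → ℝ → ℝ} {s : ℝ}
    (hv : ∀ j, HasDerivAt (v j) (v' j s) s) :
    HasDerivAt (fun s => ε ^ 2 + ∑ j, v j s ^ 2) (∑ j, 2 * v j s * v' j s) s := by
  refine (HasDerivAt.fun_sum fun j _ => (hv j).fun_pow 2).const_add (ε ^ 2) |>.congr_deriv ?_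
  exact Finset.sum_congr rfl fun j _ => by push_cast; ring

lemma hasDerivAt_sum_two_mul {v v' : Fin d → ℝ → ℝ} {v'' : Fin d → ℝ} {s : ℝ}
    (hv : ∀ j, HasDerivAt (v j) (v' j s) s) (hv' : ∀ j, HasDerivAt (v' j) (v'' j) s) :
    HasDerivAt (fun s => ∑ j, 2 * v j s * v' j s) (∑ j, 2 * (v' j s ^ 2 + v j s * v'' j)) s := by
  refine (HasDerivAt.fun_sum fun j _ => ((hv j).const_mul 2).fun_mul (hv' j)).congr_deriv ?_
  exact Finset.sum_congr rfl fun j _ => by ring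

lemma bounded_of_continuousOn {F : ℝ → ℝ → ℝ}
    (hF : ContinuousOn (fun z : ℝ × ℝ => F z.1 z.2) (univ ×ˢ Ioi 0)) {ε : ℝ} (hε : 0 < ε) (R : ℝ) :
    ∃ C, 0 ≤ C ∧ ∀ u ρ, |u| ≤ R → ε ^ 2 ≤ ρ → ρ ≤ R → |F u ρ| ≤ C := by
  obtain ⟨C, hC⟩ := (isCompact_Icc.prod isCompact_Icc).exists_bound_of_continuousOn
    (s := Icc (-R) R ×ˢ Icc (ε ^ 2) R) (hF.mono fun z hz =>
      ⟨mem_univ _, lt_of_lt_of_le (by positivity) hz.2.1⟩)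
  refine ⟨max C 0, le_max_right _ _, fun u ρ hu h1 h2 => le_max_of_le_left ?_⟩
  exact hC (u, ρ) ⟨abs_le.1 hu, h1, h2⟩

lemma abs_sum_le_card_mul {w : Fin d → ℝ} {B : ℝ} (h : ∀ j, |w j| ≤ B) :
    |∑ j, w j| ≤ d * B := by
  refine (Finset.abs_sum_le_sum_abs _ _).trans ((Finset.sum_le_sum fun j _ => h j).trans ?_)
  simp

lemma exists_common_bound {U : Jet d} {V : Fin d → Jet d} (hU : U.IsPoisson α)
    (hV : ∀ j, (V j).IsPoisson α) :
    ∃ M, 0 ≤ M ∧ ∀ F : Jet d, (F = U ∨ ∃ j, F = V j) → ∀ x t, |F.v x t| ≤ M ∧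
      (∀ i, |F.vx i x t| ≤ M) ∧ (∀ i, |F.vxx i x t| ≤ M) ∧
      |F.vt x t| ≤ M ∧ |F.vtt x t| ≤ M ∧ ∀ i, |F.v x t * F.vx i x t| ≤ M * |x i| := by
  obtain ⟨m, hm, H⟩ := hU.bdd
  choose n hn K using fun j => (hV j).bdd
  have hs : 0 ≤ ∑ j, n j := Finset.sum_nonneg fun j _ => hn j
  have mono : ∀ {F : Jet d} {x t} {a b : ℝ}, a ≤ b →
      (|F.v x t| ≤ a ∧ (∀ i, |F.vx i x t| ≤ a) ∧ (∀ i, |F.vxx i x t| ≤ a) ∧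
        |F.vt x t| ≤ a ∧ |F.vtt x t| ≤ a ∧ ∀ i, |F.v x t * F.vx i x t| ≤ a * |x i|) →
      (|F.v x t| ≤ b ∧ (∀ i, |F.vx i x t| ≤ b) ∧ (∀ i, |F.vxx i x t| ≤ b) ∧
        |F.vt x t| ≤ b ∧ |F.vtt x t| ≤ b ∧ ∀ i, |F.v x t * F.vx i x t| ≤ b * |x i|) :=
    fun h ⟨h1, h2, h3, h4, h5, h6⟩ => ⟨h1.trans h, fun i => (h2 i).trans h,
      fun i => (h3 i).trans h, h4.trans h, h5.trans h,
      fun i => (h6 i).trans (mul_le_mul_of_nonneg_right h (abs_nonneg _))⟩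
  refine ⟨m + ∑ j, n j, add_nonneg hm hs, ?_⟩
  rintro F (rfl | ⟨j, rfl⟩) x t
  · exact mono (by linarith) (H x t)
  · have : n j ≤ ∑ j, n j := Finset.single_le_sum (fun j _ => hn j) (Finset.mem_univ j)
    exact mono (by linarith) (K j x t)

lemma bellJet_isRegular (h0 : 0 < δ) (h1 : δ ≤ 1) {ε : ℝ} (hε : 0 < ε) {U : Jet d}
    {V : Fin d → Jet d} (hU : U.IsPoisson α) (hV : ∀ j, (V j).IsPoisson α) :
    (bellJet δ ε U V).IsRegular := by
  have cρ : Continuous fun p : (Fin d → ℝ) × ℝ => bellRho ε V p.1 p.2 :=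
    continuous_const.add (continuous_finsetSum _ fun j _ => (hV j).cont_v.pow 2)
  have cF : ∀ {F : ℝ → ℝ → ℝ}, ContinuousOn (fun z : ℝ × ℝ => F z.1 z.2) (univ ×ˢ Ioi 0) →
      Continuous fun p : (Fin d → ℝ) × ℝ => F (U.v p.1 p.2) (bellRho ε V p.1 p.2) := fun hF =>
    hF.comp_continuous (hU.cont_v.prodMk cρ) fun p => ⟨mem_univ _, bellRho_pos hε V p.1 p.2⟩
  have cq := cF (continuousOn_bellUq h0 h1)
  have cr := cF (continuousOn_bellR δ)
  have cuu := cF (continuousOn_bellUU h0 h1)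
  have cur := cF (continuousOn_bellUR δ)
  have crr := cF (continuousOn_bellRR δ)
  have cU := hU.cont_v
  have cV := fun j => (hV j).cont_v
  have cD1 : ∀ {a b : (Fin d → ℝ) × ℝ → ℝ}, Continuous a → Continuous b → Continuous fun p =>
      bellD1 δ (U.v p.1 p.2) (bellRho ε V p.1 p.2) (a p) (b p) := fun ha hb =>
    ((cq.mul cU).mul ha).add (cr.mul hb)
  have cD2 : ∀ {a b a₂ b₂ : (Fin d → ℝ) × ℝ → ℝ}, Continuous a → Continuous b → Continuous a₂ →
      Continuous b₂ → Continuous fun p =>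
      bellD2 δ (U.v p.1 p.2) (bellRho ε V p.1 p.2) (a p) (b p) (a₂ p) (b₂ p) :=
    fun ha hb ha₂ hb₂ => ((((cuu.mul ha).add (cur.mul hb)).mul ha).add ((cq.mul cU).mul ha₂)).add
      ((((cur.mul ha).add (crr.mul hb)).mul hb).add (cr.mul hb₂))
  have cS1 : ∀ {w : Fin d → (Fin d → ℝ) × ℝ → ℝ}, (∀ j, Continuous (w j)) → Continuous fun p =>
      ∑ j, 2 * (V j).v p.1 p.2 * w j p := fun hw =>
    continuous_finsetSum _ fun j _ => (continuous_const.mul (cV j)).mul (hw j)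
  have cS2 : ∀ {w w₂ : Fin d → (Fin d → ℝ) × ℝ → ℝ}, (∀ j, Continuous (w j)) →
      (∀ j, Continuous (w₂ j)) → Continuous fun p =>
      ∑ j, 2 * (w j p ^ 2 + (V j).v p.1 p.2 * w₂ j p) := fun hw hw₂ =>
    continuous_finsetSum _ fun j _ =>
      continuous_const.mul (((hw j).pow 2).add ((cV j).mul (hw₂ j)))
  refine
    { cont_v := cF (continuousOn_bell h0 ε)
      cont_vx := fun i => cD1 (hU.cont_vx i) (cS1 fun j => (hV j).cont_vx i)
      cont_vxx := fun i => cD2 (hU.cont_vx i) (cS1 fun j => (hV j).cont_vx i) (hU.cont_vxx i)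
        (cS2 (fun j => (hV j).cont_vx i) fun j => (hV j).cont_vxx i)
      cont_vt := cD1 hU.cont_vt (cS1 fun j => (hV j).cont_vt)
      cont_vtt := cD2 hU.cont_vt (cS1 fun j => (hV j).cont_vt) hU.cont_vtt
        (cS2 (fun j => (hV j).cont_vt) fun j => (hV j).cont_vtt)
      bdd := ?_
      deriv_x := fun i x t s => hasDerivAt_bell h0 ε (hU.deriv_x i x t s)
        (hasDerivAt_bellRho (v := fun j s => (V j).v (Function.update x i s) t)
          (v' := fun j s => (V j).vx i (Function.update x i s) t) ε
          fun j => (hV j).deriv_x i x t s) (bellRho_pos hε V _ t)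
      deriv_xx := fun i x t s => hasDerivAt_bellD1 (a := fun s => U.vx i (Function.update x i s) t)
        h0 h1 (hU.deriv_x i x t s)
        (hasDerivAt_bellRho (v := fun j s => (V j).v (Function.update x i s) t)
          (v' := fun j s => (V j).vx i (Function.update x i s) t) ε
          fun j => (hV j).deriv_x i x t s) (hU.deriv_xx i x t s)
        (hasDerivAt_sum_two_mul (v := fun j s => (V j).v (Function.update x i s) t)
          (v' := fun j s => (V j).vx i (Function.update x i s) t)
          (fun j => (hV j).deriv_x i x t s) fun j => (hV j).deriv_xx i x t s)
        (bellRho_pos hε V _ t)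
      deriv_t := fun x t hs => hasDerivAt_bell h0 ε (hU.deriv_t x t hs)
        (hasDerivAt_bellRho (v := fun j => (V j).v x) (v' := fun j => (V j).vt x) ε
          fun j => (hV j).deriv_t x t hs) (bellRho_pos hε V _ t)
      deriv_tt := fun x t hs => hasDerivAt_bellD1 h0 h1 (hU.deriv_t x t hs)
        (hasDerivAt_bellRho (v := fun j => (V j).v x) (v' := fun j => (V j).vt x) ε
          fun j => (hV j).deriv_t x t hs) (hU.deriv_tt x t hs)
        (hasDerivAt_sum_two_mul (v := fun j => (V j).v x) (v' := fun j => (V j).vt x)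
          (fun j => (hV j).deriv_t x t hs) fun j => (hV j).deriv_tt x t hs)
        (bellRho_pos hε V _ t) }
  obtain ⟨M, hM, H⟩ := exists_common_bound hU hV
  have HU := H U (Or.inl rfl)
  have HV := fun j => H (V j) (Or.inr ⟨j, rfl⟩)
  have hR : ∀ x t, bellRho ε V x t ≤ ε ^ 2 + d * M ^ 2 + M := fun x t => by
    have := (le_abs_self _).trans (abs_sum_le_card_mul (w := fun j => (V j).v x t ^ 2)
      (B := M ^ 2) fun j => by
        rw [abs_of_nonneg (sq_nonneg _), ← sq_abs]
        exact pow_le_pow_left₀ (abs_nonneg _) (HV j x t).1 2)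
    unfold bellRho
    linarith
  have bF : ∀ {F : ℝ → ℝ → ℝ}, ContinuousOn (fun z : ℝ × ℝ => F z.1 z.2) (univ ×ˢ Ioi 0) →
      ∃ C, 0 ≤ C ∧ ∀ x t, |F (U.v x t) (bellRho ε V x t)| ≤ C := fun hF => by
    obtain ⟨C, hC, h⟩ := bounded_of_continuousOn hF hε (ε ^ 2 + d * M ^ 2 + M)
    refine ⟨C, hC, fun x t => h _ _ ((HU x t).1.trans ?_) (sq_le_bellRho ε V x t) (hR x t)⟩
    have : 0 ≤ ε ^ 2 + d * M ^ 2 := by positivity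
    linarith
  obtain ⟨B, hB, bB⟩ := bF (continuousOn_bell h0 ε)
  obtain ⟨Q, hQ, bQ⟩ := bF (continuousOn_bellUq h0 h1)
  obtain ⟨R, hR, bR⟩ := bF (continuousOn_bellR δ)
  obtain ⟨UU, hUU, bUU⟩ := bF (continuousOn_bellUU h0 h1)
  obtain ⟨UR, hUR, bUR⟩ := bF (continuousOn_bellUR δ)
  obtain ⟨RR, hRR, bRR⟩ := bF (continuousOn_bellRR δ)
  have bS1 : ∀ {x t} {w : Fin d → ℝ}, (∀ j, |w j| ≤ M) →
      |∑ j, 2 * (V j).v x t * w j| ≤ d * (2 * M * M) := fun {x t w} hw =>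
    abs_sum_le_card_mul fun j => by
      rw [abs_mul, abs_mul, abs_two]
      have := (HV j x t).1
      have := hw j
      gcongr
  have bS2 : ∀ {x t} {w w₂ : Fin d → ℝ}, (∀ j, |w j| ≤ M) → (∀ j, |w₂ j| ≤ M) →
      |∑ j, 2 * (w j ^ 2 + (V j).v x t * w₂ j)| ≤ d * (2 * (M ^ 2 + M * M)) :=
    fun {x t w w₂} hw hw₂ => abs_sum_le_card_mul fun j => by
      rw [abs_mul, abs_two]
      refine mul_le_mul_of_nonneg_left ((abs_add_le _ _).trans ?_) zero_le_two
      rw [abs_mul, abs_pow]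
      have := (HV j x t).1
      have := hw j
      have := hw₂ j
      gcongr
  set N := d * (2 * M * M)
  set N₂ := d * (2 * (M ^ 2 + M * M))
  have hN : 0 ≤ N := by positivity
  have hN₂ : 0 ≤ N₂ := by positivity
  have bD1 : ∀ {x t a b}, |a| ≤ M → |b| ≤ N →
      |bellD1 δ (U.v x t) (bellRho ε V x t) a b| ≤ Q * M * M + R * N := fun {x t a b} ha hb => by
    unfold bellD1
    refine (abs_add_le _ _).trans ?_
    rw [abs_mul, abs_mul, abs_mul]
    have := (HU x t).1
    have := bQ x t
    have := bR x t
    gcongr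
  have bD2 : ∀ {x t a b a₂ b₂}, |a| ≤ M → |b| ≤ N → |a₂| ≤ M → |b₂| ≤ N₂ →
      |bellD2 δ (U.v x t) (bellRho ε V x t) a b a₂ b₂|
        ≤ (UU * M + UR * N) * M + Q * M * M + ((UR * M + RR * N) * N + R * N₂) :=
    fun {x t a b a₂ b₂} ha hb ha₂ hb₂ => by
    have := (HU x t).1
    have := bQ x t
    have := bR x t
    have := bUU x t
    have := bUR x t
    have := bRR x t
    unfold bellD2
    refine (abs_add_le _ _).trans (add_le_add ((abs_add_le _ _).trans (add_le_add ?_ ?_))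
      ((abs_add_le _ _).trans (add_le_add ?_ ?_)))
    · rw [abs_mul]
      refine mul_le_mul ((abs_add_le _ _).trans ?_) ha (abs_nonneg _) (by positivity)
      rw [abs_mul, abs_mul]
      gcongr
    · rw [abs_mul, abs_mul]
      gcongr
    · rw [abs_mul]
      refine mul_le_mul ((abs_add_le _ _).trans ?_) hb (abs_nonneg _) (by positivity)
      rw [abs_mul, abs_mul]
      gcongr
    · rw [abs_mul]
      gcongr
  set L₁ := Q * M * M + R * N
  set L₂ := (UU * M + UR * N) * M + Q * M * M + ((UR * M + RR * N) * N + R * N₂)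
  have hL₁ : 0 ≤ L₁ := by positivity
  have hL₂ : 0 ≤ L₂ := by positivity
  set L₃ := Q * M + R * (d * (2 * M))
  have hL₃ : 0 ≤ L₃ := by positivity
  refine ⟨B + L₁ + L₂ + L₃, by positivity, fun x t => ⟨?_, fun i => ?_, fun i => ?_, ?_, ?_⟩⟩
  · exact (bB x t).trans (by linarith)
  · have h : |(bellJet δ ε U V).vx i x t| ≤ L₃ * |x i| := by
      have e1 : |∑ j, 2 * (V j).v x t * (V j).vx i x t| ≤ d * (2 * (M * |x i|)) :=
        abs_sum_le_card_mul fun j => by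
          rw [mul_assoc, abs_mul, abs_two]
          have := (HV j x t).2.2.2.2.2 i
          gcongr
      have e2 := (HU x t).2.2.2.2.2 i
      have := bQ x t
      have := bR x t
      simp only [bellJet, bellD1]
      refine (abs_add_le _ _).trans ?_
      rw [mul_assoc, abs_mul, abs_mul (bellR _ _ _)]
      have e3 : L₃ * |x i| = Q * (M * |x i|) + R * (d * (2 * (M * |x i|))) := by
        simp only [L₃]; ring
      rw [e3]
      gcongr
    exact h.trans (mul_le_mul_of_nonneg_right (by linarith) (abs_nonneg _))
  · exact (bD2 ((HU x t).2.1 i) (bS1 fun j => (HV j x t).2.1 i) ((HU x t).2.2.1 i)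
      (bS2 (fun j => (HV j x t).2.1 i) fun j => (HV j x t).2.2.1 i)).trans (by linarith)
  · exact (bD1 (HU x t).2.2.2.1 (bS1 fun j => (HV j x t).2.2.2.1)).trans (by linarith)
  · exact (bD2 (HU x t).2.2.2.1 (bS1 fun j => (HV j x t).2.2.2.1) (HU x t).2.2.2.2.1
      (bS2 (fun j => (HV j x t).2.2.2.1) fun j => (HV j x t).2.2.2.2.1)).trans (by linarith)

/-- The Bellman jet dominates the bilinear form of the gradients. -/
lemma bellJet_super (h0 : 0 < δ) (h1 : δ ≤ 1) {ε : ℝ} (hε : 0 < ε) {U : Jet d}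
    {V : Fin d → Jet d} (hU : U.IsPoisson α) (hV : ∀ j, (V j).IsPoisson α) {x : Fin d → ℝ}
    (hx : x ∈ posOrth d) (t : ℝ) :
    bellC δ * |∑ i, U.vx i x t * (V i).vt x t| ≤ (bellJet δ ε U V).vtt x t
      + ∑ i, ((bellJet δ ε U V).vxx i x t + 2 * α i / x i * (bellJet δ ε U V).vx i x t) := by
  have hρ := bellRho_pos hε V x t
  have hq := bellUq_nonneg h0 (U.v x t) hρ
  have hr := bellR_nonneg h0 h1 (U.v x t) hρ
  have hc : 0 ≤ bellC δ := by unfold bellC; positivity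
  obtain ⟨τ, hτ, H⟩ := bellD2_lower h0 h1 hε (U.v x t) (fun j => (V j).v x t)
    (ρ := bellRho ε V x t) rfl
  have Ht := H (U.vt x t) (U.vtt x t) (fun j => (V j).vt x t) (fun j => (V j).vtt x t)
  have Hx := Finset.sum_le_sum fun i (_ : i ∈ Finset.univ) =>
    H (U.vx i x t) (U.vxx i x t) (fun j => (V j).vx i x t) (fun j => (V j).vxx i x t)
  have pU := mul_nonneg hq (hU.pde x hx t)
  have pV := mul_nonneg (mul_nonneg zero_le_two hr)
    (Finset.sum_nonneg fun j (_ : j ∈ Finset.univ) => (hV j).pde x hx t)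
  have key : bellC δ * |∑ i, U.vx i x t * (V i).vt x t|
      ≤ bellC δ / 2 * (τ * U.vt x t ^ 2 + (∑ j, (V j).vt x t ^ 2) / τ)
        + ∑ i, bellC δ / 2 * (τ * U.vx i x t ^ 2 + (∑ j, (V j).vx i x t ^ 2) / τ) := by
    have h : |∑ i, U.vx i x t * (V i).vt x t|
        ≤ ∑ i, 1 / 2 * (τ * U.vx i x t ^ 2 + (V i).vt x t ^ 2 / τ) := by
      refine (Finset.abs_sum_le_sum_abs _ _).trans (Finset.sum_le_sum fun i _ => ?_)
      have e : τ * U.vx i x t ^ 2 + (V i).vt x t ^ 2 / τ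
          = (τ * |U.vx i x t| - |(V i).vt x t|) ^ 2 / τ + 2 * |U.vx i x t * (V i).vt x t| := by
        rw [abs_mul, ← sq_abs (U.vx i x t), ← sq_abs ((V i).vt x t)]; field_simp; ring
      have : 0 ≤ (τ * |U.vx i x t| - |(V i).vt x t|) ^ 2 / τ := by positivity
      linarith
    refine (mul_le_mul_of_nonneg_left h hc).trans ?_
    have e : bellC δ * ∑ i, 1 / 2 * (τ * U.vx i x t ^ 2 + (V i).vt x t ^ 2 / τ)
        = bellC δ / 2 * ((∑ j, (V j).vt x t ^ 2) / τ)
          + ∑ i, bellC δ / 2 * (τ * U.vx i x t ^ 2) := by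
      rw [Finset.sum_div, Finset.mul_sum, Finset.mul_sum, ← Finset.sum_add_distrib]
      exact Finset.sum_congr rfl fun i _ => by ring
    rw [e]
    refine add_le_add (mul_le_mul_of_nonneg_left ?_ (by positivity)) (Finset.sum_le_sum fun i _ =>
      mul_le_mul_of_nonneg_left ?_ (by positivity))
    · exact le_add_of_nonneg_left (by positivity)
    · exact le_add_of_nonneg_right (div_nonneg (Finset.sum_nonneg fun _ _ => sq_nonneg _) hτ.le)
  refine key.trans ?_
  have e : bellUq δ (U.v x t) (bellRho ε V x t)
        * (U.v x t * (U.vtt x t + ∑ i, (U.vxx i x t + 2 * α i / x i * U.vx i x t)))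
      + 2 * bellR δ (U.v x t) (bellRho ε V x t) * ∑ j, (V j).v x t * ((V j).vtt x t
        + ∑ i, ((V j).vxx i x t + 2 * α i / x i * (V j).vx i x t))
      = bellUq δ (U.v x t) (bellRho ε V x t) * (U.v x t * U.vtt x t)
        + 2 * bellR δ (U.v x t) (bellRho ε V x t) * ∑ j, (V j).v x t * (V j).vtt x t
        + ∑ i, (bellUq δ (U.v x t) (bellRho ε V x t) * (U.v x t * U.vxx i x t)
          + 2 * bellR δ (U.v x t) (bellRho ε V x t) * (∑ j, (V j).v x t * (V j).vxx i x t)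
          + 2 * α i / x i * (bellJet δ ε U V).vx i x t) := by
    simp only [bellJet, bellD1]
    generalize bellUq δ (U.v x t) (bellRho ε V x t) = q
    generalize bellR δ (U.v x t) (bellRho ε V x t) = r
    have e1 : ∑ j, (V j).v x t * ((V j).vtt x t
          + ∑ i, ((V j).vxx i x t + 2 * α i / x i * (V j).vx i x t))
        = (∑ j, (V j).v x t * (V j).vtt x t) + ∑ i, ∑ j,
          (V j).v x t * ((V j).vxx i x t + 2 * α i / x i * (V j).vx i x t) := by
      rw [Finset.sum_comm, ← Finset.sum_add_distrib]
      exact Finset.sum_congr rfl fun j _ => by rw [mul_add, Finset.mul_sum]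
    have e2 : ∀ i, q * (U.v x t * U.vxx i x t) + 2 * r * (∑ j, (V j).v x t * (V j).vxx i x t)
          + 2 * α i / x i * (q * U.v x t * U.vx i x t
            + r * ∑ j, 2 * (V j).v x t * (V j).vx i x t)
        = q * (U.v x t * (U.vxx i x t + 2 * α i / x i * U.vx i x t))
          + 2 * r * ∑ j, (V j).v x t * ((V j).vxx i x t + 2 * α i / x i * (V j).vx i x t) := by
      intro i
      have e3 : ∑ j, (V j).v x t * ((V j).vxx i x t + 2 * α i / x i * (V j).vx i x t)
          = (∑ j, (V j).v x t * (V j).vxx i x t)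
            + α i / x i * ∑ j, 2 * (V j).v x t * (V j).vx i x t := by
        rw [Finset.mul_sum, ← Finset.sum_add_distrib]
        exact Finset.sum_congr rfl fun j _ => by ring
      rw [e3]
      ring
    rw [e1, Finset.sum_congr rfl fun i _ => e2 i]
    refine Eq.trans ?_ (congrArg _ Finset.sum_add_distrib.symm)
    rw [← Finset.mul_sum, ← Finset.mul_sum, ← Finset.mul_sum]
    ring
  have e0 := add_nonneg pU pV
  rw [e] at e0
  simp only [Finset.sum_add_distrib] at Hx e0 ⊢
  exact le_trans (by linarith) (add_le_add Ht (add_le_add_left Hx _))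

end

section
variable {d : ℕ} {α : Fin d → ℝ} {B : Jet d}

lemma parabola_nonneg {t T : ℝ} (h : t ∈ Ioc 0 T) : 0 ≤ t - t ^ 2 / T := by
  have hT : 0 < T := h.1.trans_le h.2
  rw [sub_nonneg, div_le_iff₀ hT]
  nlinarith [h.1, h.2]

lemma parabola_le {t T : ℝ} (h : t ∈ Ioc 0 T) : t - t ^ 2 / T ≤ T := by
  have hT : 0 < T := h.1.trans_le h.2
  have : 0 ≤ t ^ 2 / T := by positivity
  linarith [h.2]

lemma integral_parabola_mul_le {b b' b'' : ℝ → ℝ} (hb : Continuous b) (hb' : Continuous b')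
    (hb'' : Continuous b'') (h0 : ∀ t, 0 ≤ b t) (h1 : ∀ t, 0 < t → HasDerivAt b (b' t) t)
    (h2 : ∀ t, 0 < t → HasDerivAt b' (b'' t) t) {T : ℝ} (hT : 0 < T) :
    ∫ t in (0 : ℝ)..T, (t - t ^ 2 / T) * b'' t ≤ b T + b 0 := by
  have key := intervalIntegral.integral_eq_sub_of_hasDerivAt_of_le hT.le
    (f := fun t => (t - t ^ 2 / T) * b' t - (1 - 2 * t / T) * b t)
    (f' := fun t => (t - t ^ 2 / T) * b'' t + 2 / T * b t)
    (Continuous.continuousOn (by fun_prop)) (fun t h => by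
      have e1 : HasDerivAt (fun t : ℝ => t - t ^ 2 / T) (1 - 2 * t / T) t := by
        refine ((hasDerivAt_id' t).fun_sub
          (((hasDerivAt_id' t).fun_pow 2).div_const T)).congr_deriv ?_
        push_cast; ring
      have e2 : HasDerivAt (fun t : ℝ => 1 - 2 * t / T) (-(2 / T)) t := by
        refine (((hasDerivAt_id' t).const_mul 2).div_const T).const_sub 1 |>.congr_deriv ?_
        ring
      refine ((e1.fun_mul (h2 t h.1)).fun_sub (e2.fun_mul (h1 t h.1))).congr_deriv ?_
      ring) (Continuous.intervalIntegrable (by fun_prop) _ _)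
  rw [intervalIntegral.integral_add (Continuous.intervalIntegrable (by fun_prop) _ _)
    (Continuous.intervalIntegrable (by fun_prop) _ _)] at key
  have hp : 0 ≤ ∫ t in (0 : ℝ)..T, 2 / T * b t :=
    intervalIntegral.integral_nonneg hT.le fun t _ => mul_nonneg (by positivity) (h0 t)
  have e : T - T ^ 2 / T = 0 := by field_simp; ring
  have e' : 1 - 2 * T / T = -1 := by field_simp; ring
  rw [e, e'] at key
  simp only [mul_zero, zero_div, sub_zero, ne_eq, OfNat.ofNat_ne_zero, not_false_eq_true,
    zero_pow] at key
  linarith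

lemma hasDerivAt_exp_nsq (lam : ℝ) (x : Fin d → ℝ) (i : Fin d) :
    HasDerivAt (fun s => exp (-(lam * nsq (Function.update x i s))))
      (-(2 * lam * x i) * exp (-(lam * nsq x))) (x i) := by
  have h : ∀ j, HasDerivAt (fun s => Function.update x i s j ^ 2) (if j = i then 2 * x i else 0)
      (x i) := by
    intro j
    by_cases hj : j = i
    · subst hj
      simpa using (hasDerivAt_id' (x j)).fun_pow 2
    · simpa [hj] using hasDerivAt_const (x i) (x j ^ 2)
  have h2 : HasDerivAt (fun s => nsq (Function.update x i s)) (2 * x i) (x i) := by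
    refine (HasDerivAt.fun_sum fun j _ => h j).congr_deriv ?_
    simp
  refine ((h2.const_mul lam).fun_neg.exp).congr_deriv ?_
  rw [Function.update_eq_self]
  ring

lemma sq_mul_exp_nsq_le {lam : ℝ} (hl : 0 ≤ lam) (x : Fin d → ℝ) (i : Fin d) :
    lam * x i ^ 2 * exp (-(lam * nsq x)) ≤ 1 := by
  have h1 : lam * x i ^ 2 ≤ lam * nsq x := mul_le_mul_of_nonneg_left (sq_le_nsq x i) hl
  have h2 := add_one_le_exp (lam * nsq x)
  have h3 : exp (-(lam * nsq x)) * exp (lam * nsq x) = 1 := by rw [← exp_add]; simp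
  nlinarith [exp_pos (-(lam * nsq x))]

/-- The Bessel operator in the `i`-th variable. -/
def Jet.bess (α : Fin d → ℝ) (B : Jet d) (i : Fin d) (x : Fin d → ℝ) (t : ℝ) : ℝ :=
  B.vxx i x t + 2 * α i / x i * B.vx i x t

lemma Jet.IsRegular.bess_bdd (hB : B.IsRegular) (α : Fin d → ℝ) :
    ∃ C, 0 ≤ C ∧ ∀ i, ∀ x t, |B.bess α i x t| ≤ C := by
  obtain ⟨M, hM, H⟩ := hB.bdd
  refine ⟨M + ∑ j, 2 * |α j| * M, add_nonneg hM (Finset.sum_nonneg fun j _ => by positivity),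
    fun i x t => ?_⟩
  have h1 := (H x t).2.2.1 i
  have h2 := (H x t).2.1 i
  have h3 : 2 * |α i| * M ≤ ∑ j, 2 * |α j| * M :=
    Finset.single_le_sum (f := fun j => 2 * |α j| * M) (fun j _ => by positivity)
      (Finset.mem_univ i)
  refine (abs_add_le _ _).trans (add_le_add h1 (le_trans ?_ h3))
  rcases eq_or_ne (x i) 0 with h | h
  · simp only [h, div_zero, zero_mul, abs_zero]
    positivity
  · have hx : 0 < |x i| := abs_pos.2 h
    rw [abs_mul, abs_div, abs_mul, abs_two, div_mul_eq_mul_div, div_le_iff₀ hx, mul_assoc _ M]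
    gcongr

lemma Jet.IsRegular.measurable_bess (hB : B.IsRegular) (α : Fin d → ℝ) (i : Fin d) :
    Measurable fun p : (Fin d → ℝ) × ℝ => B.bess α i p.1 p.2 := by
  have h1 := (hB.cont_vx i).measurable
  have h2 := (hB.cont_vxx i).measurable
  unfold Jet.bess
  fun_prop

lemma Jet.IsRegular.integral_bess_mul_exp_le (hB : B.IsRegular) (hα : ∀ j, 0 ≤ α j) {t : ℝ}
    (h0 : ∀ x, 0 ≤ B.v x t) (hint : Integrable (fun x => B.v x t) (wMeasure d α)) {lam : ℝ}
    (hl : 0 < lam) (i : Fin d) :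
    ∫ x, B.bess α i x t * exp (-(lam * nsq x)) ∂(wMeasure d α)
      ≤ 4 * lam * ∫ x, B.v x t ∂(wMeasure d α) := by
  obtain ⟨M, hM, H⟩ := hB.bdd
  obtain ⟨C, hC, HC⟩ := hB.bess_bdd α
  set E : (Fin d → ℝ) → ℝ := fun x => exp (-(lam * nsq x))
  have hE : Continuous E := by
    have := continuous_nsq (d := d)
    fun_prop
  have hE0 : ∀ x, 0 < E x := fun x => exp_pos _
  have hE1 : ∀ x, E x ≤ 1 := fun x => exp_le_one_iff.2
    (neg_nonpos.2 (mul_nonneg hl.le (nsq_nonneg x)))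
  have hi1 : Integrable (fun x => B.bess α i x t * E x) (wMeasure d α) := by
    refine Integrable.bdd_mul (c := C) (integrable_exp_nsq hα hl) ?_ ?_
    · exact ((hB.measurable_bess α i).comp (measurable_id.prodMk
        measurable_const)).aestronglyMeasurable
    · exact Eventually.of_forall fun x => HC i x t
  have cv : Continuous fun x => B.v x t := hB.cont_v.comp (Continuous.prodMk_left t)
  have hq : ∀ x, |(4 * lam * (lam * x i ^ 2) - 2 * lam - 4 * lam * α i) * E x|
      ≤ 4 * lam + 2 * lam + 4 * lam * α i := fun x => by
    have e1 := sq_mul_exp_nsq_le hl.le x i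
    have e2 : 0 ≤ lam * x i ^ 2 * E x := mul_nonneg (by positivity) (hE0 x).le
    have e3 := mul_nonneg hl.le (hα i)
    have e4 : (2 * lam + 4 * lam * α i) * E x ≤ 2 * lam + 4 * lam * α i :=
      mul_le_of_le_one_right (by linarith) (hE1 x)
    have e5 : 0 ≤ (2 * lam + 4 * lam * α i) * E x := mul_nonneg (by linarith) (hE0 x).le
    have e6 : (4 * lam * (lam * x i ^ 2) - 2 * lam - 4 * lam * α i) * E x
      = 4 * lam * (lam * x i ^ 2 * E x) - (2 * lam + 4 * lam * α i) * E x := by ring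
    have e7 : 4 * lam * (lam * x i ^ 2 * E x) ≤ 4 * lam := mul_le_of_le_one_right (by linarith) e1
    have e8 : 0 ≤ 4 * lam * (lam * x i ^ 2 * E x) := mul_nonneg (by linarith) e2
    rw [e6, abs_le]
    constructor <;> linarith
  have hi2 : Integrable (fun x => (4 * lam * (lam * x i ^ 2) - 2 * lam - 4 * lam * α i) * E x
      * B.v x t) (wMeasure d α) := by
    refine Integrable.bdd_mul (c := 4 * lam + 2 * lam + 4 * lam * α i) hint ?_ ?_
    · exact Continuous.aestronglyMeasurable (by fun_prop)
    · exact Eventually.of_forall hq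
  have key := integral_wMeasure_div hα i (C := M + 2 * lam * M) (lam := lam) hl
    (F := fun x => B.vx i x t * E x + 2 * lam * (B.v x t * (x i * E x)))
    (F' := fun x => B.vxx i x t * E x + 2 * lam * (B.v x t * (1 * E x
      + x i * (-(2 * lam * x i) * E x))))
    (fun x _ => by
      have d1 := hB.deriv_xx i x t (x i)
      have d2 := hB.deriv_x i x t (x i)
      have d3 := hasDerivAt_exp_nsq lam x i
      have d4 : HasDerivAt (fun s => Function.update x i s i) 1 (x i) := by
        simpa using hasDerivAt_id' (x i)
      refine ((d1.fun_mul d3).fun_add ((d2.fun_mul (d4.fun_mul d3)).const_mul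
        (2 * lam))).congr_deriv ?_
      simp only [Function.update_eq_self, E]
      ring)
    (fun x hx => by
      have h1 := (H x t).2.1 i
      have h2 := (H x t).1
      rw [abs_of_pos (hx i)] at h1
      refine (abs_add_le _ _).trans ?_
      rw [abs_mul, abs_mul (2 * lam), abs_mul (B.v x t), abs_mul (x i), abs_of_pos (hE0 x),
        abs_of_pos (hx i), abs_of_pos (by positivity : 0 < 2 * lam)]
      have hxi := (hx i).le
      have := (hE0 x).le
      calc |B.vx i x t| * E x + 2 * lam * (|B.v x t| * (x i * E x))
          ≤ M * x i * E x + 2 * lam * (M * (x i * E x)) := by gcongr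
        _ = _ := by simp only [E]; ring)
  have heq : (fun x => B.vxx i x t * E x + 2 * lam * (B.v x t * (1 * E x
      + x i * (-(2 * lam * x i) * E x)))
      + 2 * α i / x i * (B.vx i x t * E x + 2 * lam * (B.v x t * (x i * E x))))
      =ᵐ[wMeasure d α] fun x => B.bess α i x t * E x
        - (4 * lam * (lam * x i ^ 2) - 2 * lam - 4 * lam * α i) * E x * B.v x t := by
    filter_upwards [ae_posOrth d α] with x hx
    have := (hx i).ne'
    simp only [Jet.bess]
    field_simp
    ring
  have key2 := key ((hi1.sub hi2).congr heq.symm)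
  rw [integral_congr_ae heq, integral_sub hi1 hi2, sub_eq_zero] at key2
  rw [key2, ← integral_const_mul]
  refine integral_mono hi2 (hint.const_mul _) fun x => ?_
  refine mul_le_mul_of_nonneg_right ?_ (h0 x)
  have e1 := sq_mul_exp_nsq_le hl.le x i
  have e3 := mul_nonneg hl.le (hα i)
  have e5 : 0 ≤ (2 * lam + 4 * lam * α i) * E x := mul_nonneg (by linarith) (hE0 x).le
  have e7 : 4 * lam * (lam * x i ^ 2 * E x) ≤ 4 * lam := mul_le_of_le_one_right (by linarith) e1
  linarith

lemma integrable_prod_bounded_mul {φ : ℝ → ℝ} {T : ℝ} (hφ : Continuous φ) {E : (Fin d → ℝ) → ℝ}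
    (hE : Integrable E (wMeasure d α)) {G : (Fin d → ℝ) → ℝ → ℝ} {C : ℝ}
    (hG : Measurable fun p : (Fin d → ℝ) × ℝ => G p.1 p.2) (hC : ∀ x t, |G x t| ≤ C) :
    Integrable (fun p : ℝ × (Fin d → ℝ) => G p.2 p.1 * (φ p.1 * E p.2))
      ((volume.restrict (Ioc 0 T)).prod (wMeasure d α)) := by
  have h1 : Integrable φ (volume.restrict (Ioc 0 T)) :=
    (hφ.integrableOn_Icc (a := 0) (b := T)).mono_set Ioc_subset_Icc_self
  refine Integrable.bdd_mul (c := C) (h1.mul_prod hE) ?_ ?_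
  · exact (hG.comp measurable_swap).aestronglyMeasurable
  · exact Eventually.of_forall fun p => hC p.2 p.1

/-- Green's formula with a parabolic weight in `t` and a Gaussian cut-off in `x`. -/
lemma Jet.IsRegular.green (hB : B.IsRegular) (hα : ∀ j, 0 ≤ α j) (h0 : ∀ x t, 0 ≤ B.v x t)
    (hint : ∀ t, Integrable (fun x => B.v x t) (wMeasure d α)) {S : ℝ}
    (hS : ∀ t, ∫ x, B.v x t ∂(wMeasure d α) ≤ S) {h : (Fin d → ℝ) → ℝ → ℝ}
    (hh0 : ∀ x t, 0 ≤ h x t)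
    (hle : ∀ x ∈ posOrth d, ∀ t, h x t ≤ B.vtt x t + ∑ i, B.bess α i x t) {lam T : ℝ}
    (hl : 0 < lam) (hT : 0 < T) :
    ∫ p : ℝ × (Fin d → ℝ), (p.1 - p.1 ^ 2 / T) * h p.2 p.1 * exp (-(lam * nsq p.2))
        ∂((volume.restrict (Ioc 0 T)).prod (wMeasure d α))
      ≤ ∫ x, B.v x T ∂(wMeasure d α) + ∫ x, B.v x 0 ∂(wMeasure d α)
        + d * (4 * lam * S * T ^ 2) := by
  obtain ⟨M, hM, H⟩ := hB.bdd
  obtain ⟨C, hC, HC⟩ := hB.bess_bdd α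
  have hE := integrable_exp_nsq hα hl
  have hφ : Continuous fun t : ℝ => t - t ^ 2 / T := by fun_prop
  have i1 := integrable_prod_bounded_mul (T := T) hφ hE hB.cont_vtt.measurable
    fun x t => (H x t).2.2.2.2
  have i2 := fun i => integrable_prod_bounded_mul (T := T) hφ hE (hB.measurable_bess α i)
    (HC i)
  have i2' := integrable_finsetSum Finset.univ fun i _ => i2 i
  have hmem : ∀ᵐ p : ℝ × (Fin d → ℝ) ∂((volume.restrict (Ioc 0 T)).prod (wMeasure d α)),
      p.1 ∈ Ioc 0 T := Measure.quasiMeasurePreserving_fst.ae (ae_restrict_mem measurableSet_Ioc)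
  have hpos : ∀ᵐ p : ℝ × (Fin d → ℝ) ∂((volume.restrict (Ioc 0 T)).prod (wMeasure d α)),
      p.2 ∈ posOrth d := Measure.quasiMeasurePreserving_snd.ae (ae_posOrth d α)
  have step1 : ∫ p : ℝ × (Fin d → ℝ), (p.1 - p.1 ^ 2 / T) * h p.2 p.1 * exp (-(lam * nsq p.2))
        ∂((volume.restrict (Ioc 0 T)).prod (wMeasure d α))
      ≤ ∫ p : ℝ × (Fin d → ℝ), (B.vtt p.2 p.1 * ((p.1 - p.1 ^ 2 / T) * exp (-(lam * nsq p.2)))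
        + ∑ i, B.bess α i p.2 p.1 * ((p.1 - p.1 ^ 2 / T) * exp (-(lam * nsq p.2))))
        ∂((volume.restrict (Ioc 0 T)).prod (wMeasure d α)) := by
    refine integral_mono_of_nonneg ?_ (i1.add i2') ?_
    · filter_upwards [hmem] with p hp
      exact mul_nonneg (mul_nonneg (parabola_nonneg hp) (hh0 _ _)) (exp_pos _).le
    · filter_upwards [hmem, hpos] with p hp hx
      rw [← Finset.sum_mul, ← add_mul, mul_comm _ (h p.2 p.1), mul_assoc]
      exact mul_le_mul_of_nonneg_right (hle _ hx _) (mul_nonneg (parabola_nonneg hp) (exp_pos _).le)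
  refine step1.trans ?_
  rw [integral_add i1 i2', integral_finsetSum _ fun i _ => i2 i]
  refine add_le_add ?_ ?_
  · rw [integral_prod_symm _ i1, ← integral_add (hint T) (hint 0)]
    refine integral_mono i1.integral_prod_right ((hint T).add (hint 0)) fun x => ?_
    have hb := integral_parabola_mul_le (b := B.v x) (b' := B.vt x) (b'' := B.vtt x)
      (hB.cont_v.comp (Continuous.prodMk_right x)) (hB.cont_vt.comp (Continuous.prodMk_right x))
      (hB.cont_vtt.comp (Continuous.prodMk_right x)) (h0 x) (hB.deriv_t x) (hB.deriv_tt x) hT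
    rw [intervalIntegral.integral_of_le hT.le] at hb
    have e : ∫ t in Ioc 0 T, B.vtt x t * ((t - t ^ 2 / T) * exp (-(lam * nsq x)))
        = (∫ t in Ioc 0 T, (t - t ^ 2 / T) * B.vtt x t) * exp (-(lam * nsq x)) := by
      rw [← integral_mul_const]
      congr 1; ext t; ring
    change ∫ t in Ioc 0 T, B.vtt x t * ((t - t ^ 2 / T) * exp (-(lam * nsq x)))
      ≤ B.v x T + B.v x 0
    rw [e]
    refine (mul_le_mul_of_nonneg_right hb (exp_pos _).le).trans
      (mul_le_of_le_one_right (add_nonneg (h0 _ _) (h0 _ _)) (exp_le_one_iff.2 ?_))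
    exact neg_nonpos.2 (mul_nonneg hl.le (nsq_nonneg x))
  · have hi : ∀ i ∈ Finset.univ, ∫ p : ℝ × (Fin d → ℝ),
        B.bess α i p.2 p.1 * ((p.1 - p.1 ^ 2 / T) * exp (-(lam * nsq p.2)))
        ∂((volume.restrict (Ioc 0 T)).prod (wMeasure d α)) ≤ 4 * lam * S * T ^ 2 := by
      intro i _
      have hS0 : 0 ≤ S := (integral_nonneg fun x => h0 x 0).trans (hS 0)
      rw [integral_prod _ (i2 i)]
      have hle2 : ∀ t ∈ Ioc 0 T, ∫ x, B.bess α i x t * ((t - t ^ 2 / T) * exp (-(lam * nsq x)))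
          ∂(wMeasure d α) ≤ T * (4 * lam * S) := by
        intro t h
        have e : ∫ x, B.bess α i x t * ((t - t ^ 2 / T) * exp (-(lam * nsq x))) ∂(wMeasure d α)
            = (t - t ^ 2 / T) * ∫ x, B.bess α i x t * exp (-(lam * nsq x)) ∂(wMeasure d α) := by
          rw [← integral_const_mul]
          congr 1; ext x; ring
        rw [e]
        have h4 := hB.integral_bess_mul_exp_le hα (fun x => h0 x t) (hint t) hl i
        have h5 := mul_le_mul_of_nonneg_left (hS t) (by positivity : 0 ≤ 4 * lam)
        exact (mul_le_mul_of_nonneg_left (h4.trans h5) (parabola_nonneg h)).trans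
          (mul_le_mul_of_nonneg_right (parabola_le h) (by positivity))
      refine (setIntegral_mono_on (i2 i).integral_prod_left (integrable_const (T * (4 * lam * S)))
        measurableSet_Ioc hle2).trans_eq ?_
      rw [integral_const]
      simp [hT.le]
      ring
    refine (Finset.sum_le_card_nsmul _ _ _ hi).trans_eq ?_
    simp

/-- Green's formula without cut-off. -/
lemma Jet.IsRegular.green_limit (hB : B.IsRegular) (hα : ∀ j, 0 ≤ α j) (h0 : ∀ x t, 0 ≤ B.v x t)
    (hint : ∀ t, Integrable (fun x => B.v x t) (wMeasure d α)) {S : ℝ}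
    (hS : ∀ t, ∫ x, B.v x t ∂(wMeasure d α) ≤ S) {h : (Fin d → ℝ) → ℝ → ℝ}
    (hh0 : ∀ x t, 0 ≤ h x t)
    (hle : ∀ x ∈ posOrth d, ∀ t, h x t ≤ B.vtt x t + ∑ i, B.bess α i x t) {T : ℝ} (hT : 0 < T)
    (hhi : Integrable (fun p : ℝ × (Fin d → ℝ) => (p.1 - p.1 ^ 2 / T) * h p.2 p.1)
      ((volume.restrict (Ioc 0 T)).prod (wMeasure d α))) :
    ∫ p : ℝ × (Fin d → ℝ), (p.1 - p.1 ^ 2 / T) * h p.2 p.1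
        ∂((volume.restrict (Ioc 0 T)).prod (wMeasure d α))
      ≤ ∫ x, B.v x T ∂(wMeasure d α) + ∫ x, B.v x 0 ∂(wMeasure d α) := by
  have hc := continuous_nsq (d := d)
  have t1 : Tendsto (fun lam : ℝ => ∫ p : ℝ × (Fin d → ℝ),
      (p.1 - p.1 ^ 2 / T) * h p.2 p.1 * exp (-(lam * nsq p.2))
        ∂((volume.restrict (Ioc 0 T)).prod (wMeasure d α))) (nhdsWithin 0 (Ioi 0))
      (nhds (∫ p : ℝ × (Fin d → ℝ), (p.1 - p.1 ^ 2 / T) * h p.2 p.1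
        ∂((volume.restrict (Ioc 0 T)).prod (wMeasure d α)))) := by
    refine tendsto_integral_filter_of_dominated_convergence _ ?_ ?_ hhi.norm ?_
    · exact Eventually.of_forall fun lam =>
        hhi.1.mul (Continuous.aestronglyMeasurable (by fun_prop))
    · filter_upwards [self_mem_nhdsWithin] with lam hlam
      refine Eventually.of_forall fun p => ?_
      rw [norm_mul]
      refine mul_le_of_le_one_right (norm_nonneg _) ?_
      rw [Real.norm_eq_abs, abs_of_pos (exp_pos _), exp_le_one_iff, neg_nonpos]
      exact mul_nonneg (le_of_lt hlam) (nsq_nonneg _)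
    · refine Eventually.of_forall fun p => ?_
      have : Continuous fun lam : ℝ => (p.1 - p.1 ^ 2 / T) * h p.2 p.1 * exp (-(lam * nsq p.2)) := by
        fun_prop
      simpa using (this.tendsto 0).mono_left nhdsWithin_le_nhds
  have t2 : Tendsto (fun lam : ℝ => ∫ x, B.v x T ∂(wMeasure d α) + ∫ x, B.v x 0 ∂(wMeasure d α)
      + d * (4 * lam * S * T ^ 2)) (nhdsWithin 0 (Ioi 0))
      (nhds (∫ x, B.v x T ∂(wMeasure d α) + ∫ x, B.v x 0 ∂(wMeasure d α))) := by
    have : Continuous fun lam : ℝ => ∫ x, B.v x T ∂(wMeasure d α) + ∫ x, B.v x 0 ∂(wMeasure d α)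
      + d * (4 * lam * S * T ^ 2) := by fun_prop
    simpa using (this.tendsto 0).mono_left nhdsWithin_le_nhds
  refine le_of_tendsto_of_tendsto t1 t2 ?_
  filter_upwards [self_mem_nhdsWithin] with lam hlam
  exact hB.green hα h0 hint hS hh0 hle hlam hT

end

section
variable {d : ℕ} {α : Fin d → ℝ} {δ ε : ℝ} {U : Jet d} {V : Fin d → Jet d}

lemma bellJet_nonneg (h0 : 0 < δ) (hε : 0 < ε) (x : Fin d → ℝ) (t : ℝ) :
    0 ≤ (bellJet δ ε U V).v x t :=
  bell_nonneg h0 hε _ (sq_le_bellRho ε V x t)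

lemma bellJet_integral (h0 : 0 < δ) (h1 : δ ≤ 1) (hε : 0 < ε) (hU : U.IsPoisson α)
    (hV : ∀ j, (V j).IsPoisson α) :
    (∀ t, Integrable (fun x => (bellJet δ ε U V).v x t) (wMeasure d α)) ∧
    (∃ S, ∀ t, ∫ x, (bellJet δ ε U V).v x t ∂(wMeasure d α) ≤ S) ∧
    Tendsto (fun t => ∫ x, (bellJet δ ε U V).v x t ∂(wMeasure d α)) atTop (nhds 0) := by
  obtain ⟨M, hM, H⟩ := exists_common_bound hU hV
  obtain ⟨C, hC, HC⟩ := bell_le_quadratic h0 h1 hε (M + d * M ^ 2)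
  have hdM : 0 ≤ d * M ^ 2 := by positivity
  have hle : ∀ x t, (bellJet δ ε U V).v x t ≤ C * (U.v x t ^ 2 + ∑ j, (V j).v x t ^ 2) := by
    intro x t
    refine HC _ _ ((H U (Or.inl rfl) x t).1.trans (by linarith))
      (Finset.sum_nonneg fun _ _ => sq_nonneg _) ?_
    have := (le_abs_self _).trans (abs_sum_le_card_mul (w := fun j => (V j).v x t ^ 2)
      (B := M ^ 2) fun j => by
        rw [abs_of_nonneg (sq_nonneg _), ← sq_abs]
        exact pow_le_pow_left₀ (abs_nonneg _) (H _ (Or.inr ⟨j, rfl⟩) x t).1 2)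
    linarith
  have hiV := fun t => integrable_finsetSum Finset.univ fun j _ => (hV j).sq_int t
  have hi := fun t => ((hU.sq_int t).add (hiV t)).const_mul C
  have hB := fun t : ℝ => (bellJet_isRegular h0 h1 hε hU hV).cont_v.comp
    (Continuous.prodMk_left (X := Fin d → ℝ) t)
  have hint : ∀ t, Integrable (fun x => (bellJet δ ε U V).v x t) (wMeasure d α) := fun t =>
    (hi t).mono' (hB t).aestronglyMeasurable (Eventually.of_forall fun x => by
      rw [Real.norm_eq_abs, abs_of_nonneg (bellJet_nonneg h0 hε x t)]
      exact hle x t)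
  have hle2 : ∀ t, ∫ x, (bellJet δ ε U V).v x t ∂(wMeasure d α)
      ≤ C * (∫ x, U.v x t ^ 2 ∂(wMeasure d α) + ∑ j, ∫ x, (V j).v x t ^ 2 ∂(wMeasure d α)) := by
    intro t
    rw [← integral_finsetSum _ fun j _ => (hV j).sq_int t, ← integral_add (hU.sq_int t) (hiV t),
      ← integral_const_mul]
    exact integral_mono (hint t) (hi t) fun x => hle x t
  refine ⟨hint, ?_, ?_⟩
  · obtain ⟨a, ha⟩ := hU.sq_bdd
    choose b hb using fun j => (hV j).sq_bdd
    exact ⟨C * (a + ∑ j, b j), fun t => (hle2 t).trans (mul_le_mul_of_nonneg_left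
      (add_le_add (ha t) (Finset.sum_le_sum fun j _ => hb j t)) hC)⟩
  · refine squeeze_zero (fun t => integral_nonneg fun x => bellJet_nonneg h0 hε x t) hle2 ?_
    simpa using (hU.sq_tendsto.add (tendsto_finsetSum Finset.univ fun j _ =>
      (hV j).sq_tendsto)).const_mul C

lemma integrable_prod_sq {w : (Fin d → ℝ) → ℝ → ℝ}
    (hw : Continuous fun p : (Fin d → ℝ) × ℝ => w p.1 p.2)
    (hi : ∀ t, Integrable (fun x => w x t ^ 2) (wMeasure d α))
    (hC : ∃ C, ∀ t, ∫ x, w x t ^ 2 ∂(wMeasure d α) ≤ C) (T : ℝ) :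
    Integrable (fun p : ℝ × (Fin d → ℝ) => w p.2 p.1 ^ 2)
      ((volume.restrict (Ioc 0 T)).prod (wMeasure d α)) := by
  obtain ⟨C, hC⟩ := hC
  have hc : Continuous fun p : ℝ × (Fin d → ℝ) => w p.2 p.1 ^ 2 := (hw.comp continuous_swap).pow 2
  rw [integrable_prod_iff hc.aestronglyMeasurable]
  refine ⟨Eventually.of_forall hi, ?_⟩
  have hm := (hc.aestronglyMeasurable (μ := (volume.restrict (Ioc 0 T)).prod
    (wMeasure d α))).norm.integral_prod_right'
  refine (integrable_const C).mono' hm (Eventually.of_forall fun t => ?_)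
  rw [Real.norm_eq_abs, abs_of_nonneg (integral_nonneg fun _ => norm_nonneg _)]
  simpa using hC t

lemma integrable_prod_mul {w z : (Fin d → ℝ) → ℝ → ℝ}
    (hw : Continuous fun p : (Fin d → ℝ) × ℝ => w p.1 p.2)
    (hwi : ∀ t, Integrable (fun x => w x t ^ 2) (wMeasure d α))
    (hwC : ∃ C, ∀ t, ∫ x, w x t ^ 2 ∂(wMeasure d α) ≤ C)
    (hz : Continuous fun p : (Fin d → ℝ) × ℝ => z p.1 p.2)
    (hzi : ∀ t, Integrable (fun x => z x t ^ 2) (wMeasure d α))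
    (hzC : ∃ C, ∀ t, ∫ x, z x t ^ 2 ∂(wMeasure d α) ≤ C) (T : ℝ) :
    Integrable (fun p : ℝ × (Fin d → ℝ) => (p.1 - p.1 ^ 2 / T) * (w p.2 p.1 * z p.2 p.1))
      ((volume.restrict (Ioc 0 T)).prod (wMeasure d α)) := by
  have mw := (memLp_two_iff_integrable_sq (hw.comp continuous_swap).aestronglyMeasurable).2
    (integrable_prod_sq hw hwi hwC T)
  have mz := (memLp_two_iff_integrable_sq (hz.comp continuous_swap).aestronglyMeasurable).2
    (integrable_prod_sq hz hzi hzC T)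
  refine Integrable.bdd_mul (c := T) (mw.integrable_mul mz)
    (Continuous.aestronglyMeasurable (by fun_prop)) ?_
  have hmem : ∀ᵐ p : ℝ × (Fin d → ℝ) ∂((volume.restrict (Ioc 0 T)).prod (wMeasure d α)),
      p.1 ∈ Ioc 0 T := Measure.quasiMeasurePreserving_fst.ae (ae_restrict_mem measurableSet_Ioc)
  filter_upwards [hmem] with p hp
  rw [Real.norm_eq_abs, abs_of_nonneg (parabola_nonneg hp)]
  exact parabola_le hp

lemma abs_integral_vx_mul_vt_le (hα : ∀ j, 0 ≤ α j) (h0 : 0 < δ) (h1 : δ ≤ 1) (hε : 0 < ε)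
    (hU : U.IsPoisson α) (hV : ∀ j, (V j).IsPoisson α)
    (hUx : ∀ i, (∀ t, Integrable (fun x => U.vx i x t ^ 2) (wMeasure d α)) ∧
      ∃ C, ∀ t, ∫ x, U.vx i x t ^ 2 ∂(wMeasure d α) ≤ C)
    (hVt : ∀ i, (∀ t, Integrable (fun x => (V i).vt x t ^ 2) (wMeasure d α)) ∧
      ∃ C, ∀ t, ∫ x, (V i).vt x t ^ 2 ∂(wMeasure d α) ≤ C) {T : ℝ} (hT : 0 < T) :
    bellC δ * |∑ i, ∫ t in (0 : ℝ)..T, (t - t ^ 2 / T) *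
        ∫ x, U.vx i x t * (V i).vt x t ∂(wMeasure d α)|
      ≤ ∫ x, (bellJet δ ε U V).v x T ∂(wMeasure d α)
        + ∫ x, (bellJet δ ε U V).v x 0 ∂(wMeasure d α) := by
  have hc : 0 ≤ bellC δ := by unfold bellC; positivity
  obtain ⟨hint, ⟨S, hS⟩, -⟩ := bellJet_integral h0 h1 hε hU hV
  have hi := fun i => integrable_prod_mul (hU.cont_vx i) (hUx i).1 (hUx i).2 (hV i).cont_vt
    (hVt i).1 (hVt i).2 T
  have hi' := integrable_finsetSum Finset.univ fun i _ => hi i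
  simp only [← Finset.mul_sum] at hi'
  have hmem : ∀ᵐ p : ℝ × (Fin d → ℝ) ∂((volume.restrict (Ioc 0 T)).prod (wMeasure d α)),
      p.1 ∈ Ioc 0 T := Measure.quasiMeasurePreserving_fst.ae (ae_restrict_mem measurableSet_Ioc)
  have habs : (fun p : ℝ × (Fin d → ℝ) => bellC δ *
        ‖(p.1 - p.1 ^ 2 / T) * ∑ i, U.vx i p.2 p.1 * (V i).vt p.2 p.1‖)
      =ᵐ[(volume.restrict (Ioc 0 T)).prod (wMeasure d α)] fun p => (p.1 - p.1 ^ 2 / T) *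
        (bellC δ * |∑ i, U.vx i p.2 p.1 * (V i).vt p.2 p.1|) := by
    filter_upwards [hmem] with p hp
    rw [norm_mul, Real.norm_eq_abs, abs_of_nonneg (parabola_nonneg hp), Real.norm_eq_abs]
    ring
  have key := (bellJet_isRegular h0 h1 hε hU hV).green_limit hα (bellJet_nonneg h0 hε) hint hS
    (h := fun x t => bellC δ * |∑ i, U.vx i x t * (V i).vt x t|)
    (fun x t => mul_nonneg hc (abs_nonneg _))
    (fun x hx t => bellJet_super h0 h1 hε hU hV hx t) hT
    ((hi'.norm.const_mul (bellC δ)).congr habs)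
  refine le_trans ?_ key
  rw [← integral_congr_ae habs, integral_const_mul]
  refine mul_le_mul_of_nonneg_left ?_ hc
  refine le_trans (le_of_eq ?_) (norm_integral_le_integral_norm _)
  rw [Real.norm_eq_abs]
  congr 1
  simp only [Finset.mul_sum]
  rw [integral_finsetSum _ fun i _ => hi i]
  refine Finset.sum_congr rfl fun i _ => ?_
  rw [integral_prod _ (hi i), intervalIntegral.integral_of_le hT.le]
  congr 1; ext t
  exact (integral_const_mul _ _).symm

lemma riesz_sum_le (hd : 0 < d) (hα : ∀ j, 0 ≤ α j) (h0 : 0 < δ) (h1 : δ ≤ 1)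
    {f : (Fin d → ℝ) → ℝ} (hf : CcInfPos d f) {g : Fin d → (Fin d → ℝ) → ℝ}
    (hg : ∀ i, CcInfPos d (g i)) :
    bellC δ / 4 * |∑ i, ∫ x, riesz d α i f x * g i x ∂(wMeasure d α)|
      ≤ (1 + 3 / 40 * δ) * (∫ x, |f x| ^ ((1 + δ) / δ) ∂(wMeasure d α)
        + ∫ x, (∑ i, g i x ^ 2) ^ ((1 + δ) / 2) ∂(wMeasure d α)) := by
  have hc : 0 ≤ bellC δ := by unfold bellC; positivity
  have hU := poissonJet_isPoisson hd hα (rapid_ht hα hf)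
  have hV := fun i => conjJet_isPoisson hd hα i (rapid_conjHat hα i (hg i))
  set U := poissonJet α (ht α f)
  set V := fun i => conjJet α i (conjHat α i (g i))
  have hgs : CcInfPos d (fun x => ∑ i, g i x ^ 2) := by
    simp only [pow_two]
    exact CcInfPos.sum Finset.univ fun i => (hg i).mul (hg i)
  have iF : Integrable (fun x => |f x| ^ ((1 + δ) / δ)) (wMeasure d α) := by
    have hp : 0 < (1 + δ) / δ := by positivity
    exact integrable_of_hasCompactSupport hα
      (hf.continuous.abs.rpow_const fun _ => Or.inr hp.le)
      (hf.2.1.comp_left (g := fun y => |y| ^ ((1 + δ) / δ)) (by simp [hp.ne']))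
  have iG : Integrable (fun x => (∑ i, g i x ^ 2) ^ ((1 + δ) / 2)) (wMeasure d α) := by
    have hp : 0 < (1 + δ) / 2 := by positivity
    exact integrable_of_hasCompactSupport hα
      (hgs.continuous.rpow_const fun _ => Or.inr hp.le)
      (hgs.2.1.comp_left (g := fun y => y ^ ((1 + δ) / 2)) (by simp [hp.ne']))
  have iFG : Integrable (fun x => |f x| ^ ((1 + δ) / δ) + (∑ i, g i x ^ 2) ^ ((1 + δ) / 2))
      (wMeasure d α) := iF.add iG
  obtain ⟨L, hL⟩ := ((IsCompact.union hf.2.1 hgs.2.1).exists_bound_of_continuousOn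
    (f := nsq) continuous_nsq.continuousOn)
  set Φ : (Fin d → ℝ) → ℝ := fun x => exp L * exp (-(1 * nsq x))
  have iΦ : Integrable Φ (wMeasure d α) := (integrable_exp_nsq hα one_pos).const_mul _
  have hzero : ∀ ε > 0, ∫ x, (bellJet δ ε U V).v x 0 ∂(wMeasure d α)
      ≤ (1 + 3 / 40 * δ) * (∫ x, |f x| ^ ((1 + δ) / δ) ∂(wMeasure d α)
        + ∫ x, (∑ i, g i x ^ 2) ^ ((1 + δ) / 2) ∂(wMeasure d α))
        + 3 / 40 * δ * ε ^ (1 + δ) * ∫ x, Φ x ∂(wMeasure d α) := by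
    intro ε hε
    rw [← integral_add iF iG, ← integral_const_mul, ← integral_const_mul,
      ← integral_add (iFG.const_mul _) (iΦ.const_mul _)]
    refine integral_mono_ae ((bellJet_integral h0 h1 hε hU hV).1 0)
      ((iFG.const_mul _).add (iΦ.const_mul _)) ?_
    have hv := eventually_countable_forall.2 fun i => conjJet_v_zero hα i (hg i)
    filter_upwards [poissonJet_v_zero hα hf, hv] with x hx hx'
    have e : (bellJet δ ε U V).v x 0 = bell δ ε (f x) (ε ^ 2 + ∑ i, g i x ^ 2) := by
      simp only [bellJet, bellRho, U, V, hx, hx']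
    have hs : 0 ≤ ∑ i, g i x ^ 2 := Finset.sum_nonneg fun _ _ => sq_nonneg _
    change (bellJet δ ε U V).v x 0 ≤ (1 + 3 / 40 * δ) * (|f x| ^ ((1 + δ) / δ)
      + (∑ i, g i x ^ 2) ^ ((1 + δ) / 2)) + 3 / 40 * δ * ε ^ (1 + δ) * Φ x
    rw [e]
    have hκ : 0 ≤ 3 / 40 * δ * ε ^ (1 + δ) := by positivity
    by_cases hK : x ∈ tsupport f ∪ tsupport fun x => ∑ i, g i x ^ 2
    · refine (bell_le_rpow h0 h1 hε (f x) hs).trans (add_le_add le_rfl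
        (le_mul_of_one_le_right hκ ?_))
      have := (le_abs_self _).trans (hL x hK)
      simp only [Φ]
      rw [← exp_add, one_le_exp_iff]
      linarith
    · rw [mem_union, not_or] at hK
      have e1 := image_eq_zero_of_notMem_tsupport hK.1
      have e2 := image_eq_zero_of_notMem_tsupport hK.2
      obtain ⟨C, -, HC⟩ := bell_le_quadratic h0 h1 hε 0
      have h3 := HC 0 0 (by simp) le_rfl le_rfl
      have h4 : 0 ≤ Φ x := by positivity
      simp only [e1, e2] at h3 ⊢
      refine h3.trans ?_
      have : C * ((0 : ℝ) ^ 2 + 0) = 0 := by ring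
      rw [this]
      positivity
  have hlim : ∀ ε > 0, bellC δ / 4 * |∑ i, ∫ x, riesz d α i f x * g i x ∂(wMeasure d α)|
      ≤ ∫ x, (bellJet δ ε U V).v x 0 ∂(wMeasure d α) := by
    intro ε hε
    have t1 := ((tendsto_finsetSum Finset.univ fun i _ =>
      tendsto_integral_vx_mul_vt hα i hf (hg i)).abs).const_mul (bellC δ)
    have t2 := (bellJet_integral h0 h1 hε hU hV).2.2.add_const
      (∫ x, (bellJet δ ε U V).v x 0 ∂(wMeasure d α))
    rw [zero_add] at t2
    have := le_of_tendsto_of_tendsto t1 t2 (by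
      filter_upwards [eventually_gt_atTop 0] with T hT
      exact abs_integral_vx_mul_vt_le hα h0 h1 hε hU hV
        (fun i => integrable_poissonJet_vx_sq hα i hd (rapid_ht hα hf))
        (fun i => integrable_conjJet_vt_sq hα i hd (rapid_conjHat hα i (hg i))) hT)
    refine le_trans (le_of_eq ?_) this
    rw [← Finset.mul_sum, abs_mul, abs_neg, abs_of_pos (by norm_num : (0 : ℝ) < 1 / 4)]
    ring
  have t3 : Tendsto (fun ε : ℝ => (1 + 3 / 40 * δ) * (∫ x, |f x| ^ ((1 + δ) / δ) ∂(wMeasure d α)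
        + ∫ x, (∑ i, g i x ^ 2) ^ ((1 + δ) / 2) ∂(wMeasure d α))
        + 3 / 40 * δ * ε ^ (1 + δ) * ∫ x, Φ x ∂(wMeasure d α)) (nhdsWithin 0 (Ioi 0))
      (nhds ((1 + 3 / 40 * δ) * (∫ x, |f x| ^ ((1 + δ) / δ) ∂(wMeasure d α)
        + ∫ x, (∑ i, g i x ^ 2) ^ ((1 + δ) / 2) ∂(wMeasure d α)))) := by
    have hpow : Continuous fun ε : ℝ => ε ^ (1 + δ) :=
      continuous_id.rpow_const fun _ => Or.inr (by linarith)
    have : Continuous fun ε : ℝ => (1 + 3 / 40 * δ) * (∫ x, |f x| ^ ((1 + δ) / δ) ∂(wMeasure d α)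
        + ∫ x, (∑ i, g i x ^ 2) ^ ((1 + δ) / 2) ∂(wMeasure d α))
        + 3 / 40 * δ * ε ^ (1 + δ) * ∫ x, Φ x ∂(wMeasure d α) := by fun_prop
    have h := (this.tendsto 0).mono_left (nhdsWithin_le_nhds (s := Ioi 0))
    simpa [Real.zero_rpow (by linarith : 1 + δ ≠ 0)] using h
  refine ge_of_tendsto t3 ?_
  filter_upwards [self_mem_nhdsWithin] with ε hε
  exact (hlim ε hε).trans (hzero ε hε)

end

lemma riesz_const_mul (d : ℕ) (α : Fin d → ℝ) (i : Fin d) (c : ℝ) (f : (Fin d → ℝ) → ℝ)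
    (x : Fin d → ℝ) : riesz d α i (fun y => c * f y) x = c * riesz d α i f x := by
  have h (β : Fin d → ℝ) (F : (Fin d → ℝ) → ℝ) (y : Fin d → ℝ) :
      hankel d β (fun z => c * F z) y = c * hankel d β F y := by
    unfold hankel
    rw [← integral_const_mul]
    congr 1; ext z; ring
  unfold riesz
  simp only [h]
  rw [mul_left_comm c, ← h]
  congr 2; ext y; ring

lemma div_bellC_le {δ : ℝ} (h0 : 0 < δ) :
    4 * (1 + 3 / 40 * δ) / bellC δ
      ≤ 2 * ((1 + (1 + δ) * δ / 8) / ((1 + δ) * δ / 8)) := by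
  unfold bellC
  rw [← mul_div_assoc, div_le_div_iff₀ (by positivity) (by positivity)]
  have : 0 ≤ δ * (2 * (1 + (1 + δ) * δ / 8) * (9 / 25 + 6 / 25 * δ)
      - 4 * (1 + 3 / 40 * δ) * ((1 + δ) / 8)) := by
    refine mul_nonneg h0.le ?_
    nlinarith [pow_pos h0 3, sq_nonneg δ]
  linarith

/-- Optimisation of `l ^ p * a + l ^ (-q) * b` over the scaling parameter `l`. -/
lemma le_of_forall_scaling {p q N K a b : ℝ} (hpq : p.HolderConjugate q) (hK : 0 ≤ K)
    (ha : 0 ≤ a) (hb : 0 ≤ b) (h : ∀ l > 0, N ≤ K * (l ^ p * a + l ^ (-q) * b)) :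
    N ≤ K * ((p / q) ^ (1 / p) + (q / p) ^ (1 / q)) * a ^ (1 / p) * b ^ (1 / q) := by
  have hp := hpq.pos
  have hq := hpq.symm.pos
  have e := hpq.inv_add_inv_eq_one
  have hpos : ∀ a b : ℝ, 0 < a → 0 < b → (∀ l > 0, N ≤ K * (l ^ p * a + l ^ (-q) * b)) →
      N ≤ K * ((p / q) ^ (1 / p) + (q / p) ^ (1 / q)) * a ^ (1 / p) * b ^ (1 / q) := by
    intro a b ha hb h
    set r := q * b / (p * a) with hr
    have hr0 : 0 < r := by positivity
    have h1 := h (r ^ (1 / (p * q))) (by positivity)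
    rw [← rpow_mul hr0.le, ← rpow_mul hr0.le] at h1
    have e1 : 1 / (p * q) * p = 1 / q := by field_simp
    have e2 : 1 / (p * q) * -q = -(1 / p) := by field_simp
    have e3 : r ^ (1 / q) * a = (q / p) ^ (1 / q) * a ^ (1 / p) * b ^ (1 / q) := by
      have : r = q / p * b / a := by rw [hr]; field_simp
      rw [this, div_rpow (by positivity) ha.le, mul_rpow (by positivity) hb.le]
      have : a = a ^ (1 / p) * a ^ (1 / q) := by
        rw [← rpow_add ha, one_div, one_div, e, rpow_one]
      have h2 : 0 < a ^ (1 / q) := by positivity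
      rw [div_mul_eq_mul_div, div_eq_iff h2.ne']
      calc _ = (q / p) ^ (1 / q) * b ^ (1 / q) * (a ^ (1 / p) * a ^ (1 / q)) := by rw [← this]
        _ = _ := by ring
    have e4 : r ^ (-(1 / p)) * b = (p / q) ^ (1 / p) * a ^ (1 / p) * b ^ (1 / q) := by
      have : r⁻¹ = p / q * a / b := by rw [hr]; field_simp
      rw [rpow_neg hr0.le, ← inv_rpow hr0.le, this, div_rpow (by positivity) hb.le,
        mul_rpow (by positivity) ha.le]
      have : b = b ^ (1 / p) * b ^ (1 / q) := by
        rw [← rpow_add hb, one_div, one_div, e, rpow_one]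
      have h2 : 0 < b ^ (1 / p) := by positivity
      rw [div_mul_eq_mul_div, div_eq_iff h2.ne']
      calc _ = (p / q) ^ (1 / p) * a ^ (1 / p) * (b ^ (1 / p) * b ^ (1 / q)) := by rw [← this]
        _ = _ := by ring
    rw [e1, e2, e3, e4] at h1
    exact h1.trans (le_of_eq (by ring))
  have hip : 0 < 1 / p := by positivity
  have hiq : 0 < 1 / q := by positivity
  have hc : Continuous fun s : ℝ => K * ((p / q) ^ (1 / p) + (q / p) ^ (1 / q)) *
      (a + s) ^ (1 / p) * (b + s) ^ (1 / q) := by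
    have c1 : Continuous fun s : ℝ => (a + s) ^ (1 / p) :=
      (continuous_const.add continuous_id).rpow_const fun _ => Or.inr hip.le
    have c2 : Continuous fun s : ℝ => (b + s) ^ (1 / q) :=
      (continuous_const.add continuous_id).rpow_const fun _ => Or.inr hiq.le
    fun_prop
  have ht := (hc.tendsto 0).mono_left (nhdsWithin_le_nhds (s := Ioi 0))
  simp only [add_zero] at ht
  refine ge_of_tendsto ht ?_
  filter_upwards [self_mem_nhdsWithin] with s hs
  have hs : 0 < s := hs
  refine hpos _ _ (by positivity) (by positivity) fun l hl => (h l hl).trans ?_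
  gcongr <;> linarith

lemma toReal_eLpNorm_eq {Ω : Type*} [MeasurableSpace Ω] {μ : Measure Ω} {F : Ω → ℝ} {p : ℝ}
    (hp : 0 < p) (hF : AEStronglyMeasurable F μ) :
    (eLpNorm F (ENNReal.ofReal p) μ).toReal = (∫ x, |F x| ^ p ∂μ) ^ (1 / p) := by
  rw [eLpNorm_eq_lintegral_rpow_enorm_toReal (by simpa using hp) ENNReal.ofReal_ne_top,
    ENNReal.toReal_ofReal hp.le, ← ENNReal.toReal_rpow,
    integral_eq_lintegral_of_nonneg_ae (Eventually.of_forall fun _ => by positivity)]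
  · congr 3; ext x
    rw [← ENNReal.ofReal_rpow_of_nonneg (abs_nonneg _) hp.le, ← Real.norm_eq_abs,
      ofReal_norm]
  · exact ((hF.norm.aemeasurable).pow_const p).aestronglyMeasurable

lemma riesz_pairing_le {d : ℕ} {α : Fin d → ℝ} {δ : ℝ} (hd : 0 < d) (hα : ∀ j, 0 ≤ α j)
    (h0 : 0 < δ) (h1 : δ ≤ 1) {f : (Fin d → ℝ) → ℝ} (hf : CcInfPos d f)
    {g : Fin d → (Fin d → ℝ) → ℝ} (hg : ∀ i, CcInfPos d (g i)) {l : ℝ} (hl : 0 < l) :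
    |∑ i, ∫ x, riesz d α i f x * g i x ∂(wMeasure d α)|
      ≤ 4 * (1 + 3 / 40 * δ) / bellC δ *
        (l ^ ((1 + δ) / δ) * ∫ x, |f x| ^ ((1 + δ) / δ) ∂(wMeasure d α)
          + l ^ (-(1 + δ)) * ∫ x, (∑ i, g i x ^ 2) ^ ((1 + δ) / 2) ∂(wMeasure d α)) := by
  have hc : 0 < bellC δ := by unfold bellC; positivity
  have key := riesz_sum_le hd hα h0 h1 (hf.const_mul l) fun i => (hg i).const_mul l⁻¹
  have e1 (i : Fin d) (x : Fin d → ℝ) :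
      riesz d α i (fun y => l * f y) x * (l⁻¹ * g i x) = riesz d α i f x * g i x := by
    rw [riesz_const_mul]; field_simp
  have e2 (x : Fin d → ℝ) : |l * f x| ^ ((1 + δ) / δ)
      = l ^ ((1 + δ) / δ) * |f x| ^ ((1 + δ) / δ) := by
    rw [abs_mul, abs_of_pos hl, mul_rpow hl.le (abs_nonneg _)]
  have e3 (x : Fin d → ℝ) : (∑ i, (l⁻¹ * g i x) ^ 2) ^ ((1 + δ) / 2)
      = l ^ (-(1 + δ)) * (∑ i, g i x ^ 2) ^ ((1 + δ) / 2) := by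
    simp only [mul_pow, ← Finset.mul_sum]
    rw [mul_rpow (by positivity) (Finset.sum_nonneg fun _ _ => sq_nonneg _),
      ← rpow_natCast, ← rpow_mul (by positivity), rpow_neg hl.le, ← inv_rpow hl.le]
    congr 2; push_cast; ring
  simp only [e1, e2, e3, integral_const_mul] at key
  rw [div_mul_eq_mul_div, le_div_iff₀ hc]
  linarith

/-- Bilinear dimension free estimate for the Bessel–Riesz transforms. -/
theorem bessel_riesz_bilinear_estimate (d : ℕ) (α : Fin d → ℝ)
    (hα : ∀ j, 0 ≤ α j) (p : ℝ) (hp : 2 ≤ p)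
    (f : (Fin d → ℝ) → ℝ) (hf : CcInfPos d f)
    (g : Fin d → (Fin d → ℝ) → ℝ) (hg : ∀ i, CcInfPos d (g i))
    (hg0 : ∀ i x, 0 ≤ g i x) :
    |∑ i, ∫ x, riesz d α i f x * g i x ∂(wMeasure d α)| ≤
      2 * ((1 + (p / (p - 1)) * (p / (p - 1) - 1) / 8) /
            ((p / (p - 1)) * (p / (p - 1) - 1) / 8)) *
        ((p / (p / (p - 1))) ^ (1 / p) + ((p / (p - 1)) / p) ^ (1 / (p / (p - 1)))) *
        (eLpNorm f (ENNReal.ofReal p) (wMeasure d α)).toReal *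
        (eLpNorm (fun x => Real.sqrt (∑ i, (g i x) ^ 2))
          (ENNReal.ofReal (p / (p - 1))) (wMeasure d α)).toReal := by
  rcases Nat.eq_zero_or_pos d with rfl | hd
  · simp only [Finset.univ_eq_empty, Finset.sum_empty, abs_zero]
    have h1 : 0 < p - 1 := by linarith
    have h2 : 0 ≤ p / (p - 1) - 1 := by
      rw [sub_nonneg, le_div_iff₀ h1]; linarith
    positivity
  have hpq : p.HolderConjugate (p / (p - 1)) := .conjExponent (by linarith)
  set q := p / (p - 1)
  obtain ⟨δ, hδ⟩ : ∃ δ, δ = q - 1 := ⟨_, rfl⟩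
  have hq : q = 1 + δ := by linarith
  have hδ' : δ = 1 / (p - 1) := by
    have : p - 1 ≠ 0 := by linarith
    rw [hδ]; simp only [q]; field_simp; ring
  have h0 : 0 < δ := by rw [hδ']; exact one_div_pos.2 (by linarith)
  have h1 : δ ≤ 1 := by rw [hδ', div_le_one (by linarith)]; linarith
  have hp' : p = (1 + δ) / δ := by
    have : p - 1 ≠ 0 := by linarith
    rw [hδ']; field_simp; ring
  have hgs : Continuous fun x => √(∑ i, g i x ^ 2) :=
    (continuous_finsetSum _ fun i _ => (hg i).continuous.pow 2).sqrt
  have hγ : 2 * ((1 + q * (q - 1) / 8) / (q * (q - 1) / 8))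
      = 2 * ((1 + (1 + δ) * δ / 8) / ((1 + δ) * δ / 8)) := by rw [hq]; ring_nf
  have eg : ∀ x, |√(∑ i, g i x ^ 2)| ^ q = (∑ i, g i x ^ 2) ^ ((1 + δ) / 2) := by
    intro x
    rw [abs_of_nonneg (sqrt_nonneg _), sqrt_eq_rpow,
      ← rpow_mul (Finset.sum_nonneg fun _ _ => sq_nonneg _), hq]
    congr 1; ring
  rw [toReal_eLpNorm_eq hpq.pos hf.continuous.aestronglyMeasurable,
    toReal_eLpNorm_eq hpq.symm.pos hgs.aestronglyMeasurable, hγ]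
  simp only [eg]
  refine le_of_forall_scaling hpq (by positivity)
    (integral_nonneg fun _ => by positivity)
    (integral_nonneg fun x => rpow_nonneg (Finset.sum_nonneg fun _ _ => sq_nonneg _) _)
    fun l hl => (riesz_pairing_le hd hα h0 h1 hf hg hl).trans ?_
  refine (mul_le_mul_of_nonneg_right (div_bellC_le h0) ?_).trans
    (by rw [← hp', ← hq])
  rw [← hp', ← hq]
  refine add_nonneg (mul_nonneg (by positivity) (integral_nonneg fun _ => by positivity))
    (mul_nonneg (by positivity)
      (integral_nonneg fun x => rpow_nonneg (Finset.sum_nonneg fun _ _ => sq_nonneg _) _))
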